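/- arXiv:math/9201272 — 9 statements merged into one kernel-verified Lean document; each statement's English description precedes it below -/
import Mathlib

section
/- Let f be holomorphic on a neighborhood of 0 in ℂ with f(0) = 0 and λ = f'(0), where λ ≠ 0 and λ^k ≠ 1 for every integer k ≥ 1. Suppose φ and ψ are holomorphic on neighborhoods of 0 with φ(0) = ψ(0) = 0, φ'(0) ≠ 0, ψ'(0) ≠ 0, and φ(f(z)) = λ·φ(z) and ψ(f(z)) = λ·ψ(z) for all z in some neighborhood of 0. Then there exists a nonzero constant c ∈ ℂ such that ψ(z) = c · φ(z) for all z in some neighborhood of 0. -/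
open Filter Topology

/-- An analytic solution `h` of `h ∘ f = λ h` near a fixed point of `f` with multiplier `λ`,
where `λ` is neither zero nor a root of unity, vanishes identically near the fixed point as soon as
`h` and `h'` vanish there. -/
theorem eventually_eq_zero_of_comp_eq_mul {f h : ℂ → ℂ} {lam : ℂ}
    (hf : HasDerivAt f lam 0) (hf0 : f 0 = 0) (hlam0 : lam ≠ 0)
    (hroot : ∀ k : ℕ, 1 ≤ k → lam ^ k ≠ 1)
    (hh : AnalyticAt ℂ h 0) (hh0 : h 0 = 0) (hh' : HasDerivAt h 0 0)
    (heq : ∀ᶠ z in 𝓝 (0 : ℂ), h (f z) = lam * h z) :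
    ∀ᶠ z in 𝓝 (0 : ℂ), h z = 0 := by
  by_contra hne
  obtain ⟨n, g, hg, hg0, hgh⟩ := hh.exists_eventuallyEq_pow_smul_nonzero_iff.mpr hne
  simp only [sub_zero, smul_eq_mul] at hgh
  have hn0 : n ≠ 0 := by
    rintro rfl
    exact hg0 (by simpa [hh0] using hgh.self_of_nhds.symm)
  have hn1 : n ≠ 1 := by
    rintro rfl
    have hd : HasDerivAt (fun z => z ^ 1 * g z) (g 0) 0 := by
      simpa using (hasDerivAt_id' (0 : ℂ)).fun_mul hg.differentiableAt.hasDerivAt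
    exact hg0 ((hd.congr_of_eventuallyEq hgh).unique hh')
  have hft : Tendsto f (𝓝 0) (𝓝 0) := by
    simpa [hf0] using hf.continuousAt.tendsto
  have hslope : Tendsto (fun z => f z / z) (𝓝[≠] 0) (𝓝 lam) := by
    refine (hasDerivAt_iff_tendsto_slope.mp hf).congr fun z => ?_
    simp [slope_def_field, hf0]
  have hl : Tendsto (fun z => (f z / z) ^ n * g (f z)) (𝓝[≠] 0) (𝓝 (lam ^ n * g 0)) :=
    (hslope.pow n).mul ((hg.continuousAt.tendsto.comp hft).mono_left nhdsWithin_le_nhds)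
  have hr : Tendsto (fun z => lam * g z) (𝓝[≠] 0) (𝓝 (lam * g 0)) :=
    (hg.continuousAt.tendsto.mono_left nhdsWithin_le_nhds).const_mul lam
  have hquot : (fun z => (f z / z) ^ n * g (f z)) =ᶠ[𝓝[≠] 0] fun z => lam * g z := by
    filter_upwards [nhdsWithin_le_nhds heq, nhdsWithin_le_nhds hgh,
      nhdsWithin_le_nhds (hft.eventually hgh), self_mem_nhdsWithin] with z h₁ h₂ h₃ hz
    have hz0 : z ≠ 0 := hz
    rw [h₂, h₃] at h₁
    rw [div_pow, div_mul_eq_mul_div, div_eq_iff (pow_ne_zero n hz0), h₁]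
    ring
  have hpow : lam ^ n = lam :=
    mul_right_cancel₀ hg0 (tendsto_nhds_unique (hl.congr' hquot) hr)
  refine hroot (n - 1) (by omega) (mul_right_cancel₀ hlam0 ?_)
  rw [← pow_succ, Nat.sub_add_cancel (by omega), hpow, one_mul]

/-- Uniqueness in the Kœnigs Linearization Theorem: if `λ = f'(0)` is nonzero and not
a root of unity, then any two linearizing coordinates `φ`, `ψ` (with nonvanishing
derivative at `0`) differ by multiplication by a nonzero constant near `0`. -/
theorem koenigs_unique (f : ℂ → ℂ) (hf : AnalyticAt ℂ f 0) (hf0 : f 0 = 0)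
    (lam : ℂ) (hlam : deriv f 0 = lam) (hlam0 : lam ≠ 0)
    (hroot : ∀ k : ℕ, 1 ≤ k → lam ^ k ≠ 1)
    (φ ψ : ℂ → ℂ) (hφ : AnalyticAt ℂ φ 0) (hψ : AnalyticAt ℂ ψ 0)
    (hφ0 : φ 0 = 0) (hψ0 : ψ 0 = 0)
    (hφ' : deriv φ 0 ≠ 0) (hψ' : deriv ψ 0 ≠ 0)
    (hφeq : ∀ᶠ z in 𝓝 (0 : ℂ), φ (f z) = lam * φ z)
    (hψeq : ∀ᶠ z in 𝓝 (0 : ℂ), ψ (f z) = lam * ψ z) :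
    ∃ c : ℂ, c ≠ 0 ∧ ∀ᶠ z in 𝓝 (0 : ℂ), ψ z = c * φ z := by
  refine ⟨deriv ψ 0 / deriv φ 0, div_ne_zero hψ' hφ', ?_⟩
  set c := deriv ψ 0 / deriv φ 0 with hc
  have hd : HasDerivAt (fun z => ψ z - c * φ z) 0 0 := by
    have := hψ.differentiableAt.hasDerivAt.sub (hφ.differentiableAt.hasDerivAt.const_mul c)
    rwa [hc, div_mul_cancel₀ _ hφ', sub_self] at this
  have hz := eventually_eq_zero_of_comp_eq_mul (h := fun z => ψ z - c * φ z)
    (hlam ▸ hf.differentiableAt.hasDerivAt) hf0 hlam0 hroot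
    (hψ.sub (analyticAt_const.mul hφ)) (by simp [hφ0, hψ0]) hd (by
      filter_upwards [hφeq, hψeq] with z h₁ h₂
      rw [h₁, h₂]
      ring)
  exact hz.mono fun z => sub_eq_zero.mp
end

section
/- Let f be holomorphic on a neighborhood of 0 in ℂ such that f(0) = 0 and the power series of f at 0 has the form f(z) = aₙ zⁿ + a_{n+1} z^{n+1} + ⋯ with n ≥ 2 and aₙ ≠ 0 (i.e., the k-th derivative of f at 0 vanishes for 0 ≤ k < n, and the n-th derivative does not). Then there exists a function φ holomorphic on some neighborhood of 0 with φ(0) = 0 and φ'(0) ≠ 0 such that φ(f(z)) = (φ(z))ⁿ for all z in some neighborhood of 0. -/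
open Filter Topology

/-- If `f` and `h` are holomorphic near `0` and `f` does not increase the modulus there, then the
cohomological equation `c * ψ - ψ ∘ f = h` with `1 < ‖c‖` has a holomorphic solution near `0`. -/
lemma exists_analyticAt_mul_sub_comp_eq {f h : ℂ → ℂ} {c : ℂ} (hf : AnalyticAt ℂ f 0)
    (hh : AnalyticAt ℂ h 0) (hle : ∀ᶠ z in 𝓝 (0 : ℂ), ‖f z‖ ≤ ‖z‖) (hc : 1 < ‖c‖) :
    ∃ ψ : ℂ → ℂ, AnalyticAt ℂ ψ 0 ∧ ∀ᶠ z in 𝓝 (0 : ℂ), c * ψ z - ψ (f z) = h z := by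
  obtain ⟨M, hM⟩ : ∃ M : ℝ, ∀ᶠ z in 𝓝 (0 : ℂ), ‖h z‖ ≤ M :=
    ⟨‖h 0‖ + 1, hh.continuousAt.norm.eventually (eventually_le_nhds (lt_add_one _))⟩
  obtain ⟨r, hr, hball⟩ := Metric.eventually_nhds_iff_ball.1
    (((hf.eventually_analyticAt.and hh.eventually_analyticAt).and hle).and hM)
  have hmaps : Set.MapsTo f (Metric.ball 0 r) (Metric.ball 0 r) := fun z hz ↦ by
    have := (hball z hz).1.2
    rw [mem_ball_zero_iff] at hz ⊢
    exact this.trans_lt hz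
  have hfd : DifferentiableOn ℂ f (Metric.ball 0 r) := fun z hz ↦
    (hball z hz).1.1.1.differentiableAt.differentiableWithinAt
  have hhd : DifferentiableOn ℂ h (Metric.ball 0 r) := fun z hz ↦
    (hball z hz).1.1.2.differentiableAt.differentiableWithinAt
  have hiter : ∀ k, DifferentiableOn ℂ f^[k] (Metric.ball 0 r) := fun k ↦ by
    induction k with
    | zero => exact differentiableOn_id
    | succ k ih => exact ih.comp hfd hmaps
  have hc0 : c ≠ 0 := norm_pos_iff.1 (one_pos.trans hc)
  have hsum : Summable fun k : ℕ ↦ M * (‖c‖⁻¹) ^ (k + 1) :=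
    ((summable_nat_add_iff 1).2
      (summable_geometric_of_lt_one (by positivity) (inv_lt_one_of_one_lt₀ hc))).mul_left M
  have hbound : ∀ (k : ℕ), ∀ z ∈ Metric.ball (0 : ℂ) r,
      ‖h (f^[k] z) * (c⁻¹) ^ (k + 1)‖ ≤ M * (‖c‖⁻¹) ^ (k + 1) := fun k z hz ↦ by
    rw [norm_mul, norm_pow, norm_inv]
    exact mul_le_mul_of_nonneg_right (hball _ (hmaps.iterate k hz)).2 (by positivity)
  refine ⟨fun z ↦ ∑' k : ℕ, h (f^[k] z) * (c⁻¹) ^ (k + 1), ?_, ?_⟩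
  · exact (Complex.differentiableOn_tsum_of_summable_norm hsum
      (fun k ↦ (hhd.comp (hiter k) (hmaps.iterate k)).mul_const _) Metric.isOpen_ball
      hbound).analyticAt (Metric.ball_mem_nhds 0 hr)
  · filter_upwards [Metric.ball_mem_nhds (0 : ℂ) hr] with z hz
    have hz_sum : Summable fun k : ℕ ↦ h (f^[k] z) * (c⁻¹) ^ (k + 1) :=
      hsum.of_norm_bounded fun k ↦ hbound k z hz
    rw [hz_sum.tsum_eq_zero_add, mul_add, ← tsum_mul_left]
    have hterm : ∀ k : ℕ, c * (h (f^[k + 1] z) * (c⁻¹) ^ (k + 1 + 1)) =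
        h (f^[k] (f z)) * (c⁻¹) ^ (k + 1) := fun k ↦ by
      rw [Function.iterate_succ_apply, pow_succ _ (k + 1)]
      field_simp
    simp only [hterm, Function.iterate_zero, id_eq, zero_add, pow_one, add_sub_cancel_right]
    field_simp

/-- A holomorphic function that does not vanish at a point has a holomorphic logarithm nearby. -/
lemma AnalyticAt.exists_eventually_exp_eq {g : ℂ → ℂ} {z₀ : ℂ} (hg : AnalyticAt ℂ g z₀)
    (h0 : g z₀ ≠ 0) :
    ∃ h : ℂ → ℂ, AnalyticAt ℂ h z₀ ∧ ∀ᶠ z in 𝓝 z₀, Complex.exp (h z) = g z := by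
  refine ⟨fun z ↦ Complex.log (g z / g z₀) + Complex.log (g z₀), ?_, ?_⟩
  · refine AnalyticAt.add (AnalyticAt.clog (hg.div analyticAt_const h0) ?_) analyticAt_const
    simp [h0]
  · filter_upwards [hg.continuousAt.eventually_ne h0] with z hz
    rw [Complex.exp_add, Complex.exp_log (div_ne_zero hz h0), Complex.exp_log h0,
      div_mul_cancel₀ _ h0]

/-- Böttcher's Theorem (existence): if `f` is holomorphic near `0` with
`f z = aₙ zⁿ + ⋯`, `n ≥ 2`, `aₙ ≠ 0` (i.e. the derivatives of order `< n` vanish at `0`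
but the `n`-th does not), then there is a local holomorphic coordinate `φ` with
`φ 0 = 0`, `φ' 0 ≠ 0`, conjugating `f` to `w ↦ wⁿ` near `0`. -/
theorem boettcher_exists (f : ℂ → ℂ) (hf : AnalyticAt ℂ f 0) (hf0 : f 0 = 0)
    (n : ℕ) (hn : 2 ≤ n)
    (hvan : ∀ k < n, iteratedDeriv k f 0 = 0)
    (hnonvan : iteratedDeriv n f 0 ≠ 0) :
    ∃ φ : ℂ → ℂ, AnalyticAt ℂ φ 0 ∧ φ 0 = 0 ∧ deriv φ 0 ≠ 0 ∧
      ∀ᶠ z in 𝓝 (0 : ℂ), φ (f z) = (φ z) ^ n := by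
  have horder : analyticOrderAt f 0 = n :=
    (analyticOrderAt_eq_nat_iff_iteratedDeriv_eq_zero hf).2 ⟨hvan, hnonvan⟩
  obtain ⟨g, hg, hg0, hfg⟩ := hf.analyticOrderAt_eq_natCast.1 horder
  simp only [sub_zero, smul_eq_mul] at hfg
  obtain ⟨h, hh, hgh⟩ := hg.exists_eventually_exp_eq hg0
  have hle : ∀ᶠ z in 𝓝 (0 : ℂ), ‖f z‖ ≤ ‖z‖ := by
    have hcont : ContinuousAt (fun z ↦ ‖z ^ (n - 1) * g z‖) 0 :=
      ((continuousAt_id.pow (n - 1)).mul hg.continuousAt).norm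
    have hlt : ‖(0 : ℂ) ^ (n - 1) * g 0‖ < 1 := by
      simp [zero_pow (show n - 1 ≠ 0 by omega)]
    filter_upwards [hfg, hcont.eventually (eventually_le_nhds hlt)] with z hz hz1
    rw [hz, ← mul_pow_sub_one (by omega : n ≠ 0) z, mul_assoc, norm_mul]
    exact mul_le_of_le_one_right (norm_nonneg z) hz1
  obtain ⟨ψ, hψ, hψf⟩ := exists_analyticAt_mul_sub_comp_eq hf hh hle
    (c := n) (by rw [Complex.norm_natCast]; exact_mod_cast hn)
  refine ⟨fun z ↦ z * Complex.exp (ψ z), analyticAt_id.mul hψ.cexp, zero_mul _, ?_, ?_⟩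
  · have hd : HasDerivAt (fun z ↦ z * Complex.exp (ψ z)) _ 0 :=
      (hasDerivAt_id (0 : ℂ)).mul hψ.cexp.differentiableAt.hasDerivAt
    rw [hd.deriv]
    simp
  · filter_upwards [hfg, hgh, hψf] with z hz hgz hψz
    rw [mul_pow, ← Complex.exp_nat_mul, ← sub_add_cancel ((n : ℂ) * ψ z) (ψ (f z)), hψz,
      Complex.exp_add, hgz, ← mul_assoc, ← hz]
end

section
/- Let f be holomorphic on a neighborhood of 0 in ℂ with f(0) = 0 and with power series f(z) = aₙ zⁿ + a_{n+1} z^{n+1} + ⋯ at 0, where n ≥ 2 and aₙ ≠ 0. Suppose φ and ψ are holomorphic on neighborhoods of 0, each satisfying φ(0) = 0, φ'(0) ≠ 0, φ(f(z)) = (φ(z))ⁿ and ψ(0) = 0, ψ'(0) ≠ 0, ψ(f(z)) = (ψ(z))ⁿ for all z in some neighborhood of 0. Then there exists a constant c ∈ ℂ with c^{n-1} = 1 such that ψ(z) = c · φ(z) for all z in some neighborhood of 0. -/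
open Filter Topology

/-- An analytic function with a simple zero at `0` is `z` times an analytic function that does
not vanish at `0`. -/
lemma AnalyticAt.exists_eventually_eq_mul_of_deriv_ne_zero {φ : ℂ → ℂ} (hφ : AnalyticAt ℂ φ 0)
    (hφ0 : φ 0 = 0) (hφ' : deriv φ 0 ≠ 0) :
    ∃ u : ℂ → ℂ, AnalyticAt ℂ u 0 ∧ u 0 ≠ 0 ∧ ∀ᶠ z in 𝓝 (0 : ℂ), φ z = z * u z := by
  have h := (hφ.analyticOrderAt_eq_natCast (n := 1)).1
    (by exact_mod_cast hφ.analyticOrderAt_eq_one_of_zero_deriv_ne_zero hφ0 hφ')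
  simpa using h

/-- If `f` vanishes to order at least `2` at `0` and `k ∘ f = k ^ n` near `0` for an analytic `k`
with `k 0 ≠ 0`, where `n ≠ 0`, then `k` is constant near `0`. -/
lemma AnalyticAt.eventually_eq_of_comp_eq_pow {f k : ℂ → ℂ} {n : ℕ} (hf : AnalyticAt ℂ f 0)
    (hf0 : f 0 = 0) (hford : 2 ≤ analyticOrderAt f 0) (hn : n ≠ 0) (hk : AnalyticAt ℂ k 0)
    (hk0 : k 0 ≠ 0) (heq : ∀ᶠ z in 𝓝 (0 : ℂ), k (f z) = k z ^ n) :
    ∀ᶠ z in 𝓝 (0 : ℂ), k z = k 0 := by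
  set h : ℂ → ℂ := fun z => k z - k 0 with hh
  set T : ℂ → ℂ := fun z => ∑ i ∈ Finset.range n, k z ^ i * k 0 ^ (n - 1 - i) with hT
  have hkn : k 0 = k 0 ^ n := by simpa [hf0] using heq.self_of_nhds
  have hh_an : AnalyticAt ℂ h 0 := hk.sub analyticAt_const
  have hT_an : AnalyticAt ℂ T 0 := by fun_prop
  have hT0 : T 0 ≠ 0 := by
    have : T 0 = n * k 0 ^ (n - 1) := by
      have := Finset.sum_congr rfl fun i (hi : i ∈ Finset.range n) =>
        show k 0 ^ i * k 0 ^ (n - 1 - i) = k 0 ^ (n - 1) by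
          rw [← pow_add]; congr 1; have := Finset.mem_range.1 hi; omega
      simp [hT, this]
    rw [this]
    exact mul_ne_zero (Nat.cast_ne_zero.2 hn) (pow_ne_zero _ hk0)
  have hcomp : h ∘ f =ᶠ[𝓝 0] h * T := by
    filter_upwards [heq] with z hz
    have hgeom := (Commute.all (k z) (k 0)).mul_geom_sum₂ n
    simp only [hh, hT, Function.comp_apply, Pi.mul_apply, hz, hgeom]
    rw [← hkn]
  have hord := analyticOrderAt_congr hcomp
  rw [AnalyticAt.analyticOrderAt_comp (by rwa [hf0]) hf, hf0, analyticOrderAt_mul hh_an hT_an,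
    (hT_an.analyticOrderAt_eq_zero).2 hT0, add_zero] at hord
  simp only [sub_zero] at hord
  have htop : analyticOrderAt h 0 = ⊤ := by
    by_contra hne
    have hpos : analyticOrderAt h 0 ≠ 0 := hh_an.analyticOrderAt_ne_zero.2 (by simp [hh])
    have hle := mul_le_mul_right hford (analyticOrderAt h 0)
    obtain ⟨m, hm⟩ := ENat.ne_top_iff_exists.1 hne
    rw [hord, ← hm] at hle
    rw [← hm] at hpos
    norm_cast at hle hpos
    omega
  filter_upwards [analyticOrderAt_eq_top.1 htop] with z hz
  exact sub_eq_zero.1 hz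

/-- Böttcher's Theorem (uniqueness): any two Böttcher coordinates for `f` differ by
multiplication by an `(n-1)`-st root of unity. -/
theorem boettcher_unique (f : ℂ → ℂ) (hf : AnalyticAt ℂ f 0) (hf0 : f 0 = 0)
    (n : ℕ) (hn : 2 ≤ n)
    (hvan : ∀ k < n, iteratedDeriv k f 0 = 0)
    (hnonvan : iteratedDeriv n f 0 ≠ 0)
    (φ ψ : ℂ → ℂ) (hφ : AnalyticAt ℂ φ 0) (hψ : AnalyticAt ℂ ψ 0)
    (hφ0 : φ 0 = 0) (hψ0 : ψ 0 = 0)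
    (hφ' : deriv φ 0 ≠ 0) (hψ' : deriv ψ 0 ≠ 0)
    (hφeq : ∀ᶠ z in 𝓝 (0 : ℂ), φ (f z) = (φ z) ^ n)
    (hψeq : ∀ᶠ z in 𝓝 (0 : ℂ), ψ (f z) = (ψ z) ^ n) :
    ∃ c : ℂ, c ^ (n - 1) = 1 ∧ ∀ᶠ z in 𝓝 (0 : ℂ), ψ z = c * φ z := by
  have hford : 2 ≤ analyticOrderAt f 0 := by
    exact_mod_cast (natCast_le_analyticOrderAt_iff_iteratedDeriv_eq_zero (n := 2) hf).2
      fun k hk => hvan k (hk.trans_le hn)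
  obtain ⟨u, hu, hu0, hφu⟩ := hφ.exists_eventually_eq_mul_of_deriv_ne_zero hφ0 hφ'
  obtain ⟨v, hv, hv0, hψv⟩ := hψ.exists_eventually_eq_mul_of_deriv_ne_zero hψ0 hψ'
  have hft : Tendsto f (𝓝 0) (𝓝 0) := by simpa [hf0] using hf.continuousAt.tendsto
  have hk : AnalyticAt ℂ (fun z => v z / u z) 0 := hv.fun_div hu hu0
  have hk0 : v 0 / u 0 ≠ 0 := div_ne_zero hv0 hu0
  have hune : ∀ᶠ z in 𝓝 (0 : ℂ), u z ≠ 0 := hu.continuousAt.eventually_ne hu0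
  have hpunct : (fun z => v (f z) / u (f z)) =ᶠ[𝓝[≠] (0 : ℂ)] fun z => (v z / u z) ^ n := by
    filter_upwards [self_mem_nhdsWithin, nhdsWithin_le_nhds hune,
      nhdsWithin_le_nhds (hφu.and hψv), nhdsWithin_le_nhds (hft.eventually (hφu.and hψv)),
      nhdsWithin_le_nhds (hφeq.and hψeq)] with z hz huz ⟨hφz, hψz⟩ ⟨hφf, hψf⟩ ⟨hφe, hψe⟩
    have hz0 : z ≠ 0 := hz
    have hfz : f z ≠ 0 := by
      intro h0
      rw [h0, hφ0, hφz] at hφe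
      exact pow_ne_zero n (mul_ne_zero hz0 huz) hφe.symm
    rw [← mul_div_mul_left (v (f z)) (u (f z)) hfz, ← hφf, ← hψf, hφe, hψe, hφz, hψz, ← div_pow,
      mul_div_mul_left _ _ hz0]
  have hcomp : ∀ᶠ z in 𝓝 (0 : ℂ), v (f z) / u (f z) = (v z / u z) ^ n := by
    have hkf : ContinuousAt (fun z => v (f z) / u (f z)) 0 :=
      ContinuousAt.comp (f := f) (g := fun z => v z / u z) (by rw [hf0]; exact hk.continuousAt)
        hf.continuousAt
    exact (hkf.eventuallyEq_nhds_iff_eventuallyEq_nhdsNE (hk.continuousAt.pow n)).1 hpunct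
  have hconst := hf.eventually_eq_of_comp_eq_pow hf0 hford (by omega) hk hk0 hcomp
  refine ⟨v 0 / u 0, ?_, ?_⟩
  · have h0 : v 0 / u 0 = (v 0 / u 0) ^ n := by simpa [hf0] using hcomp.self_of_nhds
    obtain ⟨m, rfl⟩ : ∃ m, n = m + 1 := ⟨n - 1, by omega⟩
    refine mul_right_cancel₀ hk0 ?_
    rw [Nat.add_sub_cancel, ← pow_succ, ← h0, one_mul]
  · filter_upwards [hconst, hune, hφu, hψv] with z hz huz hφz hψz
    rw [hφz, hψz, ← hz]
    field_simp
end

section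
/- Let f be holomorphic and injective on a neighborhood N of 0 in ℂ with f(0) = 0, f'(0) = 1, and suppose the order of vanishing of z ↦ f(z) − z at 0 equals n + 1 with n ≥ 1 (i.e., f(z) = z + a z^{n+1} + ⋯ with a ≠ 0). Then there exist n pairwise disjoint attracting petals U₁, …, Uₙ for f at 0, a holomorphic local inverse g of f at 0 (g holomorphic near 0 with g(0) = 0 and f(g(w)) = w near 0), and n pairwise disjoint attracting petals U′₁, …, U′ₙ for g at 0 (the repelling petals of f), such that the union U₁ ∪ ⋯ ∪ Uₙ ∪ U′₁ ∪ ⋯ ∪ U′ₙ ∪ {0} is a neighborhood of 0. -/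
open Filter Topology Set

/-- `U` is an attracting petal for `f` at `0`, relative to a neighborhood `N` of `0`
(on which `f` is holomorphic and injective): `U` is a nonempty connected open set with
compact closure contained in `N ∩ f(N)`, such that `f` maps the closure of `U` into
`U ∪ {0}` and the intersection of the forward images of the closure of `U` is `{0}`. -/
def IsAttractingPetal (f : ℂ → ℂ) (N : Set ℂ) (U : Set ℂ) : Prop :=
  IsOpen U ∧ IsConnected U ∧ IsCompact (closure U) ∧ closure U ⊆ N ∩ (f '' N) ∧
  f '' closure U ⊆ U ∪ {0} ∧ (⋂ k : ℕ, f^[k] '' closure U) = {0}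

/-- A union of two open discs whose boundary circles pass through `0`; its image under `v ↦ v⁻¹`
is the region `R < re w + |im w|`. -/
def openBidisc (R : ℝ) : Set ℂ := {v | R * Complex.normSq v < v.re + |v.im|}

/-- The closed counterpart of `openBidisc`. -/
def closedBidisc (R : ℝ) : Set ℂ := {v | R * Complex.normSq v ≤ v.re + |v.im|}

/-- The branch `v ↦ ω v^{1/n}` of the inverse of `z ↦ z ^ n / ω ^ n`. -/
noncomputable def rootBranch (n : ℕ) (ω v : ℂ) : ℂ := ω * v ^ (n⁻¹ : ℂ)

lemma openBidisc_subset_closedBidisc (R : ℝ) : openBidisc R ⊆ closedBidisc R :=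
  fun v (h : R * Complex.normSq v < v.re + |v.im|) => h.le

lemma ne_zero_of_mem_openBidisc {R : ℝ} {v : ℂ} (h : v ∈ openBidisc R) : v ≠ 0 := by
  rintro rfl
  simp [openBidisc] at h

lemma zero_mem_closedBidisc (R : ℝ) : (0 : ℂ) ∈ closedBidisc R := by
  simp [closedBidisc]

lemma mem_openBidisc_of_mem_closedBidisc {R S : ℝ} (hRS : R < S) {v : ℂ}
    (h : v ∈ closedBidisc S) (hv : v ≠ 0) : v ∈ openBidisc R := by
  have := Complex.normSq_pos.2 hv
  have h' : S * Complex.normSq v ≤ v.re + |v.im| := h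
  change R * Complex.normSq v < v.re + |v.im|
  nlinarith

lemma mem_closedBidisc_iff {R : ℝ} {v : ℂ} (hv : v ≠ 0) :
    v ∈ closedBidisc R ↔ R ≤ (v⁻¹).re + |(v⁻¹).im| := by
  have := Complex.normSq_pos.2 hv
  rw [Complex.inv_re, Complex.inv_im, abs_div, abs_neg, abs_of_pos this, ← add_div,
    le_div_iff₀ this]
  rfl

lemma norm_mul_le_of_mem_closedBidisc {R : ℝ} {v : ℂ} (h : v ∈ closedBidisc R) :
    R * ‖v‖ ≤ 2 := by
  rcases eq_or_ne v 0 with rfl | hv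
  · simp
  have h' : R * Complex.normSq v ≤ v.re + |v.im| := h
  have h0 : 0 < ‖v‖ := norm_pos_iff.2 hv
  rw [Complex.normSq_eq_norm_sq] at h'
  have h1 := (le_abs_self _).trans (Complex.abs_re_le_norm v)
  have h2 := Complex.abs_im_le_norm v
  by_contra! hlt
  nlinarith

lemma isOpen_openBidisc (R : ℝ) : IsOpen (openBidisc R) :=
  isOpen_lt (continuous_const.mul Complex.continuous_normSq)
    (Complex.continuous_re.add Complex.continuous_im.abs)

lemma isCompact_closedBidisc {R : ℝ} (hR : 0 < R) : IsCompact (closedBidisc R) := by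
  refine Metric.isCompact_of_isClosed_isBounded ?_ ?_
  · exact isClosed_le (continuous_const.mul Complex.continuous_normSq)
      (Complex.continuous_re.add Complex.continuous_im.abs)
  · refine (Metric.isBounded_closedBall (x := (0 : ℂ)) (r := 2 / R)).subset fun v hv => ?_
    rw [mem_closedBall_zero_iff, le_div_iff₀' hR]
    exact norm_mul_le_of_mem_closedBidisc hv

lemma mem_ball_self_norm_iff {v p : ℂ} :
    v ∈ Metric.ball p ‖p‖ ↔ Complex.normSq v < 2 * (v.re * p.re + v.im * p.im) := by
  rw [mem_ball_iff_norm, ← sq_lt_sq₀ (norm_nonneg _) (norm_nonneg _),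
    ← Complex.normSq_eq_norm_sq, ← Complex.normSq_eq_norm_sq]
  simp only [Complex.normSq_apply, Complex.sub_re, Complex.sub_im]
  constructor <;> intro h <;> linarith

lemma openBidisc_eq_union {R : ℝ} (hR : 0 < R) :
    openBidisc R = Metric.ball ⟨1 / (2 * R), 1 / (2 * R)⟩ ‖(⟨1 / (2 * R), 1 / (2 * R)⟩ : ℂ)‖ ∪
      Metric.ball ⟨1 / (2 * R), -(1 / (2 * R))⟩ ‖(⟨1 / (2 * R), -(1 / (2 * R))⟩ : ℂ)‖ := by
  ext v
  rw [mem_union, mem_ball_self_norm_iff, mem_ball_self_norm_iff]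
  have e1 : 2 * (v.re * (1 / (2 * R)) + v.im * (1 / (2 * R))) = (v.re + v.im) / R := by
    field_simp
  have e2 : 2 * (v.re * (1 / (2 * R)) + v.im * -(1 / (2 * R))) = (v.re - v.im) / R := by
    field_simp
    ring
  simp only [e1, e2, lt_div_iff₀' hR]
  change R * Complex.normSq v < v.re + |v.im| ↔ _
  rcases abs_cases v.im with ⟨h, h'⟩ | ⟨h, h'⟩ <;> rw [h]
  · exact ⟨Or.inl, fun h => h.elim id fun h => by linarith⟩
  · exact ⟨fun h => Or.inr (by linarith),
      fun h => h.elim (fun h => by linarith) (fun h => by linarith)⟩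

lemma ofReal_mem_openBidisc {R t : ℝ} (h0 : 0 < t) (h : R * t < 1) : (t : ℂ) ∈ openBidisc R := by
  change R * Complex.normSq t < (t : ℂ).re + |(t : ℂ).im|
  simp only [Complex.normSq_ofReal, Complex.ofReal_re, Complex.ofReal_im, abs_zero, add_zero]
  nlinarith

lemma isConnected_openBidisc {R : ℝ} (hR : 0 < R) : IsConnected (openBidisc R) := by
  have hv : ∀ p : ℂ, p.re = 1 / (2 * R) → ((1 / (2 * R) : ℝ) : ℂ) ∈ Metric.ball p ‖p‖ := by
    intro p hp
    rw [mem_ball_self_norm_iff, Complex.normSq_ofReal, Complex.ofReal_re, Complex.ofReal_im, hp]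
    have : 0 < 1 / (2 * R) := by positivity
    nlinarith
  rw [openBidisc_eq_union hR]
  exact IsConnected.union ⟨_, hv _ rfl, hv _ rfl⟩
    ⟨⟨_, hv _ rfl⟩, (convex_ball _ _).isPreconnected⟩
    ⟨⟨_, hv _ rfl⟩, (convex_ball _ _).isPreconnected⟩

lemma abs_arg_le_of_mem_closedBidisc {R : ℝ} (hR : 0 < R) {v : ℂ} (h : v ∈ closedBidisc R)
    (hv : v ≠ 0) : |v.arg| ≤ 3 * Real.pi / 4 := by
  by_contra! hlt
  have hpi := Real.pi_pos
  have h' : R * Complex.normSq v ≤ v.re + |v.im| := h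
  have hpos := mul_pos hR (Complex.normSq_pos.2 hv)
  have hle := Complex.abs_arg_le_pi v
  have hcos : Real.cos (|v.arg| - Real.pi / 4) < 0 :=
    Real.cos_neg_of_pi_div_two_lt_of_lt (by linarith) (by linarith)
  rw [Real.cos_sub, Real.cos_pi_div_four, Real.sin_pi_div_four, Real.cos_abs,
    ← add_mul] at hcos
  have h2 : 0 < Real.sqrt 2 / 2 := by positivity
  have h3 : Real.cos v.arg + Real.sin |v.arg| < 0 := by
    by_contra! h4
    nlinarith
  have h4 : |Real.sin v.arg| = Real.sin |v.arg| := Real.abs_sin_eq_sin_abs_of_abs_le_pi hle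
  have h5 : v.re + |v.im| = ‖v‖ * (Real.cos v.arg + Real.sin |v.arg|) := by
    rw [← h4, mul_add, Complex.norm_mul_cos_arg, ← Complex.norm_mul_sin_arg v, abs_mul, abs_norm]
  have := norm_pos_iff.2 hv
  nlinarith

lemma mem_slitPlane_of_mem_closedBidisc {R : ℝ} (hR : 0 < R) {v : ℂ} (h : v ∈ closedBidisc R)
    (hv : v ≠ 0) : v ∈ Complex.slitPlane := by
  rw [Complex.mem_slitPlane_iff_arg]
  refine ⟨fun harg => ?_, hv⟩
  have := abs_arg_le_of_mem_closedBidisc hR h hv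
  rw [harg, abs_of_pos Real.pi_pos] at this
  linarith [Real.pi_pos]

lemma rootBranch_pow {n : ℕ} (hn : n ≠ 0) (ω v : ℂ) : rootBranch n ω v ^ n = ω ^ n * v := by
  rw [rootBranch, mul_pow, Complex.cpow_nat_inv_pow v hn]

lemma rootBranch_zero {n : ℕ} (hn : n ≠ 0) (ω : ℂ) : rootBranch n ω 0 = 0 := by
  simp [rootBranch, hn]

lemma continuousOn_rootBranch {n : ℕ} (hn : n ≠ 0) (ω : ℂ) {R : ℝ} (hR : 0 < R) :
    ContinuousOn (rootBranch n ω) (closedBidisc R) := by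
  intro v hv
  refine ContinuousAt.continuousWithinAt (continuousAt_const.mul ?_)
  rcases eq_or_ne v 0 with rfl | h0
  · have hre : (0 : ℝ) < ((n : ℂ)⁻¹).re := by
      rw [← Complex.ofReal_natCast, ← Complex.ofReal_inv, Complex.ofReal_re]
      positivity
    exact ContinuousAt.comp (f := fun x : ℂ => (x, ((n : ℂ)⁻¹)))
      (Complex.continuousAt_cpow_zero_of_re_pos hre)
      (continuousAt_id.prodMk continuousAt_const)
  · exact continuousAt_cpow_const (mem_slitPlane_of_mem_closedBidisc hR hv h0)

lemma isOpen_rootBranch_image {n : ℕ} (hn : n ≠ 0) {ω : ℂ} (hω : ω ≠ 0) {R : ℝ} (hR : 0 < R) :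
    IsOpen (rootBranch n ω '' openBidisc R) := by
  rw [isOpen_iff_mem_nhds]
  rintro _ ⟨v, hv, rfl⟩
  have hv0 := ne_zero_of_mem_openBidisc hv
  have hd := (Complex.hasStrictDerivAt_cpow_const (c := (n : ℂ)⁻¹)
    (mem_slitPlane_of_mem_closedBidisc hR (openBidisc_subset_closedBidisc R hv) hv0)).const_mul ω
  change _ ∈ 𝓝 ((fun v => ω * v ^ ((n : ℂ)⁻¹)) v)
  rw [← hd.map_nhds_eq]
  · exact image_mem_map ((isOpen_openBidisc R).mem_nhds hv)
  · have : (n : ℂ) ≠ 0 := by exact_mod_cast hn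
    simp [hω, Complex.cpow_eq_zero_iff, hv0, this]

lemma isCompact_rootBranch_image {n : ℕ} (hn : n ≠ 0) (ω : ℂ) {R : ℝ} (hR : 0 < R) :
    IsCompact (rootBranch n ω '' closedBidisc R) :=
  (isCompact_closedBidisc hR).image_of_continuousOn (continuousOn_rootBranch hn ω hR)

lemma closure_rootBranch_image_subset {n : ℕ} (hn : n ≠ 0) (ω : ℂ) {R : ℝ} (hR : 0 < R) :
    closure (rootBranch n ω '' openBidisc R) ⊆ rootBranch n ω '' closedBidisc R :=
  closure_minimal (image_mono (openBidisc_subset_closedBidisc R))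
    (isCompact_rootBranch_image hn ω hR).isClosed

lemma isConnected_rootBranch_image {n : ℕ} (hn : n ≠ 0) (ω : ℂ) {R : ℝ} (hR : 0 < R) :
    IsConnected (rootBranch n ω '' openBidisc R) :=
  (isConnected_openBidisc hR).image _
    ((continuousOn_rootBranch hn ω hR).mono (openBidisc_subset_closedBidisc R))

lemma zero_mem_closure_rootBranch_image {n : ℕ} (hn : n ≠ 0) (ω : ℂ) {R : ℝ} (hR : 0 < R) :
    (0 : ℂ) ∈ closure (rootBranch n ω '' openBidisc R) := by
  have h0 : (0 : ℂ) ∈ closure (openBidisc R) := by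
    have ht : Tendsto (fun t : ℝ => (t : ℂ)) (𝓝[>] 0) (𝓝 0) :=
      (Complex.continuous_ofReal.tendsto' 0 0 (by simp)).mono_left nhdsWithin_le_nhds
    refine mem_closure_of_tendsto ht ?_
    filter_upwards [Ioo_mem_nhdsGT (inv_pos.2 hR)] with t ht
    refine ofReal_mem_openBidisc ht.1 ?_
    have := (mul_lt_mul_iff_right₀ hR).2 ht.2
    rwa [mul_inv_cancel₀ hR.ne'] at this
  have hc := (continuousOn_rootBranch hn ω hR 0 (zero_mem_closedBidisc R)).mono
    (openBidisc_subset_closedBidisc R)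
  simpa [rootBranch_zero hn] using hc.mem_closure_image h0

/-- For large `R`, all branches map the closed bidisc into a prescribed neighborhood of `0`. -/
lemma exists_rootBranch_image_subset {n : ℕ} (hn : n ≠ 0) (c : ℂ) {V : Set ℂ} (hV : V ∈ 𝓝 0) :
    ∃ R₀ > 0, ∀ R ≥ R₀, ∀ ω : ℂ, ω ^ n = c → rootBranch n ω '' closedBidisc R ⊆ V := by
  obtain ⟨δ, hδ, hball⟩ := Metric.mem_nhds_iff.1 hV
  refine ⟨(2 * ‖c‖ + 1) / δ ^ n, by positivity, fun R hR ω hω => ?_⟩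
  rintro _ ⟨v, hv, rfl⟩
  refine hball (mem_ball_zero_iff.2 (lt_of_pow_lt_pow_left₀ n hδ.le ?_))
  rw [← norm_pow, rootBranch_pow hn, hω, norm_mul]
  have h1 := norm_mul_le_of_mem_closedBidisc hv
  have hδn : 0 < δ ^ n := by positivity
  have h2 : 2 * ‖c‖ + 1 ≤ R * δ ^ n := (div_le_iff₀ hδn).1 hR
  have hR0 : 0 < R := lt_of_lt_of_le (by positivity) hR
  have h3 := mul_le_mul_of_nonneg_left h1 (norm_nonneg c)
  by_contra! h4
  nlinarith

lemma tendsto_div_self_of_tendsto {f : ℂ → ℂ} {n : ℕ} (hn : n ≠ 0) {b : ℂ}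
    (hf : Tendsto (fun z => (f z - z) / z ^ (n + 1)) (𝓝[≠] 0) (𝓝 b)) :
    Tendsto (fun z => f z / z) (𝓝[≠] 0) (𝓝 1) := by
  have hz : Tendsto (fun z : ℂ => z ^ n) (𝓝[≠] 0) (𝓝 0) :=
    ((continuous_pow n).tendsto' 0 0 (by simp [hn])).mono_left nhdsWithin_le_nhds
  have := (hz.mul hf).const_add 1
  rw [zero_mul, add_zero] at this
  refine this.congr' ?_
  filter_upwards [self_mem_nhdsWithin] with z (hz : z ≠ 0)
  field_simp
  ring

/-- In the coordinate `w = c / z ^ n` the map is asymptotic to the translation by `1`. -/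
lemma tendsto_div_pow_sub_div_pow {f : ℂ → ℂ} {n : ℕ} (hn : n ≠ 0) {b c : ℂ}
    (hbc : n * b * c = -1)
    (hf : Tendsto (fun z => (f z - z) / z ^ (n + 1)) (𝓝[≠] 0) (𝓝 b)) :
    Tendsto (fun z => c / f z ^ n - c / z ^ n) (𝓝[≠] 0) (𝓝 1) := by
  have hq := tendsto_div_self_of_tendsto hn hf
  let G : ℂ → ℂ := fun x => (x ^ n)⁻¹
  have hG : HasDerivAt G (-n) 1 := by
    have h := (hasDerivAt_pow n (1 : ℂ)).fun_inv (by simp)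
    simp only [one_pow, mul_one, div_one] at h
    exact h
  have hD : Tendsto (dslope G 1) (𝓝 1) (𝓝 (-n)) := by
    have := (continuousAt_dslope_same.2 hG.differentiableAt).tendsto
    rwa [dslope_same, hG.deriv] at this
  have hlim := (hf.const_mul c).mul (hD.comp hq)
  rw [show c * b * -(n : ℂ) = 1 by linear_combination -hbc] at hlim
  refine hlim.congr' ?_
  filter_upwards [self_mem_nhdsWithin, hq.eventually_ne one_ne_zero] with z (hz : z ≠ 0) hqz
  have hfz : f z ≠ 0 := fun h => hqz (by simp [h])
  have hs : (f z / z - 1) * dslope G 1 (f z / z) = G (f z / z) - G 1 := sub_smul_dslope G 1 _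
  have e : (f z - z) / z ^ (n + 1) = (f z / z - 1) / z ^ n := by
    field_simp
    ring
  change c * ((f z - z) / z ^ (n + 1)) * dslope G 1 (f z / z) = _
  rw [e, mul_assoc, div_mul_eq_mul_div, hs]
  simp only [G, one_pow, div_pow]
  field_simp

lemma mul_pow_cpow_nat_inv {n : ℕ} (hn : n ≠ 0) {v q : ℂ} (hv : v ≠ 0) (hq : q ≠ 0)
    (h : |v.arg| + n * |q.arg| < Real.pi) :
    (v * q ^ n) ^ (n⁻¹ : ℂ) = v ^ (n⁻¹ : ℂ) * q := by
  have hn' : (n : ℂ) ≠ 0 := by exact_mod_cast hn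
  have him : (Complex.log v + n * Complex.log q).im = v.arg + n * q.arg := by
    simp [Complex.log_im]
  have habs : |v.arg + n * q.arg| < Real.pi := by
    refine (abs_add_le _ _).trans_lt ?_
    rwa [abs_mul, Nat.abs_cast]
  have hexp : v * q ^ n = Complex.exp (Complex.log v + n * Complex.log q) := by
    rw [Complex.exp_add, Complex.exp_nat_mul, Complex.exp_log hv, Complex.exp_log hq]
  have hlog : Complex.log (v * q ^ n) = Complex.log v + n * Complex.log q := by
    rw [hexp, Complex.log_exp]
    · rw [him]; exact (abs_lt.1 habs).1
    · rw [him]; exact (abs_lt.1 habs).2.le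
  rw [Complex.cpow_def_of_ne_zero (mul_ne_zero hv (pow_ne_zero n hq)),
    Complex.cpow_def_of_ne_zero hv, hlog, add_mul, Complex.exp_add]
  congr 1
  rw [mul_comm (n : ℂ), mul_assoc, mul_inv_cancel₀ hn', mul_one, Complex.exp_log hq]

/-- One step of the dynamics: `f` maps the part of the closed petal of size parameter `R` near `0`
into the closed petal of parameter `R + 1 / 2`. -/
lemma exists_nhds_map_rootBranch {f : ℂ → ℂ} {n : ℕ} (hn : n ≠ 0) {b c : ℂ}
    (hbc : n * b * c = -1) (hf0 : f 0 = 0)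
    (hf : Tendsto (fun z => (f z - z) / z ^ (n + 1)) (𝓝[≠] 0) (𝓝 b)) :
    ∃ V ∈ 𝓝 (0 : ℂ), ∀ R > 0, ∀ ω : ℂ, ω ^ n = c → ∀ v ∈ closedBidisc R,
      rootBranch n ω v ∈ V →
      f (rootBranch n ω v) ∈ rootBranch n ω '' closedBidisc (R + 1 / 2) := by
  have hc : c ≠ 0 := by
    rintro rfl
    simp at hbc
  have hnpos : (0 : ℝ) < n := by positivity
  have hq := tendsto_div_self_of_tendsto hn hf
  have harg : Tendsto (fun z => n * |(f z / z).arg|) (𝓝[≠] 0) (𝓝 0) := by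
    have h1 : ContinuousAt (fun x : ℂ => n * |x.arg|) 1 :=
      continuousAt_const.mul (Complex.continuousAt_arg Complex.one_mem_slitPlane).abs
    simpa [Function.comp_def] using h1.tendsto.comp hq
  have htr := Metric.tendsto_nhds.1 (tendsto_div_pow_sub_div_pow hn hbc hf) (1 / 4) (by norm_num)
  have hev : ∀ᶠ z in 𝓝[≠] (0 : ℂ), f z / z ≠ 0 ∧ n * |(f z / z).arg| < Real.pi / 4 ∧
      dist (c / f z ^ n - c / z ^ n) 1 < 1 / 4 :=
    (hq.eventually_ne one_ne_zero).and
      ((harg.eventually_lt_const (by positivity)).and htr)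
  rw [eventually_nhdsWithin_iff] at hev
  refine ⟨_, hev, fun R hR ω hω v hv hV => ?_⟩
  rcases eq_or_ne v 0 with rfl | hv0
  · rw [rootBranch_zero hn, hf0]
    exact ⟨0, zero_mem_closedBidisc _, rootBranch_zero hn ω⟩
  set z := rootBranch n ω v with hz
  have hzn : z ^ n = c * v := by rw [hz, rootBranch_pow hn, hω]
  have hz0 : z ≠ 0 := by
    intro h
    rw [h, zero_pow hn] at hzn
    exact mul_ne_zero hc hv0 hzn.symm
  obtain ⟨hq0, hqarg, hdist⟩ := hV hz0
  set q := f z / z with hqdef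
  have hfz : f z = z * q := by rw [hqdef]; field_simp
  have hv' : v * q ^ n ≠ 0 := mul_ne_zero hv0 (pow_ne_zero n hq0)
  refine ⟨v * q ^ n, ?_, ?_⟩
  · rw [mem_closedBidisc_iff hv0] at hv
    rw [mem_closedBidisc_iff hv']
    have e : c / f z ^ n - c / z ^ n - 1 = (v * q ^ n)⁻¹ - v⁻¹ - 1 := by
      rw [hfz, mul_pow, hzn]
      field_simp
    rw [dist_eq_norm, e] at hdist
    have hre := (Complex.abs_re_le_norm _).trans_lt hdist
    have him := (Complex.abs_im_le_norm _).trans_lt hdist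
    simp only [Complex.sub_re, Complex.sub_im, Complex.one_re, Complex.one_im, sub_zero] at hre him
    have h1 := (abs_lt.1 hre).1
    have h2 := abs_sub_abs_le_abs_sub (v⁻¹).im ((v * q ^ n)⁻¹).im
    rw [abs_sub_comm] at h2
    linarith
  · have hle := abs_arg_le_of_mem_closedBidisc hR hv hv0
    rw [hfz, hz, rootBranch, rootBranch, mul_pow_cpow_nat_inv hn hv0 hq0 (by linarith), mul_assoc]

/-- For large `R`, each branch of the root maps the open bidisc onto an attracting petal. -/
theorem exists_isAttractingPetal_rootBranch {f : ℂ → ℂ} {N : Set ℂ} {n : ℕ} (hn : n ≠ 0)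
    {b c : ℂ} (hbc : n * b * c = -1) (hf0 : f 0 = 0) (hN : N ∩ f '' N ∈ 𝓝 0)
    (hf : Tendsto (fun z => (f z - z) / z ^ (n + 1)) (𝓝[≠] 0) (𝓝 b)) :
    ∃ R₀ > 0, ∀ R ≥ R₀, ∀ ω : ℂ, ω ^ n = c →
      IsAttractingPetal f N (rootBranch n ω '' openBidisc R) := by
  have hc : c ≠ 0 := by
    rintro rfl
    simp at hbc
  obtain ⟨V, hV, hstep⟩ := exists_nhds_map_rootBranch hn hbc hf0 hf
  obtain ⟨R₀, hR₀, hsub⟩ := exists_rootBranch_image_subset hn c (inter_mem hV hN)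
  refine ⟨R₀, hR₀, fun R hR ω hω => ?_⟩
  have hRpos : 0 < R := lt_of_lt_of_le hR₀ hR
  have hω0 : ω ≠ 0 := by
    rintro rfl
    exact hc (by rw [← hω, zero_pow hn])
  have hcl := closure_rootBranch_image_subset hn ω hRpos
  have hmap : ∀ S ≥ R, f '' (rootBranch n ω '' closedBidisc S) ⊆
      rootBranch n ω '' closedBidisc (S + 1 / 2) := by
    rintro S hS _ ⟨_, ⟨v, hv, rfl⟩, rfl⟩
    exact hstep S (hRpos.trans_le hS) ω hω v hv
      (hsub S (hR.trans hS) ω hω (mem_image_of_mem _ hv)).1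
  have hiter : ∀ k : ℕ, f^[k] '' (rootBranch n ω '' closedBidisc R) ⊆
      rootBranch n ω '' closedBidisc (R + k / 2) := by
    intro k
    induction k with
    | zero => simp
    | succ k ih =>
      rw [Function.iterate_succ', image_comp]
      refine (image_mono ih).trans ((hmap _ ?_).trans_eq ?_)
      · have : (0 : ℝ) ≤ k / 2 := by positivity
        linarith
      · congr 2
        push_cast
        ring
  refine ⟨isOpen_rootBranch_image hn hω0 hRpos, isConnected_rootBranch_image hn ω hRpos,
    (isCompact_rootBranch_image hn ω hRpos).of_isClosed_subset isClosed_closure hcl,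
    fun z hz => (hsub R hR ω hω (hcl hz)).2, ?_, ?_⟩
  · refine (image_mono hcl).trans ((hmap R le_rfl).trans ?_)
    rintro _ ⟨v, hv, rfl⟩
    rcases eq_or_ne v 0 with rfl | hv0
    · exact Or.inr (rootBranch_zero hn ω)
    · exact Or.inl ⟨v, mem_openBidisc_of_mem_closedBidisc (by linarith) hv hv0, rfl⟩
  · refine Subset.antisymm (fun z hz => ?_) ?_
    · have hmem : ∀ k : ℕ, z ^ n / c ∈ closedBidisc (R + k / 2) := by
        intro k
        obtain ⟨v, hv, rfl⟩ := hiter k (image_mono hcl (mem_iInter.1 hz k))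
        rwa [rootBranch_pow hn, hω, mul_div_cancel_left₀ _ hc]
      by_contra hz0
      have hpos : 0 < ‖z ^ n / c‖ := norm_pos_iff.2 (div_ne_zero (pow_ne_zero n hz0) hc)
      obtain ⟨k, hk⟩ := exists_nat_gt (4 / ‖z ^ n / c‖)
      have h1 := norm_mul_le_of_mem_closedBidisc (hmem k)
      rw [div_lt_iff₀ hpos] at hk
      have := mul_pos hRpos hpos
      linarith
    · rw [singleton_subset_iff, mem_iInter]
      exact fun k => ⟨0, zero_mem_closure_rootBranch_image hn ω hRpos,
        Function.iterate_fixed hf0 k⟩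

lemma disjoint_rootBranch_image {n : ℕ} (hn : n ≠ 0) {c ω ω' : ℂ} (hc : c ≠ 0)
    (hω : ω ^ n = c) (hω' : ω' ^ n = c) (hne : ω ≠ ω') (R : ℝ) :
    Disjoint (rootBranch n ω '' openBidisc R) (rootBranch n ω' '' openBidisc R) := by
  rw [Set.disjoint_left]
  rintro _ ⟨v, hv, rfl⟩ ⟨v', -, h⟩
  have hpow := congrArg (· ^ n) h
  simp only [rootBranch_pow hn, hω, hω', mul_right_inj' hc] at hpow
  subst hpow
  refine hne (mul_right_cancel₀ ?_ h.symm)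
  simp [Complex.cpow_eq_zero_iff, ne_zero_of_mem_openBidisc hv]

lemma mem_openBidisc_or_neg_mem {R : ℝ} {v : ℂ} (hv : v ≠ 0) (h : R * ‖v‖ < 1) :
    v ∈ openBidisc R ∨ -v ∈ openBidisc R := by
  have hpos := norm_pos_iff.2 hv
  have hlt : R * Complex.normSq v < |v.re| + |v.im| := by
    rw [Complex.normSq_eq_norm_sq]
    nlinarith [Complex.norm_le_abs_re_add_abs_im v]
  rcases abs_cases v.re with ⟨h, -⟩ | ⟨h, -⟩ <;> rw [h] at hlt
  · exact Or.inl hlt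
  · refine Or.inr ?_
    change R * Complex.normSq (-v) < (-v).re + |(-v).im|
    simpa using hlt

lemma exists_mem_rootBranch_image {n : ℕ} (hn : n ≠ 0) {c z : ℂ} (hc : c ≠ 0) {R : ℝ}
    (h : z ^ n / c ∈ openBidisc R) :
    ∃ ω : ℂ, ω ^ n = c ∧ z ∈ rootBranch n ω '' openBidisc R := by
  have hv := ne_zero_of_mem_openBidisc h
  have hz : z ^ n ≠ 0 := fun h0 => hv (by simp [h0])
  have hr : (z ^ n / c) ^ (n⁻¹ : ℂ) ≠ 0 := by simp [Complex.cpow_eq_zero_iff, hv]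
  refine ⟨z / (z ^ n / c) ^ (n⁻¹ : ℂ), ?_, z ^ n / c, h, div_mul_cancel₀ _ hr⟩
  rw [div_pow, Complex.cpow_nat_inv_pow _ hn]
  field_simp

lemma exists_enumeration_roots {n : ℕ} (hn : n ≠ 0) {c : ℂ} (hc : c ≠ 0) :
    ∃ ω : Fin n → ℂ, Function.Injective ω ∧ (∀ i, ω i ^ n = c) ∧
      ∀ x, x ^ n = c → ∃ i, ω i = x := by
  have : NeZero n := ⟨hn⟩
  have hζ := Complex.isPrimitiveRoot_exp n hn
  set ζ := Complex.exp (2 * Real.pi * Complex.I / n)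
  obtain ⟨r, hr⟩ := IsAlgClosed.exists_pow_nat_eq c (Nat.pos_of_ne_zero hn)
  have hr0 : r ≠ 0 := by
    rintro rfl
    exact hc (by rw [← hr, zero_pow hn])
  refine ⟨fun i => r * ζ ^ (i : ℕ), fun i j hij => ?_, fun i => ?_, fun x hx => ?_⟩
  · exact Fin.ext (hζ.pow_inj i.2 j.2 (mul_left_cancel₀ hr0 hij))
  · rw [mul_pow, ← pow_mul, mul_comm (i : ℕ), pow_mul, hζ.pow_eq_one, one_pow, mul_one, hr]
  · obtain ⟨i, hi, h⟩ := hζ.eq_pow_of_pow_eq_one (ξ := x / r) (by rw [div_pow, hx, hr, div_self hc])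
    exact ⟨⟨i, hi⟩, by simp only [h]; field_simp⟩

lemma iUnion_rootBranch_image_mem_nhds {n : ℕ} (hn : n ≠ 0) {c : ℂ} (hc : c ≠ 0) (R : ℝ)
    {ω ω' : Fin n → ℂ} (hω : ∀ x, x ^ n = c → ∃ i, ω i = x)
    (hω' : ∀ x, x ^ n = -c → ∃ i, ω' i = x) :
    (⋃ i, rootBranch n (ω i) '' openBidisc R) ∪ (⋃ i, rootBranch n (ω' i) '' openBidisc R) ∪ {0}
      ∈ 𝓝 (0 : ℂ) := by
  have hlim : Tendsto (fun z : ℂ => R * ‖z ^ n / c‖) (𝓝 0) (𝓝 0) :=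
    Continuous.tendsto' (by fun_prop) _ _ (by simp [hn])
  filter_upwards [hlim.eventually_lt_const one_pos] with z hz
  rcases eq_or_ne z 0 with rfl | hz0
  · exact Or.inr rfl
  refine Or.inl ?_
  rcases mem_openBidisc_or_neg_mem (div_ne_zero (pow_ne_zero n hz0) hc) hz with h | h
  · obtain ⟨x, hx, hmem⟩ := exists_mem_rootBranch_image hn hc h
    obtain ⟨i, rfl⟩ := hω x hx
    exact Or.inl (mem_iUnion.2 ⟨i, hmem⟩)
  · rw [← div_neg] at h
    obtain ⟨x, hx, hmem⟩ := exists_mem_rootBranch_image hn (neg_ne_zero.2 hc) h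
    obtain ⟨i, rfl⟩ := hω' x hx
    exact Or.inr (mem_iUnion.2 ⟨i, hmem⟩)

lemma exists_tendsto_of_iteratedDeriv {f : ℂ → ℂ} {n : ℕ} (hf : AnalyticAt ℂ f 0)
    (hvan : ∀ k ≤ n, iteratedDeriv k (fun z => f z - z) 0 = 0)
    (hnonvan : iteratedDeriv (n + 1) (fun z => f z - z) 0 ≠ 0) :
    ∃ a ≠ 0, Tendsto (fun z => (f z - z) / z ^ (n + 1)) (𝓝[≠] 0) (𝓝 a) := by
  have han : AnalyticAt ℂ (fun z => f z - z) 0 := hf.sub analyticAt_id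
  have hord : analyticOrderAt (fun z => f z - z) 0 = (n + 1 : ℕ) :=
    (analyticOrderAt_eq_nat_iff_iteratedDeriv_eq_zero han).2
      ⟨fun k hk => hvan k (Nat.lt_succ_iff.1 hk), hnonvan⟩
  obtain ⟨g, hg, hg0, heq⟩ := han.analyticOrderAt_eq_natCast.1 hord
  refine ⟨g 0, hg0, (hg.continuousAt.tendsto.mono_left nhdsWithin_le_nhds).congr' ?_⟩
  filter_upwards [heq.filter_mono nhdsWithin_le_nhds, self_mem_nhdsWithin] with z h (hz : z ≠ 0)
  rw [h, sub_zero, smul_eq_mul, mul_div_cancel_left₀ _ (pow_ne_zero _ hz)]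

lemma tendsto_localInverse {f g : ℂ → ℂ} {n : ℕ} (hn : n ≠ 0) {a : ℂ}
    (hf : Tendsto (fun z => (f z - z) / z ^ (n + 1)) (𝓝[≠] 0) (𝓝 a))
    (hf0 : f 0 = 0) (hg0 : g 0 = 0) (hg : ContinuousAt g 0) (hfg : ∀ᶠ w in 𝓝 0, f (g w) = w) :
    Tendsto (fun w => (g w - w) / w ^ (n + 1)) (𝓝[≠] 0) (𝓝 (-a)) := by
  have hgt : Tendsto g (𝓝[≠] 0) (𝓝[≠] 0) := by
    refine tendsto_nhdsWithin_iff.2 ⟨?_, ?_⟩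
    · have := hg.tendsto.mono_left (nhdsWithin_le_nhds (s := {0}ᶜ))
      rwa [hg0] at this
    · filter_upwards [hfg.filter_mono nhdsWithin_le_nhds, self_mem_nhdsWithin] with w h (hw : w ≠ 0)
      intro (h0 : g w = 0)
      rw [h0, hf0] at h
      exact hw h.symm
  have hq := ((tendsto_div_self_of_tendsto hn hf).inv₀ one_ne_zero).pow (n + 1)
  have hlim := ((hf.mul hq).comp hgt).neg
  simp only [inv_one, one_pow, mul_one] at hlim
  refine hlim.congr' ?_
  filter_upwards [hfg.filter_mono nhdsWithin_le_nhds, self_mem_nhdsWithin,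
    tendsto_nhdsWithin_iff.1 hgt |>.2] with w h (hw : w ≠ 0) (hgw : g w ≠ 0)
  simp only [Function.comp_apply, h, inv_div, div_pow]
  field_simp
  ring

lemma exists_localInverse {f : ℂ → ℂ} (hf : AnalyticAt ℂ f 0) (hf0 : f 0 = 0)
    (hf'0 : deriv f 0 = 1) :
    ∃ (g : ℂ → ℂ) (N : Set ℂ), IsOpen N ∧ (0 : ℂ) ∈ N ∧ DifferentiableOn ℂ g N ∧ InjOn g N ∧
      g 0 = 0 ∧ (∀ w ∈ N, f (g w) = w) ∧ g '' N ∈ 𝓝 0 := by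
  have hfd : HasFDerivAt f ((ContinuousLinearEquiv.refl ℂ ℂ : ℂ ≃L[ℂ] ℂ) : ℂ →L[ℂ] ℂ) 0 := by
    have h := hf.differentiableAt.hasDerivAt.hasFDerivAt
    rw [hf'0] at h
    exact h.congr_fderiv (by ext; simp)
  have hcd : ContDiffAt ℂ 1 f 0 := hf.contDiffAt
  have hs := hcd.hasStrictFDerivAt' hfd one_ne_zero
  let g := hcd.localInverse hfd one_ne_zero
  have hg0 : g 0 = 0 := by
    simpa [hf0] using hcd.localInverse_apply_image hfd one_ne_zero
  have hgc : ContDiffAt ℂ 1 g 0 := by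
    simpa [hf0] using hcd.to_localInverse hfd one_ne_zero
  have hright : ∀ᶠ w in 𝓝 0, f (g w) = w := by
    have h := hs.eventually_right_inverse
    rwa [hf0] at h
  have hleft : ∀ᶠ z in 𝓝 0, g (f z) = z := hs.eventually_left_inverse
  obtain ⟨N, hN, hNo, hN0⟩ := eventually_nhds_iff.1
    (hright.and (hgc.eventually (by simp)))
  refine ⟨g, N, hNo, hN0, fun w hw => ?_, fun w hw w' hw' h => ?_, hg0, fun w hw => (hN w hw).1, ?_⟩
  · exact ((hN w hw).2.differentiableAt one_ne_zero).differentiableWithinAt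
  · rw [← (hN w hw).1, h, (hN w' hw').1]
  · have hfN : ∀ᶠ z in 𝓝 (0 : ℂ), f z ∈ N :=
      hf.continuousAt.eventually_mem (hf0.symm ▸ hNo.mem_nhds hN0)
    filter_upwards [hleft, hfN] with z hz hzN
    exact ⟨f z, hzN, hz⟩

/-- Leau–Fatou Flower Theorem (7.2), petal existence: for `f(z) = z + a z^{n+1} + ⋯`,
`a ≠ 0`, there are `n` disjoint attracting petals for `f` and `n` disjoint attracting
petals for a local inverse `g` of `f` (the repelling petals of `f`) whose union
together with `{0}` is a neighborhood of `0`. -/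
theorem leau_fatou_flower (f : ℂ → ℂ) (N : Set ℂ) (hNopen : IsOpen N)
    (hN0 : (0 : ℂ) ∈ N) (hf : DifferentiableOn ℂ f N) (hinj : Set.InjOn f N)
    (hf0 : f 0 = 0) (hf'0 : deriv f 0 = 1) (n : ℕ) (hn : 1 ≤ n)
    (hvan : ∀ k ≤ n, iteratedDeriv k (fun z => f z - z) 0 = 0)
    (hnonvan : iteratedDeriv (n + 1) (fun z => f z - z) 0 ≠ 0) :
    ∃ (U U' : Fin n → Set ℂ) (g : ℂ → ℂ) (N' : Set ℂ),
      (∀ i, IsAttractingPetal f N (U i)) ∧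
      (Pairwise fun i j => Disjoint (U i) (U j)) ∧
      IsOpen N' ∧ (0 : ℂ) ∈ N' ∧ DifferentiableOn ℂ g N' ∧ Set.InjOn g N' ∧
      g 0 = 0 ∧ (∀ w ∈ N', f (g w) = w) ∧
      (∀ i, IsAttractingPetal g N' (U' i)) ∧
      (Pairwise fun i j => Disjoint (U' i) (U' j)) ∧
      ((⋃ i, U i) ∪ (⋃ i, U' i) ∪ {0}) ∈ 𝓝 (0 : ℂ) := by
  have hn0 : n ≠ 0 := Nat.one_le_iff_ne_zero.1 hn
  have han : AnalyticAt ℂ f 0 := hf.analyticAt (hNopen.mem_nhds hN0)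
  obtain ⟨a, ha, hfa⟩ := exists_tendsto_of_iteratedDeriv han hvan hnonvan
  obtain ⟨g, N', hN'o, hN'0, hgd, hginj, hg0, hfg, hgN'⟩ := exists_localInverse han hf0 hf'0
  have hN' := hN'o.mem_nhds hN'0
  have hga := tendsto_localInverse hn0 hfa hf0 hg0 (hgd.continuousOn.continuousAt hN')
    (eventually_of_mem hN' hfg)
  have hnC : (n : ℂ) ≠ 0 := by exact_mod_cast hn0
  have hc : -1 / (n * a) ≠ 0 := by simp [hnC, ha]
  have hfN : f '' N ∈ 𝓝 0 := by
    have hs : HasStrictDerivAt f 1 0 := hf'0 ▸ han.hasStrictDerivAt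
    have := image_mem_map (m := f) (hNopen.mem_nhds hN0)
    rwa [hs.map_nhds_eq one_ne_zero, hf0] at this
  obtain ⟨R₁, hR₁, hU⟩ := exists_isAttractingPetal_rootBranch (c := -1 / (n * a)) hn0
    (by field_simp) hf0 (inter_mem (hNopen.mem_nhds hN0) hfN) hfa
  obtain ⟨R₂, hR₂, hU'⟩ := exists_isAttractingPetal_rootBranch (c := -(-1 / (n * a))) hn0
    (by field_simp) hg0 (inter_mem hN' hgN') hga
  obtain ⟨ω, hωinj, hω, hωsurj⟩ := exists_enumeration_roots hn0 hc
  obtain ⟨ω', hω'inj, hω', hω'surj⟩ := exists_enumeration_roots hn0 (neg_ne_zero.2 hc)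
  let R := max R₁ R₂
  exact ⟨fun i => rootBranch n (ω i) '' openBidisc R, fun i => rootBranch n (ω' i) '' openBidisc R,
    g, N', fun i => hU R (le_max_left _ _) _ (hω i),
    fun i j hij => disjoint_rootBranch_image hn0 hc (hω i) (hω j) (hωinj.ne hij) R,
    hN'o, hN'0, hgd, hginj, hg0, hfg, fun i => hU' R (le_max_right _ _) _ (hω' i),
    fun i j hij => disjoint_rootBranch_image hn0 (neg_ne_zero.2 hc) (hω' i) (hω' j)
      (hω'inj.ne hij) R,
    iUnion_rootBranch_image_mem_nhds hn0 hc R hωsurj hω'surj⟩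
end

section
/- Let f be holomorphic on a neighborhood N of 0 in ℂ with f(0) = 0, f'(0) = 1, and suppose the order of vanishing of z ↦ f(z) − z at 0 equals n + 1 with n ≥ 1. Then there exists a neighborhood N₀ ⊆ N of 0 with the following property: if z ∈ N₀, q ≥ 1, the points z, f(z), f^{∘2}(z), …, f^{∘(q−1)}(z) all lie in N₀, and f^{∘q}(z) = z, then z = 0. -/
open Filter Topology

/-- In the coordinate `w = 1 / z ^ n`, the map `z ↦ z + z ^ (n + 1) * a` is a translation by an
explicit amount that tends to `-n * a` as `z → 0`. -/
theorem inv_pow_add_sub_inv_pow {K : Type*} [Field K] (n : ℕ) (z a : K) (hz : z ≠ 0)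
    (h : 1 + z ^ n * a ≠ 0) :
    ((z + z ^ (n + 1) * a) ^ n)⁻¹ - (z ^ n)⁻¹ =
      -(a * (∑ i ∈ Finset.range n, (1 + z ^ n * a) ^ i) / (1 + z ^ n * a) ^ n) := by
  have hs := geom_sum_mul (1 + z ^ n * a) n
  have e : z + z ^ (n + 1) * a = z * (1 + z ^ n * a) := by ring
  rw [e, mul_pow]
  have hzn : z ^ n ≠ 0 := pow_ne_zero _ hz
  generalize (∑ i ∈ Finset.range n, (1 + z ^ n * a) ^ i) = S at *
  have hn : (1 + z ^ n * a) ^ n ≠ 0 := pow_ne_zero _ h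
  generalize (1 + z ^ n * a) ^ n = T at *
  field_simp
  linear_combination hs

/-- If along an orbit of `f` some observable `w` changes at each step by nearly the same nonzero
amount `c`, then the orbit is not closed. -/
theorem iterate_ne_self_of_norm_sub_lt {X E : Type*} [NormedAddCommGroup E] [NormedSpace ℝ E]
    (f : X → X) (w : X → E) (c : E) (z : X) {q : ℕ} (hq : 1 ≤ q)
    (h : ∀ k < q, ‖w (f (f^[k] z)) - w (f^[k] z) - c‖ < ‖c‖) : f^[q] z ≠ z := by
  intro hper
  have hsum : ∑ k ∈ Finset.range q, (w (f (f^[k] z)) - w (f^[k] z) - c) = -(q • c) := by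
    have ht := Finset.sum_range_sub (fun k => w (f^[k] z)) q
    simp only [Function.iterate_succ_apply', hper, Function.iterate_zero, id, sub_self] at ht
    rw [Finset.sum_sub_distrib, ht]
    simp
  have hlt : ‖∑ k ∈ Finset.range q, (w (f (f^[k] z)) - w (f^[k] z) - c)‖ < q * ‖c‖ := by
    refine (norm_sum_le _ _).trans_lt ?_
    calc _ < ∑ k ∈ Finset.range q, ‖c‖ :=
          Finset.sum_lt_sum_of_nonempty (by simpa using by omega)
            fun k hk => h k (Finset.mem_range.mp hk)
      _ = _ := by simp
  rw [hsum, norm_neg, ← Nat.cast_smul_eq_nsmul ℝ, norm_smul] at hlt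
  simp at hlt

/-- Corollary 7.3: near a parabolic fixed point of multiplier `1` there is a
neighborhood `N₀` of `0` containing no periodic orbit other than the fixed point. -/
theorem no_small_cycles_parabolic (f : ℂ → ℂ) (N : Set ℂ) (hNopen : IsOpen N)
    (hN0 : (0 : ℂ) ∈ N) (hf : DifferentiableOn ℂ f N)
    (hf0 : f 0 = 0) (hf'0 : deriv f 0 = 1) (n : ℕ) (hn : 1 ≤ n)
    (hvan : ∀ k ≤ n, iteratedDeriv k (fun z => f z - z) 0 = 0)
    (hnonvan : iteratedDeriv (n + 1) (fun z => f z - z) 0 ≠ 0) :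
    ∃ N₀ : Set ℂ, N₀ ⊆ N ∧ IsOpen N₀ ∧ (0 : ℂ) ∈ N₀ ∧
      ∀ z ∈ N₀, ∀ q : ℕ, 1 ≤ q → (∀ k < q, f^[k] z ∈ N₀) → f^[q] z = z → z = 0 := by
  have hfa : AnalyticAt ℂ (fun z => f z - z) 0 :=
    (hf.analyticAt (hNopen.mem_nhds hN0)).sub analyticAt_id
  have hord : analyticOrderAt (fun z => f z - z) 0 = ((n + 1 : ℕ) : ℕ∞) :=
    (analyticOrderAt_eq_nat_iff_iteratedDeriv_eq_zero hfa).mpr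
      ⟨fun k hk => hvan k (Nat.lt_succ_iff.mp hk), hnonvan⟩
  obtain ⟨g, hg, hg0, hfg⟩ := hfa.analyticOrderAt_eq_natCast.mp hord
  have hgc := hg.continuousAt
  have hn0 : n ≠ 0 := by omega
  set c : ℂ := -(n * g 0) with hc
  have hu : ContinuousAt (fun z => 1 + z ^ n * g z) 0 := by fun_prop
  have hu0 : ∀ᶠ z in 𝓝 (0 : ℂ), 1 + z ^ n * g z ≠ 0 := hu.eventually_ne (by simp [hn0])
  have hstep : ∀ᶠ z in 𝓝 (0 : ℂ), ‖-(g z * (∑ i ∈ Finset.range n, (1 + z ^ n * g z) ^ i) /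
      (1 + z ^ n * g z) ^ n) - c‖ < ‖c‖ := by
    have hcont : ContinuousAt (fun z => ‖-(g z * (∑ i ∈ Finset.range n, (1 + z ^ n * g z) ^ i) /
        (1 + z ^ n * g z) ^ n) - c‖) 0 := by
      have : ContinuousAt (fun z => ∑ i ∈ Finset.range n, (1 + z ^ n * g z) ^ i) 0 :=
        tendsto_finsetSum _ fun i _ => hu.pow i
      exact (((hgc.mul this).div (hu.pow n) (by simp [hn0])).neg.sub continuousAt_const).norm
    refine hcont.eventually_lt continuousAt_const ?_
    simp [hn0, hc, mul_comm, hg0, Nat.pos_of_ne_zero hn0]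
  obtain ⟨N₀, hN₀, hopen, hmem⟩ :=
    eventually_nhds_iff.mp (((hNopen.eventually_mem hN0).and hfg).and
      (hu0.and hstep))
  refine ⟨N₀, fun z hz => (hN₀ z hz).1.1, hopen, hmem, fun z _ q hq horb hper => ?_⟩
  by_contra hz0
  refine iterate_ne_self_of_norm_sub_lt f (fun z => (z ^ n)⁻¹) c z hq (fun k hk => ?_) hper
  obtain ⟨⟨-, hy⟩, hy0, hys⟩ := hN₀ _ (horb k hk)
  have hne : f^[k] z ≠ 0 := by
    intro h0
    apply hz0
    rw [← hper, ← Nat.sub_add_cancel hk.le, Function.iterate_add_apply, h0,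
      Function.iterate_fixed hf0]
  have hfy : f (f^[k] z) = f^[k] z + (f^[k] z) ^ (n + 1) * g (f^[k] z) := by
    rw [sub_zero, smul_eq_mul] at hy
    linear_combination hy
  simpa only [hfy, inv_pow_add_sub_inv_pow n _ _ hne hy0] using hys
end

section
/- Let f : ℂ → ℂ be entire with f(0) = 0 and f'(0) = 1, and suppose f is not the identity map. Then for every neighborhood V of 0 there do not exist a strictly increasing sequence of natural numbers k₁ < k₂ < k₃ < ⋯ and a function g : ℂ → ℂ such that the iterates f^{∘k_j} converge to g uniformly on V as j → ∞. -/
open Filter Topology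

/-- A nonzero entire function factors globally as `z ^ m * h z` with `h` entire and `h 0 ≠ 0`. -/
theorem Differentiable.exists_eq_pow_mul_of_ne_zero {F : ℂ → ℂ} (hF : Differentiable ℂ F)
    (hne : F ≠ 0) :
    ∃ (m : ℕ) (h : ℂ → ℂ), Differentiable ℂ h ∧ h 0 ≠ 0 ∧ ∀ z, F z = z ^ m * h z := by
  obtain ⟨p, hp⟩ := hF.analyticAt 0
  have hp0 : p ≠ 0 := fun h => hne <|
    (AnalyticOnNhd.analyticOrderAt_eq_top_iff_eq_zero 0 fun z => hF.analyticAt z).1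
      (analyticOrderAt_eq_top.2 (hp.locally_zero_iff.2 h))
  refine ⟨p.order, (Function.swap dslope 0)^[p.order] F, ?_,
    hp.iterate_dslope_fslope_ne_zero hp0, fun z => ?_⟩
  · induction p.order with
    | zero => exact hF
    | succ n ih =>
      rw [Function.iterate_succ_apply']
      exact differentiableOn_univ.1
        ((Complex.differentiableOn_dslope univ_mem).2 ih.differentiableOn)
  · simpa using hp.eq_pow_order_mul_iterate_dslope z

/-- An entire function with `f 0 = 0` and `f' 0 = 1`, other than the identity, is globally of
the form `z + z ^ (n + 1) * h z` with `n ≠ 0`, `h` entire and `h 0 ≠ 0`. -/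
theorem Differentiable.exists_eq_add_pow_succ_mul {f : ℂ → ℂ} (hf : Differentiable ℂ f)
    (hf0 : f 0 = 0) (hf'0 : _root_.deriv f 0 = 1) (hne : f ≠ id) :
    ∃ (n : ℕ) (h : ℂ → ℂ), n ≠ 0 ∧ Differentiable ℂ h ∧ h 0 ≠ 0 ∧
      ∀ z, f z = z + z ^ (n + 1) * h z := by
  obtain ⟨m, h, hh, h0, hfh⟩ := (hf.sub differentiable_id).exists_eq_pow_mul_of_ne_zero
    (sub_ne_zero.2 hne)
  rcases m with _ | n
  · exact absurd (by simpa [hf0] using (hfh 0).symm) h0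
  refine ⟨n, h, ?_, hh, h0, fun z => ?_⟩
  · rintro rfl
    have h1 : HasDerivAt (f - id) (1 - 1) 0 := by
      simpa only [hf'0] using (hf 0).hasDerivAt.sub (hasDerivAt_id (0 : ℂ))
    have h2 : HasDerivAt (f - id) (1 * h 0 + 0 * _root_.deriv h 0) 0 := by
      have : f - id = fun z => z * h z := by
        funext z
        simpa using hfh z
      rw [this]
      exact (hasDerivAt_id (0 : ℂ)).mul (hh 0).hasDerivAt
    exact h0 (by simpa using h2.unique h1)
  · rw [← hfh z]
    simp

/-- The iterates of `z + z ^ (n + 1) * h z` have the form `z + z ^ (n + 1) * H z` with `H` entire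
and `H 0 = k * h 0`. -/
theorem exists_iterate_eq_add_pow_succ_mul {f h : ℂ → ℂ} {n : ℕ} (hn : n ≠ 0)
    (hh : Differentiable ℂ h) (hf : ∀ z, f z = z + z ^ (n + 1) * h z) (k : ℕ) :
    ∃ H : ℂ → ℂ, Differentiable ℂ H ∧ H 0 = k * h 0 ∧
      ∀ z, f^[k] z = z + z ^ (n + 1) * H z := by
  induction k with
  | zero => exact ⟨0, differentiable_const 0, by simp, by simp⟩
  | succ k ih =>
    obtain ⟨H, hH, hH0, hfH⟩ := ih
    have hfd : Differentiable ℂ f := by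
      rw [funext hf]
      fun_prop
    refine ⟨fun z => h z + (1 + z ^ n * h z) ^ (n + 1) * H (f z), ?_, ?_, fun z => ?_⟩
    · have := hH.comp hfd
      simp only [Function.comp_def] at this
      fun_prop
    · have : f 0 = 0 := by simp [hf]
      simp only [this, hH0, zero_pow hn]
      push_cast
      ring
    · have hfz : f z = z * (1 + z ^ n * h z) := by rw [hf]; ring
      rw [Function.iterate_succ_apply, hfH (f z)]
      have : (f z) ^ (n + 1) = z ^ (n + 1) * (1 + z ^ n * h z) ^ (n + 1) := by
        rw [hfz, mul_pow]
      rw [this, mul_assoc, mul_add, ← add_assoc, ← hf z]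

/-- If `‖z ^ m * H z‖ ≤ C` on the circle of radius `r`, then `‖H 0‖ * r ^ m ≤ C`. -/
theorem Differentiable.norm_zero_mul_pow_le {H : ℂ → ℂ} (hH : Differentiable ℂ H) {m : ℕ}
    {r C : ℝ} (hr : 0 < r) (hC : ∀ z ∈ Metric.sphere (0 : ℂ) r, ‖z ^ m * H z‖ ≤ C) :
    ‖H 0‖ * r ^ m ≤ C := by
  rw [← le_div_iff₀ (by positivity)]
  refine Complex.norm_le_of_forall_mem_frontier_norm_le (U := Metric.ball 0 r)
    Metric.isBounded_ball hH.diffContOnCl (fun z hz => ?_)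
    (subset_closure (Metric.mem_ball_self hr))
  rw [frontier_ball _ hr.ne'] at hz
  have := hC z hz
  rw [norm_mul, norm_pow, mem_sphere_zero_iff_norm.1 hz, mul_comm] at this
  rwa [le_div_iff₀ (by positivity)]

/-- The key claim in the proof of Corollary 7.5: if `f` is entire with `f 0 = 0`,
`f' 0 = 1` and `f` is not the identity, then no subsequence of the iterates of `f`
converges uniformly on any neighborhood of `0`. -/
theorem iterates_not_normal_at_parabolic (f : ℂ → ℂ) (hf : Differentiable ℂ f)
    (hf0 : f 0 = 0) (hf'0 : deriv f 0 = 1) (hne : f ≠ id)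
    (V : Set ℂ) (hV : V ∈ 𝓝 (0 : ℂ)) :
    ¬ ∃ (k : ℕ → ℕ) (g : ℂ → ℂ), StrictMono k ∧
        TendstoUniformlyOn (fun j z => f^[k j] z) g atTop V := by
  rintro ⟨k, g, hk, hg⟩
  obtain ⟨n, h, hn, hh, h0, hfh⟩ := hf.exists_eq_add_pow_succ_mul hf0 hf'0 hne
  choose H hH hH0 hfH using exists_iterate_eq_add_pow_succ_mul hn hh hfh
  obtain ⟨r, hr, hrV⟩ := Metric.nhds_basis_closedBall.mem_iff.1 hV
  obtain ⟨J, hJ⟩ := Metric.uniformCauchySeqOn_iff.1 hg.uniformCauchySeqOn 1 one_pos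
  have hbound : ∀ j ≥ J, ‖H (k j) 0 - H (k J) 0‖ * r ^ (n + 1) ≤ 1 := fun j hj =>
    ((hH (k j)).sub (hH (k J))).norm_zero_mul_pow_le hr fun z hz => by
      have := hJ j hj J le_rfl z (hrV (Metric.sphere_subset_closedBall hz))
      rw [dist_eq_norm, hfH, hfH] at this
      rw [show z ^ (n + 1) * (H (k j) - H (k J)) z =
        z + z ^ (n + 1) * H (k j) z - (z + z ^ (n + 1) * H (k J) z) by
          simp only [Pi.sub_apply]
          ring]
      exact this.le
  have hpos : 0 < ‖h 0‖ * r ^ (n + 1) := by positivity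
  obtain ⟨N, hN⟩ := exists_nat_gt (1 / (‖h 0‖ * r ^ (n + 1)))
  have hkN : k J + N ≤ k (J + N) := by
    rw [add_comm J, add_comm (k J)]
    exact hk.add_le_nat N J
  have key := hbound (J + N) (Nat.le_add_right J N)
  rw [hH0, hH0, ← sub_mul, norm_mul, mul_assoc] at key
  have hsub : (N : ℝ) ≤ ‖(k (J + N) : ℂ) - k J‖ := by
    rw [← Nat.cast_sub (by omega), Complex.norm_natCast]
    exact_mod_cast (by omega : N ≤ k (J + N) - k J)
  rw [div_lt_iff₀ hpos] at hN
  have := mul_le_mul_of_nonneg_right hsub hpos.le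
  linarith
end

section
/- Let f be holomorphic and injective on a neighborhood N of 0 in ℂ with f(0) = 0, f'(0) = 1, and order of vanishing of z ↦ f(z) − z at 0 equal to n + 1 with n ≥ 1. Then there exist an attracting petal U for f at 0, a real number c, and an injective holomorphic map α : U → ℂ such that α(f(z)) = α(z) + 1 for every z ∈ U, and such that the image α(U) contains the right half-plane { w ∈ ℂ : Re w > c }. Moreover α is unique up to an additive constant: if β : U → ℂ is injective, holomorphic, and satisfies β(f(z)) = β(z) + 1 for all z ∈ U, then β − α is constant on U. -/
open Filter Topology Set

theorem not_eventually_const_of_injOn {U : Set ℂ} {α : ℂ → ℂ} {z : ℂ} (hU : U ∈ 𝓝 z)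
    (hα : InjOn α U) : ¬ ∀ᶠ y in 𝓝 z, α y = α z := by
  intro h
  obtain ⟨y, ⟨hy, hyU⟩, hne⟩ := (((h.and hU).filter_mono nhdsWithin_le_nhds).and
    (self_mem_nhdsWithin : {z}ᶜ ∈ 𝓝[≠] z)).exists
  exact hne (hα hyU (mem_of_mem_nhds hU) hy)

theorem nhds_le_map_nhds_of_injOn {U : Set ℂ} {α : ℂ → ℂ} {z : ℂ} (hU : U ∈ 𝓝 z)
    (hαd : DifferentiableOn ℂ α U) (hα : InjOn α U) : 𝓝 (α z) ≤ map α (𝓝 z) :=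
  (hαd.analyticAt hU).eventually_constant_or_nhds_le_map_nhds.resolve_left
    (not_eventually_const_of_injOn hU hα)

theorem exists_affine_of_injective {H : ℂ → ℂ} (hH : Differentiable ℂ H)
    (hi : Function.Injective H) : ∃ a b : ℂ, ∀ z, H z = a * z + b := by
  obtain ⟨z₀, hz₀⟩ : ∃ z₀, deriv H z₀ ≠ 0 := by
    by_contra! h
    exact zero_ne_one (hi (is_const_of_deriv_eq_zero hH h 0 1))
  have hsl : ∀ z, z ≠ z₀ → dslope H z₀ z = (z - z₀)⁻¹ * (H z - H z₀) := fun z hz ↦ by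
    rw [dslope_of_ne _ hz, slope_def_module, smul_eq_mul]
  have hd0 : ∀ z, dslope H z₀ z ≠ 0 := by
    intro z
    by_cases hz : z = z₀
    · rw [hz, dslope_same]; exact hz₀
    · rw [hsl z hz]
      exact mul_ne_zero (inv_ne_zero (sub_ne_zero.2 hz)) (sub_ne_zero.2 (hi.ne hz))
  have hdd : ∀ {G : ℂ → ℂ}, Differentiable ℂ G → Differentiable ℂ (dslope G z₀) := by
    intro G hG
    rw [← differentiableOn_univ] at hG ⊢
    exact (Complex.differentiableOn_dslope univ_mem).2 hG
  set q : ℂ → ℂ := fun z ↦ (dslope H z₀ z)⁻¹ with hq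
  have hqd : Differentiable ℂ q := (hdd hH).inv hd0
  obtain ⟨r, hr, hball⟩ : ∃ r > 0, Metric.ball (H z₀) r ⊆ H '' Metric.ball z₀ 1 := by
    exact Metric.mem_nhds_iff.1 (nhds_le_map_nhds_of_injOn univ_mem hH.differentiableOn hi.injOn
      (image_mem_map (Metric.ball_mem_nhds z₀ one_pos)))
  have hfar : ∀ z, 1 ≤ ‖z - z₀‖ → ‖dslope q z₀ z‖ ≤ 1 / r + ‖q z₀‖ := by
    intro z hz
    have hne : z ≠ z₀ := by rintro rfl; simp at hz; linarith
    have hHr : r ≤ ‖H z - H z₀‖ := by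
      by_contra! hlt
      obtain ⟨y, hy, hyz⟩ := hball (mem_ball_iff_norm.2 hlt)
      rw [hi hyz, mem_ball_iff_norm] at hy
      linarith
    have hqz : ‖q z‖ ≤ ‖z - z₀‖ * (1 / r) := by
      rw [hq]
      simp only [hsl z hne, mul_inv, inv_inv, norm_mul, norm_inv, one_div]
      gcongr
    rw [dslope_of_ne _ hne, slope_def_module, norm_smul, norm_inv,
      inv_mul_le_iff₀ (by linarith)]
    calc ‖q z - q z₀‖ ≤ ‖q z‖ + ‖q z₀‖ := norm_sub_le _ _
      _ ≤ ‖z - z₀‖ * (1 / r) + ‖z - z₀‖ * ‖q z₀‖ := by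
        gcongr; exact le_mul_of_one_le_left (norm_nonneg _) hz
      _ = _ := by ring
  obtain ⟨B, hB⟩ := (isCompact_closedBall z₀ 1).exists_bound_of_continuousOn
    (hdd hqd).continuous.continuousOn
  have hbdd : Bornology.IsBounded (range (dslope q z₀)) := by
    rw [isBounded_iff_forall_norm_le]
    refine ⟨max B (1 / r + ‖q z₀‖), ?_⟩
    rintro _ ⟨z, rfl⟩
    rcases le_total ‖z - z₀‖ 1 with h | h
    · exact (hB z (mem_closedBall_iff_norm.2 h)).trans (le_max_left _ _)
    · exact (hfar z h).trans (le_max_right _ _)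
  have hconst : ∀ z, q z = q z₀ + (z - z₀) * dslope q z₀ z₀ := by
    intro z
    rw [← (hdd hqd).apply_eq_apply_of_bounded hbdd z z₀, ← smul_eq_mul, sub_smul_dslope]
    ring
  have hq0 : ∀ z, q z ≠ 0 := fun z ↦ inv_ne_zero (hd0 z)
  have ha : dslope q z₀ z₀ = 0 := by
    by_contra ha
    refine hq0 (z₀ - q z₀ / dslope q z₀ z₀) ?_
    rw [hconst]; field_simp; ring
  refine ⟨(q z₀)⁻¹, H z₀ - (q z₀)⁻¹ * z₀, fun z ↦ ?_⟩
  have h1 := sub_smul_dslope H z₀ z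
  have h2 : dslope H z₀ z = (q z₀)⁻¹ := by
    have := hconst z
    rw [ha, mul_zero, add_zero] at this
    rw [← this, hq]; simp
  rw [h2, smul_eq_mul] at h1
  linear_combination -h1

theorem eq_add_const_of_commute_translation {h : ℂ → ℂ} {c : ℝ}
    (hd : DifferentiableOn ℂ h {w | c < w.re}) (hi : InjOn h {w | c < w.re})
    (ht : ∀ w : ℂ, c < w.re → h (w + 1) = h w + 1) :
    ∃ C : ℂ, ∀ w : ℂ, c < w.re → h w = w + C := by
  have hk : ∀ (k : ℕ) (w : ℂ), c < w.re → h (w + k) = h w + k := by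
    intro k
    induction k with
    | zero => simp
    | succ k ih =>
      intro w hw
      have h0 : (0 : ℝ) ≤ k := k.cast_nonneg
      push_cast
      rw [← add_assoc, ht _ (by simp; linarith), ih w hw, add_assoc]
  set m : ℂ → ℕ := fun w ↦ ⌈c - w.re⌉₊ + 1 with hm
  have hmw : ∀ w, c < w.re + m w := fun w ↦ by
    have := Nat.le_ceil (c - w.re)
    simp only [hm]; push_cast; linarith
  set H : ℂ → ℂ := fun w ↦ h (w + m w) - m w with hHdef
  have hH : ∀ (w : ℂ) (k : ℕ), c < w.re + k → H w = h (w + k) - k := by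
    intro w k hwk
    have h1 := hk k (w + m w) (by simpa using hmw w)
    have h2 := hk (m w) (w + k) (by simpa using hwk)
    rw [add_right_comm] at h1
    simp only [hHdef]
    linear_combination h2 - h1
  have hopen : IsOpen {w : ℂ | c < w.re} := isOpen_lt continuous_const Complex.continuous_re
  have hHd : Differentiable ℂ H := by
    intro w
    have hev : H =ᶠ[𝓝 w] fun w' ↦ h (w' + m w) - m w := by
      have : {w' : ℂ | c < w'.re + m w} ∈ 𝓝 w :=
        (isOpen_lt continuous_const (by fun_prop)).mem_nhds (hmw w)
      filter_upwards [this] with w' hw' using hH w' _ hw'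
    refine DifferentiableAt.congr_of_eventuallyEq ?_ hev
    have h1 : DifferentiableAt ℂ h (w + m w) :=
      hd.differentiableAt (hopen.mem_nhds (by simpa using hmw w))
    exact (h1.comp w (differentiableAt_id.add_const _)).sub_const _
  have hHi : Function.Injective H := by
    intro w w' hww
    have h1 : c < w.re + (m w + m w' : ℕ) := by
      have := hmw w; have h0 : (0 : ℝ) ≤ m w' := Nat.cast_nonneg _
      push_cast; linarith
    have h2 : c < w'.re + (m w + m w' : ℕ) := by
      have := hmw w'; have h0 : (0 : ℝ) ≤ m w := Nat.cast_nonneg _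
      push_cast; linarith
    rw [hH w _ h1, hH w' _ h2, sub_left_inj] at hww
    exact add_right_cancel (hi (by simpa using h1) (by simpa using h2) hww)
  obtain ⟨a, b, hab⟩ := exists_affine_of_injective hHd hHi
  have hHh : ∀ w : ℂ, c < w.re → h w = a * w + b := fun w hw ↦ by
    rw [← hab, hH w 0 (by simpa using hw)]; simp
  have ha : a = 1 := by
    have hc1 : c < ((c + 1 : ℝ) : ℂ).re := by simp
    have h1 := ht _ hc1
    rw [hHh _ hc1, hHh _ (by simp; linarith)] at h1
    linear_combination h1
  exact ⟨b, fun w hw ↦ by rw [hHh w hw, ha, one_mul]⟩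

theorem abel_solution_unique {U : Set ℂ} {f α β : ℂ → ℂ} {c : ℝ} (hU : IsOpen U)
    (hfU : MapsTo f U U) (hα : DifferentiableOn ℂ α U) (hαi : InjOn α U)
    (hαf : ∀ z ∈ U, α (f z) = α z + 1) (himg : {w : ℂ | c < w.re} ⊆ α '' U)
    (hβ : DifferentiableOn ℂ β U) (hβi : InjOn β U) (hβf : ∀ z ∈ U, β (f z) = β z + 1) :
    ∃ C : ℂ, ∀ z ∈ U, β z = α z + C := by
  set P : Set ℂ := {w : ℂ | c < w.re} with hP
  have hPo : IsOpen P := isOpen_lt continuous_const Complex.continuous_re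
  set g := Function.invFunOn α U with hg
  have hgU : ∀ w ∈ P, g w ∈ U := fun w hw ↦ Function.invFunOn_mem (himg hw)
  have hαg : ∀ w ∈ P, α (g w) = w := fun w hw ↦ Function.invFunOn_eq (himg hw)
  have hgα : ∀ z ∈ U, g (α z) = z := fun z hz ↦ hαi.leftInvOn_invFunOn hz
  have hαan : ∀ z ∈ U, AnalyticAt ℂ α z := fun z hz ↦ hα.analyticAt (hU.mem_nhds hz)
  have hgc : ∀ w ∈ P, ContinuousAt g w := by
    intro w hw
    have hle := nhds_le_map_nhds_of_injOn (hU.mem_nhds (hgU w hw)) hα hαi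
    rw [hαg w hw] at hle
    intro V hV
    have hmem : α '' (V ∩ U) ∈ 𝓝 w :=
      hle (image_mem_map (inter_mem hV (hU.mem_nhds (hgU w hw))))
    refine mem_map.2 (mem_of_superset hmem ?_)
    rintro _ ⟨z, ⟨hzV, hzU⟩, rfl⟩
    rw [mem_preimage, hgα z hzU]; exact hzV
  have hgd' : ∀ w ∈ P, deriv α (g w) ≠ 0 → DifferentiableAt ℂ g w := by
    intro w hw hne
    refine (HasDerivAt.of_local_left_inverse (hgc w hw)
      (hαan _ (hgU w hw)).differentiableAt.hasDerivAt hne ?_).differentiableAt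
    filter_upwards [hPo.mem_nhds hw] with y hy using hαg y hy
  have hgd : ∀ w ∈ P, DifferentiableAt ℂ g w := by
    intro w hw
    refine (Complex.analyticAt_of_differentiable_on_punctured_nhds_of_continuousAt ?_
      (hgc w hw)).differentiableAt
    have hne : ∀ᶠ z in 𝓝[≠] (g w), deriv α z ≠ 0 := by
      rcases (hαan _ (hgU w hw)).deriv.eventually_eq_zero_or_eventually_ne_zero with h | h
      · exfalso
        obtain ⟨r, hr, hball⟩ := Metric.mem_nhds_iff.1 (h.and (hU.mem_nhds (hgU w hw)))
        refine not_eventually_const_of_injOn (hU.mem_nhds (hgU w hw)) hαi ?_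
        filter_upwards [Metric.ball_mem_nhds _ hr] with y hy
        have := Convex.norm_image_sub_le_of_norm_deriv_le (𝕜 := ℂ) (f := α) (C := 0)
          (fun x hx ↦ (hαan x (hball hx).2).differentiableAt)
          (fun x hx ↦ by rw [(hball hx).1, norm_zero]) (convex_ball (g w) r)
          (Metric.mem_ball_self hr) hy
        rw [zero_mul, norm_le_zero_iff, sub_eq_zero] at this
        exact this
      · exact h
    have ht : Tendsto g (𝓝[≠] w) (𝓝[≠] (g w)) := by
      refine tendsto_nhdsWithin_iff.2 ⟨(hgc w hw).mono_left nhdsWithin_le_nhds, ?_⟩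
      filter_upwards [self_mem_nhdsWithin, mem_nhdsWithin_of_mem_nhds (hPo.mem_nhds hw)]
        with y hy hyP heq
      exact hy (by rw [mem_singleton_iff, ← hαg y hyP, ← hαg w hw, heq])
    filter_upwards [ht.eventually hne, mem_nhdsWithin_of_mem_nhds (hPo.mem_nhds hw)]
      with y hy hyP using hgd' y hyP hy
  have hgshift : ∀ w ∈ P, g (w + 1) = f (g w) := fun w hw ↦ by
    rw [← hgα _ (hfU (hgU w hw)), hαf _ (hgU w hw), hαg w hw]
  obtain ⟨C, hC⟩ := eq_add_const_of_commute_translation (h := β ∘ g) (c := c)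
    (fun w hw ↦ ((hβ.differentiableAt (hU.mem_nhds (hgU w hw))).comp w
      (hgd w hw)).differentiableWithinAt)
    (fun w hw w' hw' h ↦ by
      rw [← hαg w hw, hβi (hgU w hw) (hgU w' hw') h, hαg w' hw'])
    (fun w hw ↦ by
      simp only [Function.comp_apply]; rw [hgshift w hw, hβf _ (hgU w hw)])
  have hiter : ∀ {γ : ℂ → ℂ}, (∀ z ∈ U, γ (f z) = γ z + 1) →
      ∀ k : ℕ, ∀ z ∈ U, γ (f^[k] z) = γ z + k := by
    intro γ hγ k z hz
    induction k with
    | zero => simp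
    | succ k ih =>
      rw [Function.iterate_succ_apply', hγ _ (hfU.iterate k hz), ih]; push_cast; ring
  refine ⟨C, fun z hz ↦ ?_⟩
  obtain ⟨k, hk⟩ := exists_nat_gt (c - (α z).re)
  have h1 := hC (α (f^[k] z)) (by rw [hiter hαf k z hz]; simp; linarith)
  rw [Function.comp_apply, hgα _ (hfU.iterate k hz), hiter hαf k z hz, hiter hβf k z hz] at h1
  linear_combination h1

/-- The complement of the closed quadrant-shaped sector `re w + |im w| ≤ R`, which opens to the
left. -/
def sectorCompl (R : ℝ) : Set ℂ := {w | R < w.re + |w.im|}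

theorem isOpen_sectorCompl (R : ℝ) : IsOpen (sectorCompl R) :=
  isOpen_lt continuous_const (Complex.continuous_re.add Complex.continuous_im.abs)

theorem mem_sectorCompl_of_lt_re {R : ℝ} {w : ℂ} (h : R < w.re) : w ∈ sectorCompl R :=
  h.trans_le (le_add_of_nonneg_right (abs_nonneg _))

theorem re_add_abs_im_le (w : ℂ) : w.re + |w.im| ≤ 2 * ‖w‖ := by
  linarith [Complex.re_le_norm w, Complex.abs_im_le_norm w]

theorem exists_summable_lipschitz {E : ℂ → ℂ} {R C s : ℝ} (hs : 0 < s) (hC : 0 ≤ C)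
    (hE : DifferentiableOn ℂ E (sectorCompl R))
    (hb : ∀ w ∈ sectorCompl R, ‖E w‖ ≤ C * ‖w‖ ^ (-s)) :
    ∃ l : ℕ → ℝ, (∀ k, 0 ≤ l k) ∧ Summable l ∧ ∃ M : ℕ, ∀ m ≥ M, ∀ a b : ℂ,
      (m : ℝ) / 2 ≤ a.re → (m : ℝ) / 2 ≤ b.re → ‖E a - E b‖ ≤ l m * ‖a - b‖ := by
  refine ⟨fun m ↦ C * ((m : ℝ) / 4) ^ (-s) / ((m : ℝ) / 4), fun k ↦ by positivity, ?_, ?_⟩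
  · have h1 : Summable fun m : ℕ ↦ ((m : ℝ) ^ (1 + s))⁻¹ :=
      Real.summable_nat_rpow_inv.2 (by linarith)
    refine (h1.mul_left (C * (4⁻¹ : ℝ) ^ (-s) / 4⁻¹)).congr fun m ↦ ?_
    rcases Nat.eq_zero_or_pos m with rfl | hm
    · simp [Real.zero_rpow (by linarith : 1 + s ≠ 0)]
    · have hm' : (0 : ℝ) < m := by exact_mod_cast hm
      rw [div_eq_mul_inv (m : ℝ) 4, Real.mul_rpow hm'.le (by norm_num), Real.rpow_add hm',
        Real.rpow_one, Real.rpow_neg hm'.le]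
      field_simp
  · obtain ⟨M, hM⟩ := exists_nat_gt (max 0 (4 * R))
    refine ⟨M, fun m hm a b ha hb' ↦ ?_⟩
    have hmM : max 0 (4 * R) < m := hM.trans_le (by exact_mod_cast hm)
    have hm0 : (0 : ℝ) < m := (le_max_left _ _).trans_lt hmM
    have hmR : 4 * R < m := (le_max_right _ _).trans_lt hmM
    have hcb : ∀ w : ℂ, (m : ℝ) / 2 ≤ w.re → ∀ z ∈ Metric.closedBall w ((m : ℝ) / 4),
        (m : ℝ) / 4 ≤ z.re := by
      intro w hw z hz
      rw [mem_closedBall_iff_norm] at hz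
      have := (abs_le.1 ((Complex.abs_re_le_norm (z - w)).trans hz)).1
      rw [Complex.sub_re] at this
      linarith
    have hmem : ∀ z : ℂ, (m : ℝ) / 4 ≤ z.re → z ∈ sectorCompl R := fun z hz ↦
      mem_sectorCompl_of_lt_re (by linarith)
    have hder : ∀ w ∈ {w : ℂ | (m : ℝ) / 2 ≤ w.re},
        ‖deriv E w‖ ≤ C * ((m : ℝ) / 4) ^ (-s) / ((m : ℝ) / 4) := by
      intro w hw
      refine Complex.norm_deriv_le_of_forall_mem_sphere_norm_le (by positivity) ?_ ?_
      · refine DifferentiableOn.diffContOnCl (hE.mono fun z hz ↦ hmem z ?_)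
        exact hcb w hw z (Metric.closure_ball_subset_closedBall hz)
      · intro z hz
        have hz4 := hcb w hw z (Metric.sphere_subset_closedBall hz)
        refine (hb z (hmem z hz4)).trans ?_
        gcongr ?_ * ?_
        exact Real.rpow_le_rpow_of_nonpos (by positivity)
          (hz4.trans (Complex.re_le_norm z)) (by linarith)
    exact Convex.norm_image_sub_le_of_norm_deriv_le (𝕜 := ℂ)
      (fun x (hx : (m : ℝ) / 2 ≤ x.re) ↦ hE.differentiableAt
        ((isOpen_sectorCompl R).mem_nhds (hmem x (by linarith))))
      hder (convex_halfSpace_re_ge _) hb' ha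

theorem re_iterate_ge {E : ℂ → ℂ} {R : ℝ} (hsmall : ∀ w ∈ sectorCompl R, ‖E w‖ ≤ 1 / 200)
    {w : ℂ} (hw : w ∈ sectorCompl R) (k : ℕ) :
    w.re + k / 2 ≤ ((fun w ↦ w + 1 + E w)^[k] w).re ∧
    w.re + |w.im| + k / 2 ≤ ((fun w ↦ w + 1 + E w)^[k] w).re +
      |((fun w ↦ w + 1 + E w)^[k] w).im| ∧
    ‖(fun w ↦ w + 1 + E w)^[k] w - w - k‖ ≤ k * (1 / 200) := by
  induction k with
  | zero => simp
  | succ k ih =>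
    rw [Function.iterate_succ_apply']
    set v := (fun w ↦ w + 1 + E w)^[k] w
    obtain ⟨h1, h2, h3⟩ := ih
    have hv : v ∈ sectorCompl R := by
      have h0 : (0 : ℝ) ≤ k := k.cast_nonneg
      have : R < w.re + |w.im| := hw
      change R < _
      linarith
    have hE := hsmall v hv
    have hre := (abs_le.1 ((Complex.abs_re_le_norm (E v)).trans hE)).1
    have him := (Complex.abs_im_le_norm (E v)).trans hE
    have him2 : |v.im| ≤ |v.im + (E v).im| + |(E v).im| := by
      simpa using abs_sub (v.im + (E v).im) (E v).im
    refine ⟨?_, ?_, ?_⟩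
    · simp only [Complex.add_re, Complex.one_re]; push_cast; linarith
    · simp only [Complex.add_re, Complex.one_re, Complex.add_im, Complex.one_im, add_zero]
      push_cast; linarith
    · calc ‖v + 1 + E v - w - ((k + 1 : ℕ) : ℂ)‖ = ‖(v - w - k) + E v‖ := by
            congr 1; push_cast; ring
        _ ≤ k * (1 / 200) + 1 / 200 := (norm_add_le _ _).trans (add_le_add h3 hE)
        _ = _ := by push_cast; ring

theorem exists_abel_solution {E : ℂ → ℂ} {R : ℝ} {l : ℕ → ℝ} {M : ℕ}
    (hE : DifferentiableOn ℂ E (sectorCompl R))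
    (hsmall : ∀ w ∈ sectorCompl R, ‖E w‖ ≤ 1 / 200)
    (hl0 : ∀ k, 0 ≤ l k) (hls : Summable l)
    (hlip : ∀ m ≥ M, ∀ a b : ℂ, (m : ℝ) / 2 ≤ a.re → (m : ℝ) / 2 ≤ b.re →
      ‖E a - E b‖ ≤ l m * ‖a - b‖)
    (hE0 : ∀ ε > 0, ∃ B : ℝ, ∀ w : ℂ, B < w.re → ‖E w‖ < ε) :
    ∃ α : ℂ → ℂ, DifferentiableOn ℂ α (sectorCompl R) ∧
      (∀ w ∈ sectorCompl R, α (w + 1 + E w) = α w + 1) ∧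
      ∀ ε > 0, ∃ m : ℝ, ∀ a b : ℂ, m ≤ a.re → m ≤ b.re →
        ‖α a - α b - (a - b)‖ ≤ ε * ‖a - b‖ := by
  set F : ℂ → ℂ := fun w ↦ w + 1 + E w with hF
  set W := sectorCompl R with hW
  have hWo : IsOpen W := isOpen_sectorCompl R
  have hiterW : ∀ w ∈ W, ∀ k, F^[k] w ∈ W := fun w hw k ↦ by
    have h1 : R < w.re + |w.im| := hw
    have h2 := (re_iterate_ge hsmall hw k).2.1
    have h0 : (0 : ℝ) ≤ k := k.cast_nonneg
    change R < _
    linarith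
  have hre : ∀ w ∈ W, ∀ k : ℕ, w.re + k / 2 ≤ (F^[k] w).re := fun w hw k ↦
    (re_iterate_ge hsmall hw k).1
  have hFd : ∀ k, DifferentiableOn ℂ F^[k] W :=
    DifferentiableOn.iterate ((differentiableOn_id.add_const _).add hE) fun w hw ↦ hiterW w hw 1
  obtain ⟨m₀, hm₀M, hm₀R⟩ : ∃ m₀ : ℕ, M ≤ m₀ ∧ R < (m₀ : ℝ) / 2 := by
    obtain ⟨k, hk⟩ := exists_nat_gt (2 * R)
    refine ⟨max M k, le_max_left _ _, ?_⟩
    have : (k : ℝ) ≤ (max M k : ℕ) := by exact_mod_cast le_max_right _ _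
    linarith
  have hHW : ∀ m ≥ m₀, ∀ w : ℂ, (m : ℝ) / 2 ≤ w.re → w ∈ W := fun m hm w hw ↦ by
    have : (m₀ : ℝ) ≤ m := by exact_mod_cast hm
    exact mem_sectorCompl_of_lt_re (by linarith)
  have hstep : ∀ m ≥ m₀, ∀ w : ℂ, (m : ℝ) / 2 ≤ w.re → ∀ k : ℕ,
      ((m + k : ℕ) : ℝ) / 2 ≤ (F^[k] w).re := fun m hm w hw k ↦ by
    have := hre w (hHW m hm w hw) k
    push_cast; linarith
  set P : ℝ := Real.exp (∑' k, l k) with hP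
  have hsum : ∀ m k : ℕ, ∑ j ∈ Finset.range k, l (m + j) ≤ ∑' j, l j := fun m k ↦ by
    have h1 := hls.sum_le_tsum (Finset.range (m + k)) fun i _ ↦ hl0 i
    rw [Finset.sum_range_add] at h1
    linarith [Finset.sum_nonneg fun i (_ : i ∈ Finset.range m) ↦ hl0 i]
  have hcontr : ∀ m ≥ m₀, ∀ a b : ℂ, (m : ℝ) / 2 ≤ a.re → (m : ℝ) / 2 ≤ b.re → ∀ k : ℕ,
      ‖F^[k] a - F^[k] b‖ ≤ Real.exp (∑ j ∈ Finset.range k, l (m + j)) * ‖a - b‖ := by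
    intro m hm a b ha hb k
    induction k with
    | zero => simp
    | succ k ih =>
      rw [Function.iterate_succ_apply', Function.iterate_succ_apply', Finset.sum_range_succ,
        Real.exp_add]
      have h1 := hlip (m + k) (hm₀M.trans (hm.trans (Nat.le_add_right _ _))) _ _
        (hstep m hm a ha k) (hstep m hm b hb k)
      calc ‖F (F^[k] a) - F (F^[k] b)‖
          = ‖(F^[k] a - F^[k] b) + (E (F^[k] a) - E (F^[k] b))‖ := by
            congr 1; simp only [hF]; ring
        _ ≤ (l (m + k) + 1) * ‖F^[k] a - F^[k] b‖ := by
            refine (norm_add_le _ _).trans ?_; linarith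
        _ ≤ Real.exp (l (m + k)) *
            (Real.exp (∑ j ∈ Finset.range k, l (m + j)) * ‖a - b‖) := by
            gcongr
            exact Real.add_one_le_exp _
        _ = _ := by ring
  have hD : ∀ m ≥ m₀, ∀ a b : ℂ, (m : ℝ) / 2 ≤ a.re → (m : ℝ) / 2 ≤ b.re → ∀ k : ℕ,
      ‖E (F^[k] a) - E (F^[k] b)‖ ≤ l (k + m) * (P * ‖a - b‖) := by
    intro m hm a b ha hb k
    have h1 := hlip (m + k) (hm₀M.trans (hm.trans (Nat.le_add_right _ _))) _ _
        (hstep m hm a ha k) (hstep m hm b hb k)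
    rw [add_comm k m]
    refine h1.trans (mul_le_mul_of_nonneg_left ((hcontr m hm a b ha hb k).trans ?_) (hl0 _))
    gcongr
    exact Real.exp_le_exp.2 (hsum m k)
  have hpart : ∀ (a b : ℂ) (k : ℕ), F^[k] a - F^[k] b =
      a - b + ∑ j ∈ Finset.range k, (E (F^[j] a) - E (F^[j] b)) := by
    intro a b k
    induction k with
    | zero => simp
    | succ k ih =>
      rw [Function.iterate_succ_apply', Function.iterate_succ_apply', Finset.sum_range_succ,
        ← add_assoc, ← ih]
      simp only [hF]; ring
  have hls' : ∀ m : ℕ, Summable fun k ↦ l (k + m) := fun m ↦ (summable_nat_add_iff m).2 hls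
  have hDs : ∀ m ≥ m₀, ∀ a b : ℂ, (m : ℝ) / 2 ≤ a.re → (m : ℝ) / 2 ≤ b.re →
      Summable fun k ↦ E (F^[k] a) - E (F^[k] b) := fun m hm a b ha hb ↦
    Summable.of_norm_bounded ((hls' m).mul_right _) (hD m hm a b ha hb)
  set w₀ : ℂ := (((m₀ : ℝ) / 2 : ℝ) : ℂ) with hw₀
  have hw₀re : (m₀ : ℝ) / 2 ≤ w₀.re := by rw [hw₀, Complex.ofReal_re]
  have hw₀W : w₀ ∈ W := hHW m₀ le_rfl w₀ hw₀re
  have hlim : ∀ a b : ℂ, (m₀ : ℝ) / 2 ≤ a.re → (m₀ : ℝ) / 2 ≤ b.re →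
      Tendsto (fun k ↦ F^[k] a - F^[k] b) atTop
        (𝓝 (a - b + ∑' k, (E (F^[k] a) - E (F^[k] b)))) := by
    intro a b ha hb
    simp only [hpart a b]
    exact (hDs m₀ le_rfl a b ha hb).hasSum.tendsto_sum_nat.const_add _
  have hpush : ∀ w ∈ W, ∃ k : ℕ, (m₀ : ℝ) / 2 < (F^[k] w).re := by
    intro w hw
    obtain ⟨k, hk⟩ := exists_nat_gt (m₀ - 2 * w.re)
    exact ⟨k, by linarith [hre w hw k]⟩
  set α : ℂ → ℂ := fun w ↦ limUnder atTop fun k ↦ F^[k] w - F^[k] w₀ with hαdef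
  have hα : ∀ w ∈ W, Tendsto (fun k ↦ F^[k] w - F^[k] w₀) atTop (𝓝 (α w)) := by
    intro w hw
    refine tendsto_nhds_limUnder ?_
    obtain ⟨j, hj⟩ := hpush w hw
    have h1 := hlim (F^[j] w) (F^[j] w₀) hj.le (by
      have h0 : (0 : ℝ) ≤ j := j.cast_nonneg
      linarith [hre w₀ hw₀W j])
    refine ⟨_, (tendsto_add_atTop_iff_nat j).1 (h1.congr fun k ↦ ?_)⟩
    rw [Function.iterate_add_apply, Function.iterate_add_apply]
  have hE0' : Tendsto (fun k ↦ E (F^[k] w₀)) atTop (𝓝 0) := by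
    rw [Metric.tendsto_atTop]
    intro ε hε
    obtain ⟨B, hB⟩ := hE0 ε hε
    obtain ⟨K, hK⟩ := exists_nat_gt (2 * (B - w₀.re))
    refine ⟨K, fun k hk ↦ ?_⟩
    rw [dist_zero_right]
    refine hB _ ?_
    have : (K : ℝ) ≤ k := by exact_mod_cast hk
    linarith [hre w₀ hw₀W k]
  have habel : ∀ w ∈ W, α (F w) = α w + 1 := by
    intro w hw
    have h1 := hα (F w) (hiterW w hw 1)
    have h2 : Tendsto (fun k ↦ (F^[k + 1] w - F^[k + 1] w₀) + (1 + E (F^[k] w₀))) atTop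
        (𝓝 (α w + (1 + 0))) :=
      ((tendsto_add_atTop_iff_nat 1).2 (hα w hw)).add (hE0'.const_add 1)
    rw [add_zero] at h2
    refine tendsto_nhds_unique h1 (h2.congr fun k ↦ ?_)
    rw [Function.iterate_succ_apply, Function.iterate_succ_apply' F k w₀]
    simp only [hF]; ring
  have habelk : ∀ w ∈ W, ∀ k : ℕ, α (F^[k] w) = α w + k := by
    intro w hw k
    induction k with
    | zero => simp
    | succ k ih =>
      rw [Function.iterate_succ_apply', habel _ (hiterW w hw k), ih]; push_cast; ring
  have hdH : DifferentiableOn ℂ α {w : ℂ | (m₀ : ℝ) / 2 < w.re} := by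
    intro w hw
    set V : Set ℂ := {w : ℂ | (m₀ : ℝ) / 2 < w.re} ∩ Metric.ball w₀ (‖w - w₀‖ + 1) with hV
    have hVo : IsOpen V :=
      (isOpen_lt continuous_const Complex.continuous_re).inter Metric.isOpen_ball
    have hwV : w ∈ V := ⟨hw, by rw [mem_ball_iff_norm]; linarith⟩
    have hVW : V ⊆ W := fun v hv ↦ hHW m₀ le_rfl v (le_of_lt hv.1)
    have h1 : DifferentiableOn ℂ (fun w ↦ ∑' k, (E (F^[k] w) - E (F^[k] w₀))) V := by
      refine Complex.differentiableOn_tsum_of_summable_norm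
        (u := fun k ↦ l (k + m₀) * (P * (‖w - w₀‖ + 1))) ((hls' m₀).mul_right _)
        (fun k ↦ ?_) hVo fun k v hv ↦ ?_
      · exact (hE.comp ((hFd k).mono hVW) fun v hv ↦ hiterW v (hVW hv) k).sub_const _
      · refine (hD m₀ le_rfl v w₀ (le_of_lt hv.1) hw₀re k).trans ?_
        have := (mem_ball_iff_norm.1 hv.2).le
        exact mul_le_mul_of_nonneg_left
          (mul_le_mul_of_nonneg_left this (Real.exp_pos _).le) (hl0 _)
    have h2 : DifferentiableOn ℂ α V :=
      ((differentiableOn_id.sub_const w₀).add h1).congr fun v hv ↦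
        tendsto_nhds_unique (hα v (hVW hv)) (hlim v w₀ (le_of_lt hv.1) hw₀re)
    exact (h2.differentiableAt (hVo.mem_nhds hwV)).differentiableWithinAt
  refine ⟨α, ?_, habel, ?_⟩
  · intro w hw
    obtain ⟨k, hk⟩ := hpush w hw
    have hHo : IsOpen {w : ℂ | (m₀ : ℝ) / 2 < w.re} :=
      isOpen_lt continuous_const Complex.continuous_re
    have h1 : DifferentiableAt ℂ (fun v ↦ α (F^[k] v) - k) w :=
      ((hdH.differentiableAt (hHo.mem_nhds hk)).comp w
        ((hFd k).differentiableAt (hWo.mem_nhds hw))).sub_const _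
    refine (h1.congr_of_eventuallyEq ?_).differentiableWithinAt
    filter_upwards [hWo.mem_nhds hw] with v hv
    rw [habelk v hv k]; ring
  · intro ε hε
    have ht : Tendsto (fun m ↦ (∑' k, l (k + m)) * P) atTop (𝓝 0) := by
      simpa using (tendsto_sum_nat_add l).mul_const P
    obtain ⟨m, hmε, hm⟩ := ((ht.eventually (ge_mem_nhds hε)).and (eventually_ge_atTop m₀)).exists
    refine ⟨(m : ℝ) / 2, fun a b ha hb ↦ ?_⟩
    have h1 : Tendsto (fun k ↦ ‖F^[k] a - F^[k] b - (a - b)‖) atTop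
        (𝓝 ‖α a - α b - (a - b)‖) := by
      refine (((hα a (hHW m hm a ha)).sub (hα b (hHW m hm b hb))).sub_const (a - b)).norm.congr
        fun k ↦ ?_
      congr 1; ring
    refine le_of_tendsto h1 (Eventually.of_forall fun k ↦ ?_)
    rw [hpart a b k, add_sub_cancel_left]
    calc ‖∑ j ∈ Finset.range k, (E (F^[j] a) - E (F^[j] b))‖
        ≤ ∑ j ∈ Finset.range k, l (j + m) * (P * ‖a - b‖) :=
          norm_sum_le_of_le _ fun j _ ↦ hD m hm a b ha hb j
      _ = (∑ j ∈ Finset.range k, l (j + m)) * (P * ‖a - b‖) := by rw [Finset.sum_mul]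
      _ ≤ (∑' j, l (j + m)) * (P * ‖a - b‖) := by
          gcongr
          exact (hls' m).sum_le_tsum _ fun i _ ↦ hl0 _
      _ = ((∑' j, l (j + m)) * P) * ‖a - b‖ := by ring
      _ ≤ ε * ‖a - b‖ := by gcongr

theorem exists_fatou_coordinate_near_infinity {E : ℂ → ℂ} {R : ℝ} {l : ℕ → ℝ} {M : ℕ}
    (hE : DifferentiableOn ℂ E (sectorCompl R))
    (hsmall : ∀ w ∈ sectorCompl R, ‖E w‖ ≤ 1 / 200)
    (hl0 : ∀ k, 0 ≤ l k) (hls : Summable l)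
    (hlip : ∀ m ≥ M, ∀ a b : ℂ, (m : ℝ) / 2 ≤ a.re → (m : ℝ) / 2 ≤ b.re →
      ‖E a - E b‖ ≤ l m * ‖a - b‖)
    (hE0 : ∀ ε > 0, ∃ B : ℝ, ∀ w : ℂ, B < w.re → ‖E w‖ < ε)
    (hinj : InjOn (fun w ↦ w + 1 + E w) (sectorCompl R)) :
    ∃ (α : ℂ → ℂ) (c : ℝ), DifferentiableOn ℂ α (sectorCompl R) ∧ InjOn α (sectorCompl R) ∧
      (∀ w ∈ sectorCompl R, α (w + 1 + E w) = α w + 1) ∧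
      {w : ℂ | c < w.re} ⊆ α '' sectorCompl R := by
  obtain ⟨α, hαd, habel, hαlip⟩ := exists_abel_solution hE hsmall hl0 hls hlip hE0
  set F : ℂ → ℂ := fun w ↦ w + 1 + E w with hF
  set W := sectorCompl R with hW
  have hiterW : ∀ w ∈ W, ∀ k, F^[k] w ∈ W := fun w hw k ↦ by
    have h1 : R < w.re + |w.im| := hw
    have h2 := (re_iterate_ge hsmall hw k).2.1
    have h0 : (0 : ℝ) ≤ k := k.cast_nonneg
    change R < _
    linarith
  have habelk : ∀ w ∈ W, ∀ k : ℕ, α (F^[k] w) = α w + k := by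
    intro w hw k
    induction k with
    | zero => simp
    | succ k ih =>
      rw [Function.iterate_succ_apply', habel _ (hiterW w hw k), ih]; push_cast; ring
  have hαi : InjOn α W := by
    obtain ⟨m, hm⟩ := hαlip (1 / 2) (by norm_num)
    intro a ha b hb hab
    obtain ⟨k, hk⟩ := exists_nat_gt (max (2 * (m - a.re)) (2 * (m - b.re)))
    have hka := (le_max_left _ _).trans_lt hk
    have hkb := (le_max_right _ _).trans_lt hk
    have h1 := hm (F^[k] a) (F^[k] b) (by linarith [(re_iterate_ge hsmall ha k).1])
      (by linarith [(re_iterate_ge hsmall hb k).1])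
    rw [habelk a ha, habelk b hb, hab, sub_self, zero_sub, norm_neg] at h1
    have h2 : F^[k] a = F^[k] b := by
      rw [← sub_eq_zero, ← norm_le_zero_iff]; linarith
    exact hinj.iterate (fun w hw ↦ hiterW w hw 1) k ha hb h2
  obtain ⟨m, hm⟩ := hαlip (1 / 1000) (by norm_num)
  set u₀ : ℂ := ((max m 0 : ℝ) : ℂ) with hu₀
  have hu₀m : m ≤ u₀.re := by rw [hu₀, Complex.ofReal_re]; exact le_max_left _ _
  obtain ⟨K, hK⟩ : ∃ K, ∀ w ∈ W, ‖α w - w‖ ≤ (3 / 200) * ‖w‖ + K := by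
    refine ⟨(1 / 1000) * (2 * (2 * |m| + 1) + ‖u₀‖) + ‖α u₀ - u₀‖ + (2 * |m| + 1) * (1 / 200),
      fun w hw ↦ ?_⟩
    obtain ⟨k, hk1, hk2⟩ : ∃ k : ℕ, 2 * |m| + 2 * ‖w‖ ≤ k ∧ k ≤ 2 * |m| + 2 * ‖w‖ + 1 :=
      ⟨_, Nat.le_ceil _, (Nat.ceil_lt_add_one (by positivity)).le⟩
    obtain ⟨h1, -, h3⟩ := re_iterate_ge hsmall hw k
    have hkm : m ≤ (F^[k] w).re := by
      have := (abs_le.1 (Complex.abs_re_le_norm w)).1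
      linarith [le_abs_self m]
    have h4 := hm _ _ hkm hu₀m
    have h5 : ‖F^[k] w‖ ≤ ‖w‖ + 2 * k := by
      have : F^[k] w = (F^[k] w - w - k) + (w + k) := by ring
      rw [this]
      refine (norm_add_le _ _).trans ?_
      have := norm_add_le w k
      rw [Complex.norm_natCast] at this
      have h0 : (0 : ℝ) ≤ k := k.cast_nonneg
      linarith
    have h6 : α w - w = (α (F^[k] w) - α u₀ - (F^[k] w - u₀)) + (α u₀ - u₀)
        + (F^[k] w - w - k) := by
      rw [habelk w hw]; ring
    have h7 : ‖F^[k] w - u₀‖ ≤ ‖F^[k] w‖ + ‖u₀‖ := norm_sub_le _ _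
    rw [h6]
    refine norm_add₃_le.trans ?_
    linarith
  refine ⟨α, max (2 * |R|) (32 * |K|), hαd, hαi, habel, fun z hz ↦ ?_⟩
  have hzre : max (2 * |R|) (32 * |K|) < ‖z‖ := lt_of_lt_of_le hz (Complex.re_le_norm z)
  have hzR := (le_max_left _ _).trans_lt hzre
  have hzK := (le_max_right _ _).trans_lt hzre
  have hz0 : 0 < z.re := lt_of_le_of_lt (by positivity) hz
  have hz1 : 0 < ‖z‖ := hz0.trans_le (Complex.re_le_norm z)
  have hball : Metric.closedBall z (‖z‖ / 4) ⊆ W := by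
    intro w hw
    rw [mem_closedBall_iff_norm] at hw
    have h1 := (abs_le.1 ((Complex.abs_re_le_norm (w - z)).trans hw)).1
    have h2 := (Complex.abs_im_le_norm (w - z)).trans hw
    rw [Complex.sub_re] at h1
    rw [Complex.sub_im] at h2
    have h3 : |z.im| - |w.im| ≤ |w.im - z.im| := by
      rw [abs_sub_comm]; exact abs_sub_abs_le_abs_sub _ _
    have h4 := Complex.norm_le_abs_re_add_abs_im z
    rw [abs_of_pos hz0] at h4
    change R < _
    linarith [le_abs_self R]
  have hzW : z ∈ W := hball (Metric.mem_closedBall_self (by positivity))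
  have hζ := hK z hzW
  have hKle := le_abs_self K
  have hsub := DiffContOnCl.ball_subset_image_closedBall (f := α) (z₀ := z) (r := ‖z‖ / 4)
    (ε := ‖z‖ / 4 - (3 / 200) * (9 / 4) * ‖z‖ - 2 * |K|)
    (DifferentiableOn.diffContOnCl
      (hαd.mono (Metric.closure_ball_subset_closedBall.trans hball))) (by positivity)
    (fun w hw ↦ by
      have hw' := hK w (hball (Metric.sphere_subset_closedBall hw))
      rw [mem_sphere_iff_norm] at hw
      have h1 : ‖w‖ ≤ ‖z‖ + ‖z‖ / 4 := by
        rw [← hw]; simpa using norm_add_le z (w - z)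
      have h2 : ‖w - z‖ ≤ ‖α w - α z‖ + ‖α w - w‖ + ‖α z - z‖ := by
        have : w - z = (α w - α z) + (w - α w) + (α z - z) := by ring
        rw [norm_sub_rev (α w) w, this]
        exact norm_add₃_le
      linarith)
    (not_eventually.1 (not_eventually_const_of_injOn ((isOpen_sectorCompl R).mem_nhds hzW) hαi))
  have hmem : z ∈ Metric.ball (α z)
      ((‖z‖ / 4 - (3 / 200) * (9 / 4) * ‖z‖ - 2 * |K|) / 2) := by
    rw [mem_ball_iff_norm, norm_sub_rev]
    linarith
  exact image_mono hball (hsub hmem)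

theorem analyticAt_dslope {g : ℂ → ℂ} {z : ℂ} (hg : AnalyticAt ℂ g z) :
    AnalyticAt ℂ (dslope g z) z := by
  obtain ⟨p, hp⟩ := hg
  exact ⟨_, hp.has_fpower_series_dslope_fslope⟩

theorem exists_parabolic_normal_form {f : ℂ → ℂ} {n : ℕ} (hf : AnalyticAt ℂ f 0) (hn : 1 ≤ n)
    (hvan : ∀ k ≤ n, iteratedDeriv k (fun z => f z - z) 0 = 0)
    (hnonvan : iteratedDeriv (n + 1) (fun z => f z - z) 0 ≠ 0) :
    ∃ a : ℂ, a ≠ 0 ∧ ∃ p q : ℂ → ℂ, ContinuousAt p 0 ∧ p 0 = 1 ∧ AnalyticAt ℂ q 0 ∧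
      ∀ᶠ z in 𝓝 (0 : ℂ), f z = z * p z ∧
        (p z ^ n)⁻¹ = 1 - n * a * z ^ n + z ^ (n + 1) * q z := by
  have hfz : AnalyticAt ℂ (fun z ↦ f z - z) 0 := hf.sub analyticAt_id
  have hord : analyticOrderAt (fun z ↦ f z - z) 0 = (n + 1 : ℕ) :=
    (analyticOrderAt_eq_nat_iff_iteratedDeriv_eq_zero hfz).2
      ⟨fun k hk ↦ hvan k (Nat.lt_succ_iff.1 hk), hnonvan⟩
  obtain ⟨h, hh, hh0, hev⟩ := hfz.analyticOrderAt_eq_natCast.1 hord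
  have hn0 : n ≠ 0 := by lia
  set κ : ℂ → ℂ := fun u ↦ ((1 + u) ^ n)⁻¹ with hκ
  have hκd : HasDerivAt κ (-n) 0 := by
    have h1 : HasDerivAt (fun u : ℂ ↦ (1 + u) ^ n) (n * (1 + 0) ^ (n - 1) * 1) 0 :=
      ((hasDerivAt_id (0 : ℂ)).const_add 1).pow n
    exact (h1.inv (by simp)).congr_deriv (by simp)
  have hκa : AnalyticAt ℂ κ 0 :=
    ((analyticAt_const.add analyticAt_id).pow n).inv (by simp)
  set u : ℂ → ℂ := fun z ↦ z ^ n * h z with hu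
  have hua : AnalyticAt ℂ u 0 := (analyticAt_id.pow n).mul hh
  have hu0 : u 0 = 0 := by simp [hu, hn0]
  set μ : ℂ → ℂ := fun z ↦ h z * dslope κ 0 (u z) with hμ
  have hμa : AnalyticAt ℂ μ 0 :=
    hh.mul (AnalyticAt.fun_comp (by rw [hu0]; exact analyticAt_dslope hκa) hua)
  have hμ0 : μ 0 = -(n * h 0) := by
    simp only [hμ, hu0, dslope_same, hκd.deriv]; ring
  refine ⟨h 0, hh0, fun z ↦ 1 + u z, dslope μ 0, (hua.continuousAt.const_add 1), by simp [hu0],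
    analyticAt_dslope hμa, ?_⟩
  filter_upwards [hev] with z hz
  constructor
  · simp only [sub_zero, smul_eq_mul] at hz
    simp only [hu]
    linear_combination hz
  · have h1 := sub_smul_dslope κ 0 (u z)
    have h2 := sub_smul_dslope μ 0 z
    rw [sub_zero, smul_eq_mul] at h1 h2
    rw [hμ0] at h2
    have h3 : κ 0 = 1 := by simp [hκ]
    rw [h3] at h1
    have h4 : κ (u z) = ((1 + u z) ^ n)⁻¹ := rfl
    have h5 : μ z = h z * dslope κ 0 (u z) := rfl
    have h6 : u z = z ^ n * h z := rfl
    rw [← h4]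
    rw [h5] at h2
    have h7 : u z * dslope κ 0 (u z) = z ^ n * (h z * dslope κ 0 (u z)) := by
      nth_rw 1 [h6]; ring
    rw [pow_succ]
    linear_combination (-h1) + h7 - z ^ n * h2

theorem abs_arg_le_of_mem_sectorCompl {w : ℂ} (hw : w ∈ sectorCompl 0) :
    |w.arg| ≤ 3 * Real.pi / 4 := by
  by_contra! hlt
  have hpi := Real.pi_pos
  have hw' : 0 < w.re + |w.im| := hw
  have h1 := Real.cos_lt_cos_of_nonneg_of_le_pi (by positivity) (Complex.abs_arg_le_pi w) hlt
  rw [Real.cos_abs] at h1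
  have h2 : Real.cos (3 * Real.pi / 4) = -(√2 / 2) := by
    rw [show 3 * Real.pi / 4 = Real.pi - Real.pi / 4 by ring, Real.cos_pi_sub,
      Real.cos_pi_div_four]
  rw [h2] at h1
  have hs : √2 * √2 = 2 := Real.mul_self_sqrt (by norm_num)
  have hs0 : 0 < √2 := by positivity
  have hcs := Real.sin_sq_add_cos_sq w.arg
  have hcos : 1 / 2 < Real.cos w.arg ^ 2 := by nlinarith
  have hre := Complex.norm_mul_cos_arg w
  have him := Complex.norm_mul_sin_arg w
  have hsin : |Real.sin w.arg| ≤ -Real.cos w.arg :=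
    abs_le_of_sq_le_sq (by nlinarith) (by nlinarith)
  have := mul_le_mul_of_nonneg_left hsin (norm_nonneg w)
  rw [← hre, ← him, abs_mul, abs_norm] at hw'
  linarith

theorem sectorCompl_subset_slitPlane : sectorCompl 0 ⊆ Complex.slitPlane := by
  intro w (hw : 0 < w.re + |w.im|)
  rw [Complex.mem_slitPlane_iff]
  by_contra! h
  rw [h.2, abs_zero] at hw
  linarith [h.1]

theorem exists_conjugacy_near_infinity {f : ℂ → ℂ} {n : ℕ} {S : Set ℂ} (hf : AnalyticAt ℂ f 0)
    (hn : 1 ≤ n) (hvan : ∀ k ≤ n, iteratedDeriv k (fun z => f z - z) 0 = 0)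
    (hnonvan : iteratedDeriv (n + 1) (fun z => f z - z) 0 ≠ 0) (hS : S ∈ 𝓝 (0 : ℂ)) :
    ∃ (ψ φ E : ℂ → ℂ) (R C s : ℝ), 0 ≤ R ∧ 0 < s ∧ 0 ≤ C ∧
      DifferentiableOn ℂ ψ (sectorCompl R) ∧ DifferentiableOn ℂ φ {0}ᶜ ∧
      DifferentiableOn ℂ E (sectorCompl R) ∧
      (∀ w ∈ sectorCompl R, ‖E w‖ ≤ C * ‖w‖ ^ (-s)) ∧
      Tendsto (fun k : ℕ ↦ ψ k) atTop (𝓝 0) ∧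
      ∀ w ∈ sectorCompl R, ψ w ≠ 0 ∧ ψ w ∈ S ∧ φ (ψ w) = w ∧ f (ψ w) = ψ (w + 1 + E w) := by
  obtain ⟨a, ha, p, q, hp, hp0, hq, hev⟩ := exists_parabolic_normal_form hf hn hvan hnonvan
  have hn0 : (n : ℂ) ≠ 0 := Nat.cast_ne_zero.2 (by lia)
  have hnR : (0 : ℝ) < n := Nat.cast_pos.2 (by lia)
  obtain ⟨c, hc⟩ := IsAlgClosed.exists_pow_nat_eq (-(n * a)⁻¹) (show 0 < n by lia)
  have hc0 : c ≠ 0 := by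
    rintro rfl
    rw [zero_pow (by lia)] at hc
    exact neg_ne_zero.2 (inv_ne_zero (mul_ne_zero hn0 ha)) hc.symm
  have hnac : n * a * c ^ n = -1 := by rw [hc]; field_simp
  have hlog : ∀ᶠ z in 𝓝 (0 : ℂ), p z ≠ 0 ∧ n * |(Complex.log (p z)).im| < Real.pi / 4 := by
    refine (hp.eventually_ne (by rw [hp0]; exact one_ne_zero)).and ?_
    have h1 : ContinuousAt (fun z ↦ (n : ℝ) * |(Complex.log (p z)).im|) 0 := by
      refine ContinuousAt.const_mul (ContinuousAt.abs ?_) _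
      exact Complex.continuous_im.continuousAt.comp
        (hp.clog (by rw [hp0]; exact Complex.one_mem_slitPlane))
    refine h1.eventually_lt_const ?_
    simp [hp0, Real.pi_pos]
  have hqb : ∀ᶠ z in 𝓝 (0 : ℂ), ‖q z‖ < ‖q 0‖ + 1 :=
    hq.continuousAt.norm.eventually_lt_const (by linarith)
  obtain ⟨r, hr, hball⟩ := Metric.eventually_nhds_iff_ball.1
    (((hev.and hlog).and (hqb.and hq.eventually_analyticAt)).and hS)
  set ψ : ℂ → ℂ := fun w ↦ c * Complex.exp (-(Complex.log w) / n) with hψ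
  set E : ℂ → ℂ := fun w ↦ w * ψ w ^ (n + 1) * q (ψ w) with hEdef
  set s : ℝ := (n : ℝ)⁻¹ with hs
  have hs0 : 0 < s := inv_pos.2 hnR
  have hψ0 : ∀ w, ψ w ≠ 0 := fun w ↦ mul_ne_zero hc0 (Complex.exp_ne_zero _)
  have hψn : ∀ w, w ≠ 0 → ψ w ^ n = c ^ n / w := by
    intro w hw
    simp only [hψ]
    rw [mul_pow, ← Complex.exp_nat_mul, mul_div_cancel₀ _ hn0, Complex.exp_neg,
      Complex.exp_log hw, div_eq_mul_inv]
  have hψnorm : ∀ w, w ≠ 0 → ‖ψ w‖ = ‖c‖ * ‖w‖ ^ (-s) := by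
    intro w hw
    simp only [hψ]
    rw [norm_mul, Complex.norm_exp, Real.rpow_def_of_pos (norm_pos_iff.2 hw)]
    congr 2
    rw [← Complex.ofReal_natCast, Complex.div_ofReal_re, Complex.neg_re, Complex.log_re, hs]
    field_simp
  have hlim : Tendsto (fun x : ℝ ↦ ‖c‖ * x ^ (-s)) atTop (𝓝 0) := by
    simpa using (tendsto_rpow_neg_atTop hs0).const_mul ‖c‖
  obtain ⟨B, hB0, hB⟩ : ∃ B, 0 < B ∧ ∀ x, B ≤ x → ‖c‖ * x ^ (-s) < r := by
    obtain ⟨B, hB⟩ := ((hlim.eventually_lt_const hr).and (eventually_gt_atTop 0)).exists_forall_of_atTop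
    exact ⟨B, (hB B le_rfl).2, fun x hx ↦ (hB x hx).1⟩
  have hW0 : sectorCompl (2 * B) ⊆ sectorCompl 0 := fun w (hw : 2 * B < w.re + |w.im|) ↦ by
    change (0 : ℝ) < w.re + |w.im|
    linarith
  have hslit := hW0.trans sectorCompl_subset_slitPlane
  have hne : ∀ w ∈ sectorCompl (2 * B), w ≠ 0 := fun w hw ↦
    Complex.slitPlane_ne_zero (hslit hw)
  have hψball : ∀ w ∈ sectorCompl (2 * B), ψ w ∈ Metric.ball 0 r := by
    intro w hw
    rw [mem_ball_zero_iff, hψnorm w (hne w hw)]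
    have hw' : 2 * B < w.re + |w.im| := hw
    exact hB _ (by linarith [re_add_abs_im_le w])
  have hψd : DifferentiableOn ℂ ψ (sectorCompl (2 * B)) := fun w hw ↦
    ((((Complex.differentiableAt_log (hslit hw)).neg.div_const _).cexp).const_mul
      c).differentiableWithinAt
  refine ⟨ψ, fun z ↦ c ^ n / z ^ n, E, 2 * B, ‖c‖ ^ n * ‖c‖ * (‖q 0‖ + 1), s, by positivity,
    hs0, by positivity, hψd, ?_, ?_, ?_, ?_, ?_⟩
  · exact (differentiableOn_const _).div (differentiableOn_id.pow n) fun z hz ↦ pow_ne_zero n hz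
  · intro w hw
    have h1 := hψd.differentiableAt ((isOpen_sectorCompl _).mem_nhds hw)
    have h2 := ((hball _ (hψball w hw)).1.2.2.differentiableAt).comp w h1
    exact ((differentiableAt_id.mul (h1.pow _)).mul h2).differentiableWithinAt
  · intro w hw
    have h1 := (hball _ (hψball w hw)).1.2.1.le
    have h2 : w * ψ w ^ (n + 1) = c ^ n * ψ w := by
      rw [pow_succ, hψn w (hne w hw)]
      field_simp [hne w hw]
    simp only [hEdef]
    rw [h2, norm_mul, norm_mul, norm_pow, hψnorm w (hne w hw)]
    calc ‖c‖ ^ n * (‖c‖ * ‖w‖ ^ (-s)) * ‖q (ψ w)‖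
        ≤ ‖c‖ ^ n * (‖c‖ * ‖w‖ ^ (-s)) * (‖q 0‖ + 1) := by gcongr
      _ = _ := by ring
  · rw [tendsto_zero_iff_norm_tendsto_zero]
    refine (hlim.comp tendsto_natCast_atTop_atTop).congr' ?_
    filter_upwards [eventually_gt_atTop 0] with k hk
    rw [hψnorm _ (Nat.cast_ne_zero.2 hk.ne'), Complex.norm_natCast]
    rfl
  · intro w hw
    obtain ⟨⟨⟨⟨hf1, hf2⟩, hp1, hp2⟩, -⟩, hSz⟩ := hball _ (hψball w hw)
    refine ⟨hψ0 w, hSz, ?_, ?_⟩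
    · simp only [hψn w (hne w hw)]
      rw [div_div_cancel₀ (pow_ne_zero n hc0)]
    · have hF : w + 1 + E w = Complex.exp (Complex.log w - n * Complex.log (p (ψ w))) := by
        rw [Complex.exp_sub, Complex.exp_log (hne w hw), Complex.exp_nat_mul,
          Complex.exp_log hp1, div_eq_mul_inv, hf2]
        have h3 : w * ψ w ^ n = c ^ n := by
          rw [hψn w (hne w hw)]; field_simp [hne w hw]
        simp only [hEdef]
        linear_combination hnac + n * a * h3
      have him : |(Complex.log w - n * Complex.log (p (ψ w))).im| < Real.pi := by
        rw [Complex.sub_im, Complex.log_im w, ← Complex.ofReal_natCast, Complex.im_ofReal_mul]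
        refine (abs_sub _ _).trans_lt ?_
        rw [abs_mul, abs_of_pos hnR]
        linarith [abs_arg_le_of_mem_sectorCompl (hW0 hw)]
      rw [abs_lt] at him
      have hlogF : Complex.log (w + 1 + E w) = Complex.log w - n * Complex.log (p (ψ w)) := by
        rw [hF, Complex.log_exp him.1 him.2.le]
      rw [hf1]
      change _ = c * Complex.exp (-(Complex.log (w + 1 + E w)) / n)
      rw [hlogF, neg_sub, sub_div, mul_div_cancel_left₀ _ hn0, sub_eq_add_neg, Complex.exp_add,
        Complex.exp_log hp1, ← neg_div]
      ring

theorem isConnected_sectorCompl (R : ℝ) : IsConnected (sectorCompl R) := by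
  set x₀ : ℂ := ((|R| + 1 : ℝ) : ℂ) with hx₀
  have hx₀re : x₀.re = |R| + 1 := Complex.ofReal_re _
  have hx₀im : x₀.im = 0 := Complex.ofReal_im _
  have hstar : StarConvex ℝ x₀ (sectorCompl R) := by
    intro w hw t u ht hu htu
    have hw' : R < w.re + |w.im| := hw
    change R < _
    simp only [Complex.add_re, Complex.add_im, Complex.smul_re, Complex.smul_im, smul_eq_mul,
      hx₀re, hx₀im, mul_zero, zero_add, abs_mul, abs_of_nonneg hu]
    have h1 : R < |R| + 1 := by linarith [le_abs_self R]
    have h2 : u * R ≤ u * (w.re + |w.im|) := mul_le_mul_of_nonneg_left hw'.le hu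
    have h3 : t * R ≤ t * (|R| + 1) := mul_le_mul_of_nonneg_left h1.le ht
    have h4 : R = t * R + u * R := by rw [← add_mul, htu, one_mul]
    rcases ht.eq_or_lt with rfl | ht'
    · rw [zero_add] at htu; subst htu; linarith
    · linarith [mul_lt_mul_of_pos_left h1 ht']
  have hmem : x₀ ∈ sectorCompl R :=
    mem_sectorCompl_of_lt_re (by rw [hx₀re]; linarith [le_abs_self R])
  exact (hstar.isPathConnected hmem).isConnected

theorem isAttractingPetal_image {f ψ φ E : ℂ → ℂ} {N S : Set ℂ} {R : ℝ}
    (hf0 : f 0 = 0) (hS : IsCompact S) (hSN : S ⊆ N ∩ f '' N)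
    (hψd : DifferentiableOn ℂ ψ (sectorCompl (R - 1))) (hφd : DifferentiableOn ℂ φ {0}ᶜ)
    (hψlim : Tendsto (fun k : ℕ ↦ ψ k) atTop (𝓝 0))
    (hsmall : ∀ w ∈ sectorCompl (R - 1), ‖E w‖ ≤ 1 / 200)
    (hψ : ∀ w ∈ sectorCompl (R - 1),
      ψ w ≠ 0 ∧ ψ w ∈ S ∧ φ (ψ w) = w ∧ f (ψ w) = ψ (w + 1 + E w)) :
    IsAttractingPetal f N (ψ '' sectorCompl R) := by
  have hWle : {w : ℂ | R ≤ w.re + |w.im|} ⊆ sectorCompl (R - 1) :=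
    fun w (hw : R ≤ w.re + |w.im|) ↦ by
      change R - 1 < w.re + |w.im|
      linarith
  have hWW : sectorCompl R ⊆ sectorCompl (R - 1) := fun w (hw : R < w.re + |w.im|) ↦
    hWle hw.le
  have hψi : InjOn ψ (sectorCompl (R - 1)) := fun w hw w' hw' h ↦ by
    rw [← (hψ w hw).2.2.1, h, (hψ w' hw').2.2.1]
  have hUS : ψ '' sectorCompl R ⊆ S := by
    rintro _ ⟨w, hw, rfl⟩
    exact (hψ w (hWW hw)).2.1
  have hclS : closure (ψ '' sectorCompl R) ⊆ S := closure_minimal hUS hS.isClosed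
  have hcl : ∀ z ∈ closure (ψ '' sectorCompl R), z ≠ 0 →
      ∃ w ∈ {w : ℂ | R ≤ w.re + |w.im|}, ψ w = z := by
    intro z hz hz0
    obtain ⟨x, hx, hxz⟩ := mem_closure_iff_seq_limit.1 hz
    choose v hv hvx using hx
    have hφz : Tendsto v atTop (𝓝 (φ z)) := by
      have h1 := (hφd.differentiableAt (isOpen_compl_singleton.mem_nhds hz0)).continuousAt
      refine (h1.tendsto.comp hxz).congr fun k ↦ ?_
      rw [Function.comp_apply, ← hvx k, (hψ _ (hWW (hv k))).2.2.1]
    have hclosed : IsClosed {w : ℂ | R ≤ w.re + |w.im|} :=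
      isClosed_le continuous_const (Complex.continuous_re.add Complex.continuous_im.abs)
    have hmem : φ z ∈ {w : ℂ | R ≤ w.re + |w.im|} :=
      hclosed.mem_of_tendsto hφz (Eventually.of_forall fun k ↦
        (show R < (v k).re + |(v k).im| from hv k).le)
    refine ⟨φ z, hmem, ?_⟩
    have h2 := (hψd.differentiableAt
      ((isOpen_sectorCompl _).mem_nhds (hWle hmem))).continuousAt
    refine tendsto_nhds_unique (h2.tendsto.comp hφz) (hxz.congr fun k ↦ ?_)
    rw [Function.comp_apply, hvx k]
  set F : ℂ → ℂ := fun w ↦ w + 1 + E w with hF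
  have hiter : ∀ w ∈ sectorCompl (R - 1), ∀ k : ℕ, F^[k] w ∈ sectorCompl (R - 1) ∧
      f^[k] (ψ w) = ψ (F^[k] w) := by
    intro w hw k
    have hk : F^[k] w ∈ sectorCompl (R - 1) := by
      have h1 : R - 1 < w.re + |w.im| := hw
      have h0 : (0 : ℝ) ≤ k := k.cast_nonneg
      have h2 := (re_iterate_ge hsmall hw k).2.1
      change R - 1 < (F^[k] w).re + |(F^[k] w).im|
      linarith
    refine ⟨hk, ?_⟩
    clear hk
    induction k with
    | zero => rfl
    | succ k ih =>
      have h1 : R - 1 < w.re + |w.im| := hw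
      have h0 : (0 : ℝ) ≤ k := k.cast_nonneg
      have h2 := (re_iterate_ge hsmall hw k).2.1
      have hk : F^[k] w ∈ sectorCompl (R - 1) := by
        change R - 1 < (F^[k] w).re + |(F^[k] w).im|
        linarith
      rw [Function.iterate_succ_apply', Function.iterate_succ_apply', ih, (hψ _ hk).2.2.2]
  have h0cl : (0 : ℂ) ∈ closure (ψ '' sectorCompl R) := by
    refine mem_closure_of_tendsto hψlim ?_
    obtain ⟨K, hK⟩ := exists_nat_gt R
    filter_upwards [eventually_ge_atTop K] with k hk
    refine mem_image_of_mem _ (mem_sectorCompl_of_lt_re (hK.trans_le ?_))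
    rw [Complex.natCast_re]
    exact_mod_cast hk
  refine ⟨?_, (isConnected_sectorCompl R).image ψ (hψd.continuousOn.mono hWW),
    hS.of_isClosed_subset isClosed_closure hclS, hclS.trans hSN, ?_, ?_⟩
  · rw [isOpen_iff_mem_nhds]
    rintro _ ⟨w, hw, rfl⟩
    have hnh := (isOpen_sectorCompl R).mem_nhds hw
    exact nhds_le_map_nhds_of_injOn hnh (hψd.mono hWW) (hψi.mono hWW) (image_mem_map hnh)
  · rintro _ ⟨z, hz, rfl⟩
    by_cases hz0 : z = 0
    · right; rw [hz0, hf0]; rfl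
    · left
      obtain ⟨w, hw, rfl⟩ := hcl z hz hz0
      have hw' : R ≤ w.re + |w.im| := hw
      rw [(hψ w (hWle hw)).2.2.2]
      refine mem_image_of_mem _ ?_
      have h2 := (re_iterate_ge hsmall (hWle hw) 1).2.1
      rw [Nat.cast_one, Function.iterate_one] at h2
      change R < (F w).re + |(F w).im|
      linarith
  · refine Subset.antisymm (fun z hz ↦ ?_) ?_
    · rw [mem_iInter] at hz
      by_contra hz0
      rw [mem_singleton_iff] at hz0
      obtain ⟨k, hk⟩ := exists_nat_gt (2 * ((φ z).re + |(φ z).im| - R))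
      obtain ⟨x, hx, hxz⟩ := hz k
      have hx0 : x ≠ 0 := by
        rintro rfl
        rw [Function.iterate_fixed hf0] at hxz
        exact hz0 hxz.symm
      obtain ⟨w, hw, rfl⟩ := hcl x hx hx0
      have hw' : R ≤ w.re + |w.im| := hw
      obtain ⟨h1, h2⟩ := hiter w (hWle hw) k
      rw [h2] at hxz
      have h3 := (hψ _ h1).2.2.1
      rw [hxz] at h3
      have h4 := (re_iterate_ge hsmall (hWle hw) k).2.1
      rw [h3] at hk
      linarith
    · rw [singleton_subset_iff, mem_iInter]
      exact fun k ↦ ⟨0, h0cl, Function.iterate_fixed hf0 k⟩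

/-- Theorem 7.7 (Leau, Fatou): there is an attracting petal `U` and an injective
holomorphic Fatou coordinate `α : U → ℂ` satisfying the Abel equation
`α (f z) = α z + 1` on `U`, whose image contains a right half-plane; moreover `α` is
unique up to an additive constant. -/
theorem fatou_coordinate (f : ℂ → ℂ) (N : Set ℂ) (hNopen : IsOpen N)
    (hN0 : (0 : ℂ) ∈ N) (hf : DifferentiableOn ℂ f N) (hinj : Set.InjOn f N)
    (hf0 : f 0 = 0) (hf'0 : deriv f 0 = 1) (n : ℕ) (hn : 1 ≤ n)
    (hvan : ∀ k ≤ n, iteratedDeriv k (fun z => f z - z) 0 = 0)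
    (hnonvan : iteratedDeriv (n + 1) (fun z => f z - z) 0 ≠ 0) :
    ∃ (U : Set ℂ) (α : ℂ → ℂ) (c : ℝ),
      IsAttractingPetal f N U ∧
      DifferentiableOn ℂ α U ∧ Set.InjOn α U ∧
      (∀ z ∈ U, α (f z) = α z + 1) ∧
      {w : ℂ | c < w.re} ⊆ α '' U ∧
      ∀ β : ℂ → ℂ, DifferentiableOn ℂ β U → Set.InjOn β U →
        (∀ z ∈ U, β (f z) = β z + 1) →
        ∃ C : ℂ, ∀ z ∈ U, β z = α z + C := by
  have hfan : AnalyticAt ℂ f 0 := hf.analyticAt (hNopen.mem_nhds hN0)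
  have hfN : N ∩ f '' N ∈ 𝓝 (0 : ℂ) := by
    refine inter_mem (hNopen.mem_nhds hN0) ?_
    have h := nhds_le_map_nhds_of_injOn (hNopen.mem_nhds hN0) hf hinj
      (image_mem_map (hNopen.mem_nhds hN0))
    rwa [hf0] at h
  obtain ⟨r, hr, hrN⟩ := Metric.nhds_basis_closedBall.mem_iff.1 hfN
  obtain ⟨ψ, φ, E, R₀, C, s, hR₀, hs, hC, hψd, hφd, hEd, hEb, hψlim, hψ⟩ :=
    exists_conjugacy_near_infinity hfan hn hvan hnonvan (Metric.closedBall_mem_nhds 0 hr)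
  have hElim : ∀ ε > 0, ∃ B ≥ R₀, ∀ w ∈ sectorCompl B, ‖E w‖ < ε := by
    intro ε hε
    have hlim : Tendsto (fun x : ℝ ↦ C * x ^ (-s)) atTop (𝓝 0) := by
      simpa using (tendsto_rpow_neg_atTop hs).const_mul C
    obtain ⟨x, hx⟩ := (hlim.eventually_lt_const hε).exists_forall_of_atTop
    refine ⟨max R₀ (2 * x), le_max_left _ _, fun w hw ↦ ?_⟩
    have hw' : max R₀ (2 * x) < w.re + |w.im| := hw
    have h1 := (le_max_left _ _).trans_lt hw'
    have h2 := (le_max_right _ _).trans_lt hw'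
    exact (hEb w h1).trans_lt (hx _ (by linarith [re_add_abs_im_le w]))
  obtain ⟨R₁, hR₁, hsmall⟩ := hElim (1 / 200) (by norm_num)
  have hsub : ∀ {A B : ℝ}, A ≤ B → sectorCompl B ⊆ sectorCompl A := fun hAB w hw ↦
    lt_of_le_of_lt hAB hw
  have hsub₁ : sectorCompl R₁ ⊆ sectorCompl R₀ := hsub hR₁
  have hsub₂ : sectorCompl (R₁ + 1) ⊆ sectorCompl R₀ := hsub (by linarith)
  have hsmall₂ : ∀ w ∈ sectorCompl (R₁ + 1), ‖E w‖ ≤ 1 / 200 := fun w hw ↦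
    (hsmall w (hsub (by linarith) hw)).le
  obtain ⟨l, hl0, hls, M, hlip⟩ := exists_summable_lipschitz hs hC hEd hEb
  have hFW : ∀ w ∈ sectorCompl (R₁ + 1), w + 1 + E w ∈ sectorCompl (R₁ + 1) := fun w hw ↦ by
    have h1 : R₁ + 1 < w.re + |w.im| := hw
    have h2 := (re_iterate_ge hsmall₂ hw 1).2.1
    rw [Nat.cast_one, Function.iterate_one] at h2
    change R₁ + 1 < (w + 1 + E w).re + |(w + 1 + E w).im|
    linarith
  have hFi : InjOn (fun w ↦ w + 1 + E w) (sectorCompl (R₁ + 1)) := by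
    intro w hw w' hw' h
    obtain ⟨-, hS, hφw, hfw⟩ := hψ w (hsub₂ hw)
    obtain ⟨-, hS', hφw', hfw'⟩ := hψ w' (hsub₂ hw')
    have h1 : f (ψ w) = f (ψ w') := by
      rw [hfw, hfw']; exact congrArg ψ h
    rw [← hφw, hinj (hrN hS).1 (hrN hS').1 h1, hφw']
  obtain ⟨α, c, hαd, hαi, hαE, himg⟩ := exists_fatou_coordinate_near_infinity (hEd.mono hsub₂)
    hsmall₂ hl0 hls hlip (fun ε hε ↦ by
      obtain ⟨B, -, hB⟩ := hElim ε hε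
      exact ⟨B, fun w hw ↦ hB w (mem_sectorCompl_of_lt_re hw)⟩) hFi
  have hpetal : IsAttractingPetal f N (ψ '' sectorCompl (R₁ + 1)) := by
    have hR : R₁ + 1 - 1 = R₁ := add_sub_cancel_right _ _
    refine isAttractingPetal_image (φ := φ) (E := E) hf0 (isCompact_closedBall 0 r) hrN ?_ hφd
      hψlim ?_ ?_ <;> rw [hR]
    · exact hψd.mono hsub₁
    · exact fun w hw ↦ (hsmall w hw).le
    · exact fun w hw ↦ hψ w (hsub₁ hw)
  have hfU : MapsTo f (ψ '' sectorCompl (R₁ + 1)) (ψ '' sectorCompl (R₁ + 1)) := by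
    rintro _ ⟨w, hw, rfl⟩
    exact ⟨_, hFW w hw, (hψ w (hsub₂ hw)).2.2.2.symm⟩
  have hd : DifferentiableOn ℂ (α ∘ φ) (ψ '' sectorCompl (R₁ + 1)) := by
    refine hαd.comp (hφd.mono ?_) ?_
    · rintro _ ⟨w, hw, rfl⟩
      exact (hψ w (hsub₂ hw)).1
    · rintro _ ⟨w, hw, rfl⟩
      rwa [(hψ w (hsub₂ hw)).2.2.1]
  have hi : InjOn (α ∘ φ) (ψ '' sectorCompl (R₁ + 1)) := by
    rintro _ ⟨w, hw, rfl⟩ _ ⟨w', hw', rfl⟩ h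
    rw [Function.comp_apply, Function.comp_apply, (hψ w (hsub₂ hw)).2.2.1,
      (hψ w' (hsub₂ hw')).2.2.1] at h
    rw [hαi hw hw' h]
  have habel : ∀ z ∈ ψ '' sectorCompl (R₁ + 1), (α ∘ φ) (f z) = (α ∘ φ) z + 1 := by
    rintro _ ⟨w, hw, rfl⟩
    rw [Function.comp_apply, Function.comp_apply, (hψ w (hsub₂ hw)).2.2.2,
      (hψ w (hsub₂ hw)).2.2.1, (hψ _ (hsub₂ (hFW w hw))).2.2.1, hαE w hw]
  have himg' : {w : ℂ | c < w.re} ⊆ (α ∘ φ) '' (ψ '' sectorCompl (R₁ + 1)) := by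
    intro ζ hζ
    obtain ⟨w, hw, rfl⟩ := himg hζ
    exact ⟨ψ w, mem_image_of_mem _ hw, by
      rw [Function.comp_apply, (hψ w (hsub₂ hw)).2.2.1]⟩
  exact ⟨_, α ∘ φ, c, hpetal, hd, hi, habel, himg', fun β hβd hβi hβ ↦
    abel_solution_unique hpetal.1 hfU hd hi habel himg' hβd hβi hβ⟩
end

section
/- Let f : ℂ → ℂ be entire with f(0) = 0, f'(0) = 1, and order of vanishing of z ↦ f(z) − z at 0 equal to n + 1 with n ≥ 1. Let U be an attracting petal for f at 0 and let α : U → ℂ be holomorphic with α(f(z)) = α(z) + 1 for all z ∈ U. Let Ω = { z ∈ ℂ : f^{∘k}(z) ∈ U for some k ≥ 0 }. Then Ω is open and there exists a unique holomorphic function A : Ω → ℂ such that A agrees with α on U and A(f(z)) = A(z) + 1 for every z ∈ Ω. -/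
open Filter Topology Set

/-- An Abel equation on a forward-invariant set `s`
can be iterated. -/
theorem abel_iterate {X : Type*} {f : X → X} {s : Set X} {β : X → ℂ} (hs : MapsTo f s s)
    (hβ : ∀ z ∈ s, β (f z) = β z + 1) (k : ℕ) {z : X} (hz : z ∈ s) :
    β (f^[k] z) = β z + k := by
  induction k with
  | zero => simp
  | succ k ih =>
    rw [Function.iterate_succ_apply', hβ _ (hs.iterate k hz), ih]
    push_cast
    ring

/-- The value `α (f^[k] z) - k` does not depend on the entry time `k`. -/
theorem abel_sub_eq {X : Type*} {f : X → X} {U : Set X} {α : X → ℂ} (hU : MapsTo f U U)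
    (hα : ∀ z ∈ U, α (f z) = α z + 1) {j k : ℕ} {z : X} (hj : f^[j] z ∈ U)
    (hk : f^[k] z ∈ U) : α (f^[j] z) - j = α (f^[k] z) - k := by
  have key : ∀ {i : ℕ} (m : ℕ), f^[i] z ∈ U →
      α (f^[m] (f^[i] z)) = α (f^[i] z) + m := fun m hi => abel_iterate hU hα m hi
  have h₁ := key k hj
  have h₂ := key j hk
  rw [← Function.iterate_add_apply] at h₁ h₂
  rw [add_comm j k] at h₂
  linear_combination h₂ - h₁

/-- A petal carrying a solution of the Abel equation is mapped into itself: the fixed point `0`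
does not lie in it. -/
theorem IsAttractingPetal.mapsTo {f : ℂ → ℂ} {N U : Set ℂ} (hU : IsAttractingPetal f N U)
    (hf0 : f 0 = 0) (hN0 : (0 : ℂ) ∈ N) (hinj : InjOn f N) {α : ℂ → ℂ}
    (habel : ∀ z ∈ U, α (f z) = α z + 1) : MapsTo f U U := by
  obtain ⟨-, -, -, hsub, himg, -⟩ := hU
  intro z hz
  have hzc := subset_closure hz
  rcases himg (mem_image_of_mem f hzc) with h | h
  · exact h
  · have hz0 : z = 0 := hinj (hsub hzc).1 hN0 (h.trans hf0.symm)
    subst hz0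
    have := habel 0 hz
    rw [hf0] at this
    simp at this

/-- Corollary 7.9: the Fatou coordinate `α` on an attracting petal `U` of an entire
map `f` extends uniquely to a holomorphic map `A` on the parabolic basin
`Ω = { z : f^[k] z ∈ U for some k }`, still satisfying the Abel equation. -/
theorem fatou_coordinate_extends (f : ℂ → ℂ) (hf : Differentiable ℂ f)
    (hf0 : f 0 = 0) (hf'0 : deriv f 0 = 1) (n : ℕ) (hn : 1 ≤ n)
    (hvan : ∀ k ≤ n, iteratedDeriv k (fun z => f z - z) 0 = 0)
    (hnonvan : iteratedDeriv (n + 1) (fun z => f z - z) 0 ≠ 0)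
    (N : Set ℂ) (hNopen : IsOpen N) (hN0 : (0 : ℂ) ∈ N) (hinj : Set.InjOn f N)
    (U : Set ℂ) (hU : IsAttractingPetal f N U)
    (α : ℂ → ℂ) (hα : DifferentiableOn ℂ α U)
    (habel : ∀ z ∈ U, α (f z) = α z + 1) :
    IsOpen {z : ℂ | ∃ k : ℕ, f^[k] z ∈ U} ∧
    ∃ A : ℂ → ℂ,
      (DifferentiableOn ℂ A {z : ℂ | ∃ k : ℕ, f^[k] z ∈ U} ∧
        Set.EqOn A α U ∧
        ∀ z ∈ {z : ℂ | ∃ k : ℕ, f^[k] z ∈ U}, A (f z) = A z + 1) ∧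
      ∀ B : ℂ → ℂ,
        (DifferentiableOn ℂ B {z : ℂ | ∃ k : ℕ, f^[k] z ∈ U} ∧
          Set.EqOn B α U ∧
          ∀ z ∈ {z : ℂ | ∃ k : ℕ, f^[k] z ∈ U}, B (f z) = B z + 1) →
        Set.EqOn B A {z : ℂ | ∃ k : ℕ, f^[k] z ∈ U} := by
  have hUo : IsOpen U := hU.1
  have hmaps : MapsTo f U U := hU.mapsTo hf0 hN0 hinj habel
  have hopen (k : ℕ) : IsOpen (f^[k] ⁻¹' U) := hUo.preimage (hf.iterate k).continuous
  refine ⟨?_, ?_⟩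
  · rw [ofPred_exists]
    exact isOpen_iUnion hopen
  set Ω : Set ℂ := {z : ℂ | ∃ k : ℕ, f^[k] z ∈ U}
  have hmapsΩ : MapsTo f Ω Ω := by
    rintro z ⟨k, hk⟩
    refine ⟨k, ?_⟩
    rw [← Function.iterate_succ_apply, Function.iterate_succ_apply']
    exact hmaps hk
  classical
  let A : ℂ → ℂ := fun z =>
    if h : ∃ k : ℕ, f^[k] z ∈ U then α (f^[Nat.find h] z) - Nat.find h else 0
  have hA {z : ℂ} {k : ℕ} (hk : f^[k] z ∈ U) : A z = α (f^[k] z) - k := by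
    have h : ∃ k : ℕ, f^[k] z ∈ U := ⟨k, hk⟩
    simp only [A, dif_pos h]
    exact abel_sub_eq hmaps habel (Nat.find_spec h) hk
  refine ⟨A, ⟨?_, ?_, ?_⟩, ?_⟩
  · rintro z ⟨k, hk⟩
    have hd : DifferentiableAt ℂ (fun w => α (f^[k] w) - k) z :=
      ((hα.differentiableAt (hUo.mem_nhds hk)).comp z (hf.iterate k z)).sub_const _
    refine (hd.congr_of_eventuallyEq ?_).differentiableWithinAt
    filter_upwards [(hopen k).mem_nhds hk] with w hw using hA hw
  · intro z hz
    simpa using hA (k := 0) hz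
  · rintro z ⟨k, hk⟩
    have hk' : f^[k + 1] z ∈ U := by
      rw [Function.iterate_succ_apply']
      exact hmaps hk
    rw [hA hk', hA (z := f z) (k := k) hk', Function.iterate_succ_apply]
    push_cast
    ring
  · rintro B ⟨-, hBU, hB⟩ z ⟨k, hk⟩
    rw [hA hk, ← hBU hk, abel_iterate hmapsΩ hB k ⟨k, hk⟩]
    ring
end

section
/- Let ξ be a real irrational number satisfying a Diophantine condition: there exist κ ≥ 2 and ε > 0 such that |ξ − p/q| > ε / q^κ for every integer p and every positive integer q. Let f be holomorphic on a neighborhood of 0 in ℂ with f(0) = 0 and f'(0) = exp(2πiξ). Then f is locally linearizable: there exists h holomorphic on a neighborhood of 0 with h(0) = 0 and h'(0) = 1 such that f(h(w)) = h(exp(2πiξ)·w) for all w in some neighborhood of 0. -/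
open Filter Topology

/-- A Diophantine angle yields a polynomial lower bound on the small divisors `‖λ ^ m - 1‖`. -/
theorem exists_small_divisor_bound {ξ κ ε : ℝ} (hε : 0 < ε)
    (hdio : ∀ p : ℤ, ∀ q : ℕ, 0 < q → ε / (q : ℝ) ^ κ < |ξ - (p : ℝ) / (q : ℝ)|) :
    ∃ k : ℕ, ∃ c : ℝ, 0 < c ∧ ∀ m : ℕ, 0 < m →
      c / (m : ℝ) ^ k ≤ ‖Complex.exp (2 * Real.pi * Complex.I * ξ) ^ m - 1‖ := by
  obtain ⟨k, hk⟩ := exists_nat_ge κ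
  refine ⟨k, 4 * ε, by positivity, fun m hm => ?_⟩
  have hm1 : (1 : ℝ) ≤ m := by exact_mod_cast hm
  have hm0 : (0 : ℝ) < m := by linarith
  set p : ℤ := round ((m : ℝ) * ξ) with hp
  set x : ℝ := m * ξ - p with hx
  have hx2 : |x| ≤ 1 / 2 := abs_sub_round _
  have h1 : ε / (m : ℝ) ^ k ≤ |x| := by
    have h2 : ξ - (p : ℝ) / m = x / m := by rw [hx]; field_simp
    have h3 := (hdio p m hm).le
    rw [h2, abs_div, abs_of_pos hm0] at h3
    have h4 : (m : ℝ) ^ κ ≤ (m : ℝ) ^ k := by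
      rw [← Real.rpow_natCast]; exact Real.rpow_le_rpow_of_exponent_le hm1 hk
    calc ε / (m : ℝ) ^ k ≤ ε / (m : ℝ) ^ κ := by gcongr
      _ ≤ |x| / m := h3
      _ ≤ |x| := div_le_self (abs_nonneg _) hm1
  have h5 : Complex.exp (2 * Real.pi * Complex.I * ξ) ^ m
      = Complex.exp (Complex.I * ((2 * Real.pi * x : ℝ) : ℂ)) := by
    rw [← Complex.exp_nat_mul, Complex.exp_eq_exp_iff_exists_int]
    refine ⟨p, ?_⟩
    rw [hx]; push_cast; ring
  rw [h5, Complex.norm_exp_I_mul_ofReal_sub_one, norm_mul, Real.norm_eq_abs, Real.norm_eq_abs]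
  have h6 : 2 * Real.pi * x / 2 = Real.pi * x := by ring
  have h7 := Real.mul_abs_le_abs_sin (x := Real.pi * x) (by
    rw [abs_mul, abs_of_pos Real.pi_pos]; nlinarith [Real.pi_pos])
  rw [abs_mul, abs_of_pos Real.pi_pos] at h7
  have h8 : 2 / Real.pi * (Real.pi * |x|) = 2 * |x| := by field_simp
  rw [h6, abs_two, mul_div_assoc]
  linarith

/-- Solution of the linear cohomological equation `λ u(z) - u(λ z) = g(z)` on a smaller disc. -/
theorem exists_cohomological_solution {l : ℂ} (hl : ‖l‖ = 1) {k : ℕ} {c : ℝ} (hc : 0 < c)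
    (hsd : ∀ m : ℕ, 0 < m → c / (m : ℝ) ^ k ≤ ‖l ^ m - 1‖)
    {g : ℂ → ℂ} {R K δ : ℝ} (hR : R ≤ 1) (hδ : 0 < δ) (hδR : δ < R)
    (hg : DifferentiableOn ℂ g (Metric.ball 0 R)) (hg0 : g 0 = 0) (hg1 : deriv g 0 = 0)
    (hK : ∀ z ∈ Metric.ball (0 : ℂ) R, ‖g z‖ ≤ K) :
    ∃ u : ℂ → ℂ, DifferentiableOn ℂ u (Metric.ball 0 (R - δ)) ∧ u 0 = 0 ∧ deriv u 0 = 0 ∧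
      ∀ z ∈ Metric.ball (0 : ℂ) (R - δ), l * u z - u (l * z) = g z ∧
        ‖u z‖ ≤ K * k.factorial / c / (δ / 2) ^ (k + 1) := by
  set s : ℝ := R - δ / 2 with hs
  have hs0 : 0 < s := by linarith
  have hK0 : 0 ≤ K := (norm_nonneg _).trans (hK 0 (by simp; linarith))
  set b : ℕ → ℂ := fun n => (n.factorial : ℂ)⁻¹ * iteratedDeriv n g 0 with hb
  have hbn : ∀ n, ‖b n‖ ≤ K / s ^ n := by
    intro n
    have hsub : Metric.closedBall (0 : ℂ) s ⊆ Metric.ball 0 R :=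
      Metric.closedBall_subset_ball (by linarith)
    have := Complex.norm_iteratedDeriv_le_of_forall_mem_sphere_norm_le (c := 0) (f := g) n hs0
      ((hg.mono hsub).diffContOnCl_ball subset_rfl)
      (fun z hz => hK z (hsub (Metric.sphere_subset_closedBall hz)))
    have hf : (0 : ℝ) < n.factorial := by exact_mod_cast n.factorial_pos
    rw [hb]
    simp only [norm_mul, norm_inv, Complex.norm_natCast]
    rw [inv_mul_le_iff₀ hf]
    rwa [← mul_div_assoc]
  have hgs : ∀ z ∈ Metric.ball (0 : ℂ) R, HasSum (fun n => b n * z ^ n) (g z) := by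
    intro z hz
    have e : (fun n => b n * z ^ n)
        = fun n => (n.factorial : ℂ)⁻¹ • (z - 0) ^ n • iteratedDeriv n g 0 := by
      funext n
      simp only [hb, sub_zero, smul_eq_mul]
      ring
    rw [e]
    exact Complex.hasSum_taylorSeries_on_ball hg hz
  set a : ℕ → ℂ := fun m => b (m + 2) / (l - l ^ (m + 2)) with ha
  have hl0 : l ≠ 0 := by rintro rfl; simp at hl
  have hdn : ∀ m : ℕ, c / ((m : ℝ) + 1) ^ k ≤ ‖l - l ^ (m + 2)‖ := by
    intro m
    have h1 := hsd (m + 1) (by omega)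
    have h2 : l - l ^ (m + 2) = -(l * (l ^ (m + 1) - 1)) := by ring
    rw [h2, norm_neg, norm_mul, hl, one_mul]
    exact_mod_cast h1
  have hdne : ∀ m : ℕ, l - l ^ (m + 2) ≠ 0 := by
    intro m
    rw [← norm_pos_iff]
    exact lt_of_lt_of_le (by positivity) (hdn m)
  set x : ℝ := 1 - δ / 2 with hx
  have hx0 : 0 < x := by linarith
  have hx1 : ‖x‖ < 1 := by rw [Real.norm_eq_abs, abs_of_pos hx0]; linarith
  set B : ℝ := K * k.factorial / c / s ^ 2 with hB
  have hB0 : 0 ≤ B := by positivity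
  have hterm : ∀ m : ℕ, ∀ z ∈ Metric.ball (0 : ℂ) (R - δ),
      ‖a m * z ^ m‖ ≤ B * (((m + k).choose k : ℝ) * x ^ m) := by
    intro m z hz
    rw [mem_ball_zero_iff] at hz
    have hzx : ‖z‖ ≤ x * s := by rw [hx, hs]; nlinarith
    have h1 : ((m : ℝ) + 1) ^ k ≤ k.factorial * ((m + k).choose k : ℝ) := by
      have := Nat.pow_succ_le_ascFactorial (m + 1) k
      rw [Nat.ascFactorial_eq_factorial_mul_choose] at this
      exact_mod_cast this
    have h2 : ‖a m‖ ≤ K / s ^ (m + 2) * (((m : ℝ) + 1) ^ k / c) := by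
      rw [ha]
      simp only [norm_div]
      rw [div_eq_mul_inv]
      gcongr
      · exact hbn _
      · rw [inv_le_comm₀ (norm_pos_iff.2 (hdne m)) (by positivity), inv_div]
        exact hdn m
    rw [norm_mul, norm_pow]
    calc ‖a m‖ * ‖z‖ ^ m
        ≤ (K / s ^ (m + 2) * ((k.factorial * ((m + k).choose k : ℝ)) / c)) * (x * s) ^ m := by
          gcongr
          exact h2.trans (by gcongr)
      _ = B * (((m + k).choose k : ℝ) * x ^ m) := by
          rw [hB, mul_pow, pow_add]; field_simp
  have hsum := (hasSum_choose_mul_geometric_of_norm_lt_one k hx1).mul_left B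
  have hsa : ∀ z ∈ Metric.ball (0 : ℂ) (R - δ), Summable fun m => a m * z ^ m := fun z hz =>
    Summable.of_norm_bounded hsum.summable (fun m => hterm m z hz)
  set v : ℂ → ℂ := fun z => ∑' m, a m * z ^ m with hv
  have hvd : DifferentiableOn ℂ v (Metric.ball 0 (R - δ)) :=
    Complex.differentiableOn_tsum_of_summable_norm hsum.summable
      (fun m => (by fun_prop : Differentiable ℂ fun z : ℂ => a m * z ^ m).differentiableOn)
      Metric.isOpen_ball hterm
  refine ⟨fun z => z ^ 2 * v z, by fun_prop, by simp, ?_, fun z hz => ⟨?_, ?_⟩⟩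
  · have h1 : DifferentiableAt ℂ v 0 :=
      hvd.differentiableAt (Metric.ball_mem_nhds _ (by linarith))
    have h2 : HasDerivAt (fun z => z ^ 2 * v z) _ 0 :=
      (hasDerivAt_pow 2 (0 : ℂ)).mul h1.hasDerivAt
    simpa using h2.deriv
  · have hlz : l * z ∈ Metric.ball (0 : ℂ) (R - δ) := by
      simpa [mem_ball_zero_iff, hl] using hz
    have hzR : z ∈ Metric.ball (0 : ℂ) R := Metric.ball_subset_ball (by linarith) hz
    have e1 := ((hsa z hz).hasSum.mul_left (l * z ^ 2)).sub
      ((hsa _ hlz).hasSum.mul_left ((l * z) ^ 2))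
    have e2 := (hasSum_nat_add_iff' 2).2 (hgs z hzR)
    have hb0 : b 0 = 0 := by simp [hb, hg0]
    have hb1 : b 1 = 0 := by simp [hb, hg1]
    simp only [Finset.sum_range_succ, Finset.sum_range_zero, hb0, hb1, zero_mul, add_zero,
      sub_zero] at e2
    have e3 : ∀ m, l * z ^ 2 * (a m * z ^ m) - (l * z) ^ 2 * (a m * (l * z) ^ m)
        = b (m + 2) * z ^ (m + 2) := by
      intro m
      have : a m * (l - l ^ (m + 2)) = b (m + 2) := div_mul_cancel₀ _ (hdne m)
      rw [← this]; ring
    simp only [e3] at e1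
    have := e1.unique e2
    rw [← this]
    simp only [hv]; ring
  · have h1 : ‖v z‖ ≤ B * (1 / (1 - x) ^ (k + 1)) :=
      tsum_of_norm_bounded hsum (fun m => hterm m z hz)
    rw [mem_ball_zero_iff] at hz
    have hzs : ‖z‖ ≤ s := by linarith
    rw [norm_mul, norm_pow]
    calc ‖z‖ ^ 2 * ‖v z‖ ≤ s ^ 2 * (B * (1 / (1 - x) ^ (k + 1))) := by gcongr
      _ = _ := by
        have : 1 - x = δ / 2 := by rw [hx]; ring
        rw [this, hB]; field_simp

/-- Cauchy's estimate for the first derivative of a function bounded on a larger disc. -/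
theorem norm_deriv_le_of_norm_le_on_ball {g : ℂ → ℂ} {c : ℂ} {R r K : ℝ} (hr : 0 < r)
    (hg : DifferentiableOn ℂ g (Metric.ball c R)) (hK : ∀ z ∈ Metric.ball c R, ‖g z‖ ≤ K)
    {z : ℂ} (hz : z ∈ Metric.ball c (R - r)) : ‖deriv g z‖ ≤ K / r := by
  have hsub : Metric.closedBall z r ⊆ Metric.ball c R :=
    Metric.closedBall_subset_ball' (by rw [Metric.mem_ball] at hz; linarith)
  exact Complex.norm_deriv_le_of_forall_mem_sphere_norm_le hr
    ((hg.mono hsub).diffContOnCl_ball subset_rfl)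
    (fun y hy => hK y (hsub (Metric.sphere_subset_closedBall hy)))

/-- Second-order Taylor estimate for a bounded holomorphic function on a disc of radius `2`. -/
theorem norm_taylor_remainder_le {g : ℂ → ℂ} {w v : ℂ} {K : ℝ}
    (hg : DifferentiableOn ℂ g (Metric.ball w 2)) (hK : ∀ z ∈ Metric.ball w 2, ‖g z‖ ≤ K)
    (hv : ‖v‖ ≤ 1 / 4) : ‖g (w + v) - g w - deriv g w * v‖ ≤ 2 * K * ‖v‖ ^ 2 := by
  have hK0 : 0 ≤ K := (norm_nonneg _).trans (hK w (by simp))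
  have h1 : ∀ z ∈ Metric.ball w 1, ‖deriv g z‖ ≤ K := fun z hz => by
    simpa using norm_deriv_le_of_norm_le_on_ball one_pos hg hK (z := z) (by norm_num; simpa using hz)
  have hg' : DifferentiableOn ℂ (deriv g) (Metric.ball w 1) :=
    (hg.deriv Metric.isOpen_ball).mono (Metric.ball_subset_ball (by norm_num))
  have h2 : ∀ z ∈ Metric.ball w (1 / 2), ‖deriv (deriv g) z‖ ≤ 2 * K := fun z hz => by
    have := norm_deriv_le_of_norm_le_on_ball (r := 1 / 2) (by norm_num) hg' h1 (z := z)
      (by norm_num at hz ⊢; exact hz)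
    linarith
  have hsub : Metric.closedBall w ‖v‖ ⊆ Metric.ball w (1 / 2) :=
    Metric.closedBall_subset_ball (by linarith)
  have h3 : ∀ z ∈ Metric.closedBall w ‖v‖, ‖deriv g z - deriv g w‖ ≤ 2 * K * ‖v‖ := by
    intro z hz
    have := Convex.norm_image_sub_le_of_norm_deriv_le (𝕜 := ℂ) (f := deriv g)
      (s := Metric.ball w (1 / 2)) (x := w) (y := z)
      (fun y hy => hg'.differentiableAt (Metric.isOpen_ball.mem_nhds
        (Metric.ball_subset_ball (by norm_num) hy))) h2 (convex_ball _ _) (by simp) (hsub hz)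
    refine this.trans ?_
    rw [mem_closedBall_iff_norm] at hz
    gcongr
  have h4 := Convex.norm_image_sub_le_of_norm_hasDerivWithin_le (𝕜 := ℂ)
    (f := fun z => g z - deriv g w * z) (f' := fun z => deriv g z - deriv g w)
    (s := Metric.closedBall w ‖v‖) (x := w) (y := w + v)
    (fun z hz => by
      have hd : DifferentiableAt ℂ g z := hg.differentiableAt (Metric.isOpen_ball.mem_nhds
        (Metric.ball_subset_ball (by norm_num) (hsub hz)))
      have h5 : HasDerivAt (fun z => g z - deriv g w * z) (deriv g z - deriv g w * 1) z :=
        hd.hasDerivAt.sub ((hasDerivAt_id z).const_mul (deriv g w))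
      simpa using h5.hasDerivWithinAt)
    h3 (convex_closedBall _ _) (by simp) (by simp)
  have e : g (w + v) - deriv g w * (w + v) - (g w - deriv g w * w)
      = g (w + v) - g w - deriv g w * v := by ring
  rw [e, add_sub_cancel_left] at h4
  calc _ ≤ _ := h4
    _ = _ := by ring

/-- `h` is a tangent-to-identity map on the disc of radius `r` that is `d`-close to the identity
in `C¹` and conjugates `f` to the rotation by `l` up to an error `e`. -/
structure IsApproxLinearization (f : ℂ → ℂ) (l : ℂ) (r d e : ℝ) (h : ℂ → ℂ) : Prop where
  diff : DifferentiableOn ℂ h (Metric.ball 0 r)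
  map_zero : h 0 = 0
  deriv_zero : deriv h 0 = 1
  close : ∀ z ∈ Metric.ball (0 : ℂ) r, ‖h z - z‖ ≤ d
  deriv_close : ∀ z ∈ Metric.ball (0 : ℂ) r, ‖deriv h z - 1‖ ≤ d
  error : ∀ z ∈ Metric.ball (0 : ℂ) r, ‖f (h z) - h (l * z)‖ ≤ e

/-- One Newton step: the linearization error is squared, up to a power of the loss of domain. -/
theorem exists_newton_step {l : ℂ} (hl : ‖l‖ = 1) {k : ℕ} {c : ℝ} (hc : 0 < c)
    (hsd : ∀ m : ℕ, 0 < m → c / (m : ℝ) ^ k ≤ ‖l ^ m - 1‖) :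
    ∃ C : ℝ, 0 < C ∧ ∀ f : ℂ → ℂ, DifferentiableOn ℂ f (Metric.ball 0 4) →
      (∀ z ∈ Metric.ball (0 : ℂ) 4, ‖f z‖ ≤ 5) → f 0 = 0 → deriv f 0 = l →
      ∀ (r δ d e : ℝ) (h : ℂ → ℂ), 0 < δ → δ < r → r ≤ 1 → d ≤ 1 / 2 →
        IsApproxLinearization f l r d e h → C * e / δ ^ (2 * k + 2) ≤ 1 / 4 →
        ∃ h' : ℂ → ℂ, IsApproxLinearization f l (r - δ) (d + C * e / δ ^ (2 * k + 2))
            (C * e / δ ^ (2 * k + 2) * e) h' ∧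
          ∀ z ∈ Metric.ball (0 : ℂ) (r - δ), ‖h' z - h z‖ ≤ C * e / δ ^ (2 * k + 2) := by
  set A : ℝ := 2 * k.factorial / c * 4 ^ (k + 1) with hA
  have hA0 : 0 < A := by positivity
  refine ⟨4 * A + 40 * A ^ 2, by positivity, ?_⟩
  intro f hf hfb hf0 hf1 r δ d e h hδ hδr hr hd hh hsmall
  set C : ℝ := 4 * A + 40 * A ^ 2 with hC
  have hr0 : 0 < r := hδ.trans hδr
  have hδ1 : δ ≤ 1 := by linarith
  have h0r : (0 : ℂ) ∈ Metric.ball (0 : ℂ) r := by simpa using hr0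
  have he0 : 0 ≤ e := (norm_nonneg _).trans (hh.error 0 h0r)
  have hlb : ∀ {ρ : ℝ} {z : ℂ}, z ∈ Metric.ball (0 : ℂ) ρ → l * z ∈ Metric.ball (0 : ℂ) ρ := by
    intro ρ z hz
    simpa [mem_ball_zero_iff, hl] using hz
  have hhd : ∀ z ∈ Metric.ball (0 : ℂ) r, HasDerivAt h (deriv h z) z := fun z hz =>
    (hh.diff.differentiableAt (Metric.isOpen_ball.mem_nhds hz)).hasDerivAt
  have hh'd : DifferentiableOn ℂ (deriv h) (Metric.ball 0 r) := hh.diff.deriv Metric.isOpen_ball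
  have hh2 : ∀ z ∈ Metric.ball (0 : ℂ) r, ‖h z‖ < 2 := by
    intro z hz
    have h1 := hh.close z hz
    rw [mem_ball_zero_iff] at hz
    have := norm_le_norm_add_norm_sub' (h z) z
    linarith
  have hh'u : ∀ z ∈ Metric.ball (0 : ℂ) r, ‖deriv h z‖ ≤ 2 := by
    intro z hz
    have h1 := hh.deriv_close z hz
    have := norm_le_norm_add_norm_sub' (deriv h z) 1
    rw [norm_one] at this
    linarith
  have hh'l : ∀ z ∈ Metric.ball (0 : ℂ) r, 1 / 2 ≤ ‖deriv h z‖ := by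
    intro z hz
    have h1 := hh.deriv_close z hz
    have := norm_le_norm_add_norm_sub (deriv h z) 1
    rw [norm_one] at this
    linarith
  have hh'0 : ∀ z ∈ Metric.ball (0 : ℂ) r, deriv h z ≠ 0 := by
    intro z hz
    rw [← norm_pos_iff]
    exact lt_of_lt_of_le (by norm_num) (hh'l z hz)
  set E : ℂ → ℂ := fun z => f (h z) - h (l * z) with hE
  have hEd : ∀ z ∈ Metric.ball (0 : ℂ) r,
      HasDerivAt E (deriv f (h z) * deriv h z - deriv h (l * z) * l) z := by
    intro z hz
    have h1 : HasDerivAt f (deriv f (h z)) (h z) :=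
      (hf.differentiableAt (Metric.isOpen_ball.mem_nhds (by
        rw [mem_ball_zero_iff]; linarith [hh2 z hz]))).hasDerivAt
    have h2 : HasDerivAt (fun z => l * z) l z := by
      simpa using (hasDerivAt_id z).const_mul l
    exact (h1.comp z (hhd z hz)).sub ((hhd (l * z) (hlb hz)).comp z h2)
  have hEdiff : DifferentiableOn ℂ E (Metric.ball 0 r) := fun z hz =>
    (hEd z hz).differentiableAt.differentiableWithinAt
  have hE0 : E 0 = 0 := by simp [hE, hh.map_zero, hf0]
  have hE'0 : deriv E 0 = 0 := by
    rw [(hEd 0 h0r).deriv]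
    simp [hh.map_zero, hh.deriv_zero, hf1]
  have hden : DifferentiableOn ℂ (fun z => deriv h (l * z)) (Metric.ball 0 r) :=
    hh'd.comp (by fun_prop) (fun z hz => hlb hz)
  have hgd : DifferentiableOn ℂ (fun z => -E z / deriv h (l * z)) (Metric.ball 0 r) :=
    hEdiff.neg.div hden (fun z hz => hh'0 _ (hlb hz))
  have hg1 : deriv (fun z => -E z / deriv h (l * z)) 0 = 0 := by
    have h1 : DifferentiableAt ℂ E 0 := (hEd 0 h0r).differentiableAt
    have h2 : DifferentiableAt ℂ (fun z => deriv h (l * z)) 0 :=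
      hden.differentiableAt (Metric.isOpen_ball.mem_nhds h0r)
    have h3 : HasDerivAt (fun z => -E z / deriv h (l * z)) _ 0 :=
      h1.hasDerivAt.neg.div h2.hasDerivAt (hh'0 _ (hlb h0r))
    rw [h3.deriv]
    simp [hE0, hE'0]
  have hgK : ∀ z ∈ Metric.ball (0 : ℂ) r, ‖-E z / deriv h (l * z)‖ ≤ 2 * e := by
    intro z hz
    rw [norm_div, norm_neg, div_le_iff₀ (norm_pos_iff.2 (hh'0 _ (hlb hz)))]
    have h1 := hh.error z hz
    have h2 := hh'l _ (hlb hz)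
    calc ‖E z‖ ≤ e := h1
      _ = 2 * e * (1 / 2) := by ring
      _ ≤ _ := by gcongr
  obtain ⟨u, hud, hu0, hu1, hu⟩ := exists_cohomological_solution hl hc hsd hr
    (δ := δ / 2) (by linarith) (by linarith) hgd (by simp [hE0]) hg1 hgK
  set U : ℝ := A * e / δ ^ (k + 1) with hU
  have hU0 : 0 ≤ U := by positivity
  have huU : ∀ z ∈ Metric.ball (0 : ℂ) (r - δ / 2), ‖u z‖ ≤ U := by
    intro z hz
    refine (hu z hz).2.trans (le_of_eq ?_)
    have : δ / 2 / 2 = δ / 4 := by ring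
    rw [hU, hA, this, div_pow]
    field_simp
  have hb1 : ∀ {z : ℂ}, z ∈ Metric.ball (0 : ℂ) (r - δ / 2) → z ∈ Metric.ball (0 : ℂ) r :=
    fun hz => Metric.ball_subset_ball (by linarith) hz
  have hb2 : ∀ {z : ℂ}, z ∈ Metric.ball (0 : ℂ) (r - δ) → z ∈ Metric.ball (0 : ℂ) (r - δ / 2) :=
    fun hz => Metric.ball_subset_ball (by linarith) hz
  have hpd : DifferentiableOn ℂ (fun z => deriv h z * u z) (Metric.ball 0 (r - δ / 2)) :=
    (hh'd.mono fun z hz => hb1 hz).mul hud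
  have hpV : ∀ z ∈ Metric.ball (0 : ℂ) (r - δ / 2), ‖deriv h z * u z‖ ≤ 2 * U := by
    intro z hz
    rw [norm_mul]
    exact mul_le_mul (hh'u z (hb1 hz)) (huU z hz) (norm_nonneg _) (by norm_num)
  have hp' : ∀ z ∈ Metric.ball (0 : ℂ) (r - δ), ‖deriv (fun z => deriv h z * u z) z‖
      ≤ 2 * U / (δ / 2) := fun z hz =>
    norm_deriv_le_of_norm_le_on_ball (by linarith) hpd hpV (by rwa [sub_sub, add_halves])
  have hE' : ∀ z ∈ Metric.ball (0 : ℂ) (r - δ), ‖deriv E z‖ ≤ e / (δ / 2) := fun z hz =>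
    norm_deriv_le_of_norm_le_on_ball (by linarith) hEdiff hh.error (hb2 hz)
  have hp1 : δ ^ (2 * k + 2) ≤ δ ^ (k + 2) := pow_le_pow_of_le_one hδ.le hδ1 (by omega)
  have hUδ : U / δ ≤ A * e / δ ^ (2 * k + 2) := by
    have : U / δ = A * e / δ ^ (k + 2) := by rw [hU, div_div, ← pow_succ]
    rw [this]
    gcongr
  have hUle : U ≤ U / δ := by
    rw [le_div_iff₀ hδ]; nlinarith
  have hCe : C * e / δ ^ (2 * k + 2)
      = 4 * (A * e / δ ^ (2 * k + 2)) + 40 * A * (A * e / δ ^ (2 * k + 2)) := by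
    rw [hC]; ring
  have hAe0 : 0 ≤ 40 * A * (A * e / δ ^ (2 * k + 2)) := by positivity
  have hUU : U ^ 2 = A ^ 2 * e / δ ^ (2 * k + 2) * e := by
    rw [hU, div_pow, ← pow_mul]
    have : (k + 1) * 2 = 2 * k + 2 := by ring
    rw [this]; ring
  set T : ℝ := C * e / δ ^ (2 * k + 2) with hT
  have hVT : 2 * U ≤ T := by linarith
  have hVT' : 2 * U / (δ / 2) ≤ T := by
    have : 2 * U / (δ / 2) = 4 * (U / δ) := by ring
    linarith
  have hderiv : ∀ z ∈ Metric.ball (0 : ℂ) (r - δ), HasDerivAt (fun z => h z + deriv h z * u z)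
      (deriv h z + deriv (fun z => deriv h z * u z) z) z := fun z hz =>
    (hhd z (hb1 (hb2 hz))).add
      (hpd.differentiableAt (Metric.isOpen_ball.mem_nhds (hb2 hz))).hasDerivAt
  have h0δ : (0 : ℂ) ∈ Metric.ball (0 : ℂ) (r - δ) := by simpa using hδr
  refine ⟨fun z => h z + deriv h z * u z, ⟨?_, ?_, ?_, ?_, ?_, ?_⟩, ?_⟩
  · exact fun z hz => (hderiv z hz).differentiableAt.differentiableWithinAt
  · simp [hh.map_zero, hu0]
  · rw [(hderiv 0 h0δ).deriv]
    have h1 : DifferentiableAt ℂ (deriv h) 0 :=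
      hh'd.differentiableAt (Metric.isOpen_ball.mem_nhds h0r)
    have h2 : DifferentiableAt ℂ u 0 :=
      hud.differentiableAt (Metric.isOpen_ball.mem_nhds (hb2 h0δ))
    have h3 : HasDerivAt (fun z => deriv h z * u z) _ 0 := h1.hasDerivAt.mul h2.hasDerivAt
    rw [h3.deriv, hu0, hu1, hh.deriv_zero]
    ring
  · intro z hz
    have e1 : h z + deriv h z * u z - z = (h z - z) + deriv h z * u z := by ring
    rw [e1]
    have h1 := hh.close z (hb1 (hb2 hz))
    have h2 := hpV z (hb2 hz)
    exact (norm_add_le _ _).trans (by linarith)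
  · intro z hz
    rw [(hderiv z hz).deriv, add_sub_right_comm]
    have h1 := hh.deriv_close z (hb1 (hb2 hz))
    have h2 := hp' z hz
    exact (norm_add_le _ _).trans (by linarith)
  · intro z hz
    have hzr := hb1 (hb2 hz)
    have hvs := hpV z (hb2 hz)
    have hsub : Metric.ball (h z) 2 ⊆ Metric.ball 0 4 :=
      Metric.ball_subset_ball' (by rw [dist_zero_right]; linarith [hh2 z hzr])
    have hR := norm_taylor_remainder_le (hf.mono hsub) (fun y hy => hfb y (hsub hy))
      (v := deriv h z * u z) (by linarith)
    have hco := (hu z (hb2 hz)).1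
    have hco' : deriv h (l * z) * (l * u z - u (l * z)) = -E z := by
      rw [hco, mul_div_cancel₀ _ (hh'0 _ (hlb hzr))]
    have hE'z := (hEd z hzr).deriv
    have e1 : f (h z + deriv h z * u z) - (h (l * z) + deriv h (l * z) * u (l * z))
        = (f (h z + deriv h z * u z) - f (h z) - deriv f (h z) * (deriv h z * u z))
          + deriv E z * u z := by
      rw [hE'z]
      have : E z = f (h z) - h (l * z) := rfl
      rw [this] at hco'
      linear_combination hco'
    rw [e1]
    have h1 : ‖deriv E z * u z‖ ≤ e / (δ / 2) * U := by
      rw [norm_mul]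
      exact mul_le_mul (hE' z hz) (huU z (hb2 hz)) (norm_nonneg _) (by positivity)
    have h2 : e / (δ / 2) * U = 2 * (U / δ) * e := by field_simp
    have h3 : ‖deriv h z * u z‖ ^ 2 ≤ (2 * U) ^ 2 := by gcongr
    have h4 : 2 * (U / δ) * e ≤ 4 * (A * e / δ ^ (2 * k + 2)) * e := by
      have : 0 ≤ U / δ := by positivity
      gcongr ?_ * e
      linarith
    refine (norm_add_le _ _).trans ?_
    have h5 : T * e = 4 * (A * e / δ ^ (2 * k + 2)) * e
        + 40 * (A ^ 2 * e / δ ^ (2 * k + 2) * e) := by rw [hCe]; ring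
    rw [h5, ← hUU]
    nlinarith
  · intro z hz
    rw [add_sub_cancel_left]
    exact (hpV z (hb2 hz)).trans hVT

theorem IsApproxLinearization.mono {f h : ℂ → ℂ} {l : ℂ} {r r' d d' e e' : ℝ}
    (hh : IsApproxLinearization f l r d e h) (hr : r' ≤ r) (hd : d ≤ d') (he : e ≤ e') :
    IsApproxLinearization f l r' d' e' h where
  diff := hh.diff.mono (Metric.ball_subset_ball hr)
  map_zero := hh.map_zero
  deriv_zero := hh.deriv_zero
  close z hz := (hh.close z (Metric.ball_subset_ball hr hz)).trans hd
  deriv_close z hz := (hh.deriv_close z (Metric.ball_subset_ball hr hz)).trans hd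
  error z hz := (hh.error z (Metric.ball_subset_ball hr hz)).trans he

/-- Maps that are sufficiently close to a rotation with polynomially bounded small divisors are
linearizable on a disc of definite size. -/
theorem exists_linearization_of_close_to_rotation {l : ℂ} (hl : ‖l‖ = 1) {k : ℕ} {c : ℝ}
    (hc : 0 < c) (hsd : ∀ m : ℕ, 0 < m → c / (m : ℝ) ^ k ≤ ‖l ^ m - 1‖) :
    ∃ η : ℝ, 0 < η ∧ ∀ f : ℂ → ℂ, DifferentiableOn ℂ f (Metric.ball 0 4) → f 0 = 0 →
      deriv f 0 = l → (∀ z ∈ Metric.ball (0 : ℂ) 4, ‖f z - l * z‖ ≤ η) →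
      ∃ h : ℂ → ℂ, DifferentiableOn ℂ h (Metric.ball 0 (1 / 2)) ∧ h 0 = 0 ∧ deriv h 0 = 1 ∧
        ∀ z ∈ Metric.ball (0 : ℂ) (1 / 2), f (h z) = h (l * z) := by
  obtain ⟨C, hC, hstep⟩ := exists_newton_step hl hc hsd
  set t : ℕ := 2 * k + 2 with ht
  set θ : ℝ := (1 / 2) ^ (t + 1) with hθ
  have hθ0 : 0 < θ := by positivity
  have hθ1 : θ < 1 := pow_lt_one₀ (by norm_num) (by norm_num) (by omega)
  set η : ℝ := min 1 (θ / (4 * C * 4 ^ t)) with hη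
  have hη0 : 0 < η := lt_min one_pos (by positivity)
  have hηC : C * η * 4 ^ t ≤ θ / 4 := by
    have : η ≤ θ / (4 * C * 4 ^ t) := min_le_right _ _
    rw [le_div_iff₀ (by positivity)] at this
    linarith
  refine ⟨η, hη0, fun f hf hf0 hf1 hfη => ?_⟩
  have hfb : ∀ z ∈ Metric.ball (0 : ℂ) 4, ‖f z‖ ≤ 5 := by
    intro z hz
    have h1 := hfη z hz
    have h2 : η ≤ 1 := min_le_left _ _
    have h3 := norm_le_norm_add_norm_sub' (f z) (l * z)
    rw [mem_ball_zero_iff] at hz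
    rw [norm_mul, hl, one_mul] at h3
    linarith
  have hT : ∀ n : ℕ, C * (η * θ ^ n) / ((1 / 2 : ℝ) ^ (n + 2)) ^ t
      = C * η * 4 ^ t * (1 / 2) ^ n := by
    intro n
    have h1 : θ ^ n = ((1 / 2 : ℝ) ^ n) ^ t * (1 / 2) ^ n := by
      rw [hθ, ← pow_mul, ← pow_mul, ← pow_add]
      congr 1; ring
    have h2 : (4 : ℝ) ^ t * ((1 / 2 : ℝ) ^ (n + 2)) ^ t = ((1 / 2 : ℝ) ^ n) ^ t := by
      rw [← mul_pow]; congr 1; rw [pow_add]; ring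
    rw [div_eq_iff (by positivity), h1, ← h2]
    ring
  let P : ℕ → (ℂ → ℂ) → Prop := fun n h =>
    IsApproxLinearization f l (1 / 2 + (1 / 2) ^ (n + 1)) (1 / 2 - (1 / 2) ^ (n + 1)) (η * θ ^ n) h
  have hnext : ∀ n h, P n h → ∃ h', P (n + 1) h' ∧
      ∀ z ∈ Metric.ball (0 : ℂ) (1 / 2), ‖h' z - h z‖ ≤ (1 / 2) ^ (n + 2) := by
    intro n h hh
    have hn0 : (0 : ℝ) < (1 / 2) ^ n := by positivity
    have hn1 : (1 / 2 : ℝ) ^ n ≤ 1 := pow_le_one₀ (by norm_num) (by norm_num)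
    have p1 : (1 / 2 : ℝ) ^ (n + 1) = (1 / 2) ^ n / 2 := by rw [pow_succ]; ring
    have p2 : (1 / 2 : ℝ) ^ (n + 2) = (1 / 2) ^ n / 4 := by rw [pow_add]; ring
    have hT1 : C * (η * θ ^ n) / ((1 / 2 : ℝ) ^ (n + 2)) ^ t ≤ θ / 4 * (1 / 2) ^ n := by
      rw [hT]; gcongr
    have hT2 : C * (η * θ ^ n) / ((1 / 2 : ℝ) ^ (n + 2)) ^ t ≤ (1 / 2) ^ (n + 2) :=
      hT1.trans (by rw [p2]; nlinarith)
    have hT3 : C * (η * θ ^ n) / ((1 / 2 : ℝ) ^ (n + 2)) ^ t ≤ θ := by nlinarith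
    obtain ⟨h', hh', hd⟩ := hstep f hf hfb hf0 hf1 _ ((1 / 2) ^ (n + 2)) _ _ h (by positivity)
      (by rw [p1, p2]; linarith) (by rw [p1]; linarith) (by rw [p1]; linarith) hh
      (hT2.trans (by rw [p2]; linarith))
    have q : (1 / 2 : ℝ) ^ (n + 1 + 1) = (1 / 2) ^ (n + 2) := rfl
    refine ⟨h', hh'.mono ?_ ?_ ?_, fun z hz => (hd z ?_).trans hT2⟩
    · rw [q, p1, p2]; linarith
    · have hp : (1 / 2 : ℝ) ^ (n + 2) = (1 / 2) ^ (n + 1) - (1 / 2) ^ (n + 2) := by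
        rw [p1, p2]; ring
      rw [q]; linarith
    · calc _ ≤ θ * (η * θ ^ n) := by gcongr
        _ = η * θ ^ (n + 1) := by ring
    · exact Metric.ball_subset_ball (by rw [p1, p2]; linarith) hz
  choose! F hF hFd using hnext
  let H : ℕ → ℂ → ℂ := fun n => Nat.rec id F n
  have hP : ∀ n, P n (H n) := by
    intro n
    induction n with
    | zero =>
      have e0 : (1 / 2 : ℝ) + (1 / 2) ^ (0 + 1) = 1 := by norm_num
      have e1 : (1 / 2 : ℝ) - (1 / 2) ^ (0 + 1) = 0 := by norm_num
      have e2 : η * θ ^ 0 = η := by simp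
      change IsApproxLinearization f l _ _ _ id
      rw [e0, e1, e2]
      refine ⟨differentiableOn_id, rfl, deriv_id _, by simp, by simp, fun z hz => ?_⟩
      exact hfη z (Metric.ball_subset_ball (by norm_num) hz)
    | succ n ih => exact hF n (H n) ih
  have hHd : ∀ n, ∀ z ∈ Metric.ball (0 : ℂ) (1 / 2),
      dist (H n z) (H (n + 1) z) ≤ (1 / 2) / 2 / 2 ^ n := by
    intro n z hz
    rw [dist_comm, dist_eq_norm]
    refine (hFd n (H n) (hP n) z hz).trans (le_of_eq ?_)
    rw [pow_add, one_div_pow]; ring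
  have hlim : ∀ z, ∃ y, z ∈ Metric.ball (0 : ℂ) (1 / 2) →
      Tendsto (fun n => H n z) atTop (𝓝 y) := by
    intro z
    by_cases hz : z ∈ Metric.ball (0 : ℂ) (1 / 2)
    · obtain ⟨y, hy⟩ := cauchySeq_tendsto_of_complete
        (cauchySeq_of_le_geometric_two fun n => hHd n z hz)
      exact ⟨y, fun _ => hy⟩
    · exact ⟨0, fun h => absurd h hz⟩
  choose h hh using hlim
  have hunif : TendstoUniformlyOn H h atTop (Metric.ball (0 : ℂ) (1 / 2)) := by
    rw [Metric.tendstoUniformlyOn_iff]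
    intro ε hε
    have h0 : Tendsto (fun n : ℕ => (1 / 2 : ℝ) / 2 ^ n) atTop (𝓝 0) :=
      tendsto_const_nhds.div_atTop (tendsto_pow_atTop_atTop_of_one_lt one_lt_two)
    filter_upwards [h0.eventually (gt_mem_nhds hε)] with n hn z hz
    rw [dist_comm]
    exact (dist_le_of_le_geometric_two_of_tendsto (fun n => hHd n z hz) (hh z hz) n).trans_lt hn
  have hHdiff : ∀ n, DifferentiableOn ℂ (H n) (Metric.ball 0 (1 / 2)) := fun n =>
    (hP n).diff.mono (Metric.ball_subset_ball (by simp))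
  have hloc := hunif.tendstoLocallyUniformlyOn
  have h0 : (0 : ℂ) ∈ Metric.ball (0 : ℂ) (1 / 2) := by simp
  refine ⟨h, hloc.differentiableOn (Eventually.of_forall hHdiff) Metric.isOpen_ball, ?_, ?_, ?_⟩
  · refine tendsto_nhds_unique (hh 0 h0) ?_
    simp only [(hP _).map_zero, tendsto_const_nhds]
  · refine tendsto_nhds_unique ((hloc.deriv (Eventually.of_forall hHdiff)
      Metric.isOpen_ball).tendsto_at h0) ?_
    simp only [Function.comp_apply, (hP _).deriv_zero, tendsto_const_nhds]
  · intro z hz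
    have hlz : l * z ∈ Metric.ball (0 : ℂ) (1 / 2) := by
      simpa [mem_ball_zero_iff, hl] using hz
    have hzn : ∀ n, z ∈ Metric.ball (0 : ℂ) (1 / 2 + (1 / 2) ^ (n + 1)) := fun n =>
      Metric.ball_subset_ball (by simp) hz
    have hhz : ‖h z - z‖ ≤ 1 / 2 := by
      refine le_of_tendsto ((hh z hz).sub_const z).norm (Eventually.of_forall fun n => ?_)
      exact ((hP n).close z (hzn n)).trans (by simp)
    have hhz4 : h z ∈ Metric.ball (0 : ℂ) 4 := by
      rw [mem_ball_zero_iff] at hz ⊢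
      have := norm_le_norm_add_norm_sub' (h z) z
      linarith
    have hcont : ContinuousAt f (h z) :=
      (hf.differentiableAt (Metric.isOpen_ball.mem_nhds hhz4)).continuousAt
    have l1 : Tendsto (fun n => f (H n z) - H n (l * z)) atTop (𝓝 (f (h z) - h (l * z))) :=
      (hcont.tendsto.comp (hh z hz)).sub (hh _ hlz)
    have l2 : Tendsto (fun n => f (H n z) - H n (l * z)) atTop (𝓝 0) := by
      refine squeeze_zero_norm (fun n => (hP n).error z (hzn n)) ?_
      simpa using (tendsto_pow_atTop_nhds_zero_of_lt_one hθ0.le hθ1).const_mul η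
    exact sub_eq_zero.1 (tendsto_nhds_unique l1 l2)

/-- Siegel's Linearization Theorem: if the irrational angle `ξ` satisfies a
Diophantine condition of some order `κ ≥ 2`, then any holomorphic germ `f` with
`f 0 = 0` and multiplier `e^{2πiξ}` is locally linearizable. -/
theorem siegel_linearization (ξ : ℝ) (hirr : Irrational ξ)
    (hdio : ∃ κ : ℝ, 2 ≤ κ ∧ ∃ ε : ℝ, 0 < ε ∧
      ∀ p : ℤ, ∀ q : ℕ, 0 < q → ε / (q : ℝ) ^ κ < |ξ - (p : ℝ) / (q : ℝ)|)
    (f : ℂ → ℂ) (hf : AnalyticAt ℂ f 0) (hf0 : f 0 = 0)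
    (hmult : deriv f 0 = Complex.exp (2 * Real.pi * Complex.I * ξ)) :
    ∃ h : ℂ → ℂ, AnalyticAt ℂ h 0 ∧ h 0 = 0 ∧ deriv h 0 = 1 ∧
      ∀ᶠ w in 𝓝 (0 : ℂ),
        f (h w) = h (Complex.exp (2 * Real.pi * Complex.I * ξ) * w) := by
  obtain ⟨κ, -, ε, hε, hdio⟩ := hdio
  obtain ⟨k, c, hc, hsd⟩ := exists_small_divisor_bound hε hdio
  have hl : ‖Complex.exp (2 * Real.pi * Complex.I * ξ)‖ = 1 := by
    rw [Complex.norm_exp]; simp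
  set l : ℂ := Complex.exp (2 * Real.pi * Complex.I * ξ) with hldef
  obtain ⟨η, hη, hlin⟩ := exists_linearization_of_close_to_rotation hl hc hsd
  have hfd : HasDerivAt f l 0 := hmult ▸ hf.differentiableAt.hasDerivAt
  have ev := (hasDerivAt_iff_isLittleO.1 hfd).def (show 0 < η / 4 by positivity)
  obtain ⟨ρ, hρ, hball⟩ := Metric.eventually_nhds_iff_ball.1 (ev.and hf.eventually_analyticAt)
  set s : ℝ := ρ / 4 with hs
  have hs0 : 0 < s := by positivity
  have hsc : (s : ℂ) ≠ 0 := by exact_mod_cast hs0.ne'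
  have hns : ‖(s : ℂ)‖ = s := by rw [Complex.norm_real, Real.norm_of_nonneg hs0.le]
  have hsz : ∀ z ∈ Metric.ball (0 : ℂ) 4, (s : ℂ) * z ∈ Metric.ball (0 : ℂ) ρ := by
    intro z hz
    rw [mem_ball_zero_iff] at hz ⊢
    rw [norm_mul, hns, hs]
    nlinarith
  have hmul : ∀ a z : ℂ, HasDerivAt (fun z => a * z) a z := fun a z => by
    simpa using (hasDerivAt_id z).const_mul a
  have hFd : DifferentiableOn ℂ (fun z => (s : ℂ)⁻¹ * f (s * z)) (Metric.ball 0 4) := by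
    intro z hz
    have h1 : DifferentiableAt ℂ f (s * z) := (hball _ (hsz z hz)).2.differentiableAt
    exact ((h1.comp z (hmul s z).differentiableAt).const_mul _).differentiableWithinAt
  have hF1 : deriv (fun z => (s : ℂ)⁻¹ * f (s * z)) 0 = l := by
    have h1 : HasDerivAt f l ((s : ℂ) * 0) := by rwa [mul_zero]
    have h2 : HasDerivAt (fun z => (s : ℂ)⁻¹ * f (s * z)) _ 0 :=
      (h1.comp 0 (hmul s 0)).const_mul (s : ℂ)⁻¹
    rw [h2.deriv]
    field_simp
  have hFη : ∀ z ∈ Metric.ball (0 : ℂ) 4, ‖(s : ℂ)⁻¹ * f (s * z) - l * z‖ ≤ η := by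
    intro z hz
    have h1 := (hball _ (hsz z hz)).1
    simp only [hf0, sub_zero, smul_eq_mul] at h1
    rw [norm_mul, hns] at h1
    have e : (s : ℂ)⁻¹ * f (s * z) - l * z = (s : ℂ)⁻¹ * (f (s * z) - s * z * l) := by
      field_simp
    rw [mem_ball_zero_iff] at hz
    rw [e, norm_mul, norm_inv, hns, inv_mul_le_iff₀ hs0]
    refine h1.trans ?_
    have : η / 4 * (s * ‖z‖) ≤ η / 4 * (s * 4) := by gcongr
    linarith
  obtain ⟨h, hhd, hh0, hh1, hh⟩ :=
    hlin (fun z => (s : ℂ)⁻¹ * f (s * z)) hFd (by simp [hf0]) hF1 hFη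
  have hmem : ∀ᶠ w in 𝓝 (0 : ℂ), (s : ℂ)⁻¹ * w ∈ Metric.ball (0 : ℂ) (1 / 2) := by
    have : Tendsto (fun w : ℂ => (s : ℂ)⁻¹ * w) (𝓝 0) (𝓝 ((s : ℂ)⁻¹ * 0)) :=
      tendsto_id.const_mul _
    rw [mul_zero] at this
    exact this.eventually (Metric.ball_mem_nhds _ (by norm_num))
  have hha : AnalyticAt ℂ h ((s : ℂ)⁻¹ * 0) := by
    rw [mul_zero]
    exact hhd.analyticAt (Metric.ball_mem_nhds _ (by norm_num))
  refine ⟨fun w => s * h ((s : ℂ)⁻¹ * w), ?_, by simp [hh0], ?_, ?_⟩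
  · exact analyticAt_const.mul (hha.comp (f := fun w : ℂ => (s : ℂ)⁻¹ * w)
      (analyticAt_const.mul analyticAt_id))
  · have h1 : HasDerivAt (fun w => (s : ℂ) * h ((s : ℂ)⁻¹ * w)) _ 0 :=
      (hha.differentiableAt.hasDerivAt.comp 0 (hmul (s : ℂ)⁻¹ 0)).const_mul (s : ℂ)
    rw [h1.deriv, mul_zero, hh1, one_mul, mul_inv_cancel₀ hsc]
  · filter_upwards [hmem] with w hw
    have h1 := hh _ hw
    rw [inv_mul_eq_iff_eq_mul₀ hsc] at h1
    rw [h1, mul_left_comm]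
end
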